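/- Let n ≥ 3, let q be a prime power, and let c be a code word of C_{n-1}(n,q) with wt(c) ≤ B_{n,q}. Then c can be written as a linear combination of incidence vectors of hyperplanes all passing through a fixed (n−3)-dimensional subspace of PG(n,q). -/

import Mathlib

open scoped Classical

noncomputable section

namespace PGCode

open Projectivization

/-- The points of `PG(n, q)`, where the field `F` has order `q`. -/
abbrev Pt (F : Type) [Field F] (n : ℕ) := Projectivization F (Fin (n + 1) → F)

variable {F : Type} [Field F]

/-- A point of `PG(n,q)` lies in the projective subspace determined by a linear subspace `W`. -/
def ptIn {n : ℕ} (P : Pt F n) (W : Submodule F (Fin (n + 1) → F)) : Prop :=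
  Projectivization.submodule P ≤ W

/-- The set of points of the projective subspace determined by a linear subspace `W`. -/
def ptsIn {n : ℕ} (W : Submodule F (Fin (n + 1) → F)) : Set (Pt F n) :=
  {P | ptIn P W}

/-- The incidence vector (over `F_p = ZMod p`) of the projective subspace determined by `W`. -/
def incVec (p : ℕ) {n : ℕ} (W : Submodule F (Fin (n + 1) → F)) : Pt F n → ZMod p :=
  fun P => if ptIn P W then (1 : ZMod p) else 0

/-- The code `C_{n-1}(n,q)`: the `F_p`-span of the incidence vectors of all hyperplanes
(projective dimension `n-1`, i.e. linear dimension `n`). -/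
def code (F : Type) [Field F] (p n : ℕ) : Submodule (ZMod p) (Pt F n → ZMod p) :=
  Submodule.span (ZMod p)
    {v | ∃ W : Submodule F (Fin (n + 1) → F), Module.finrank F W = n ∧ v = incVec p W}

/-- The support of a word. -/
def supp {p n : ℕ} (v : Pt F n → ZMod p) : Set (Pt F n) := {P | v P ≠ 0}

/-- The weight of a word. -/
def wt {p n : ℕ} (v : Pt F n → ZMod p) : ℕ := (supp v).ncard

/-- The weight of the restriction of a word to the subspace determined by `W`. -/
def wtRes {p n : ℕ} (c : Pt F n → ZMod p) (W : Submodule F (Fin (n + 1) → F)) : ℕ :=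
  (ptsIn W ∩ supp c).ncard

/-- `θ_m = (q^(m+1) - 1)/(q - 1)`, with `θ_m = 0` for `m < 0`. -/
def theta (q : ℕ) (m : ℤ) : ℕ :=
  if m < 0 then 0 else ∑ i ∈ Finset.range (m.toNat + 1), q ^ i

/-- The bound `B_{n,q}` from the paper. -/
def B (n q : ℕ) : ℝ :=
  if q < 7 ∨ q = 8 ∨ q = 9 ∨ q = 16 ∨ q = 25 ∨ q = 27 ∨ q = 49 then
    2 * (q : ℝ) ^ (n - 1)
  else if q = 7 ∨ q = 11 ∨ q = 13 ∨ q = 17 then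
    (3 * q - Real.sqrt (6 * q) - 1 / 2) * (q : ℝ) ^ (n - 2)
  else if q = 19 ∨ q = 121 then
    (3 * q - Real.sqrt (6 * q) + 9 / 2) * (q : ℝ) ^ (n - 2)
  else if q = 29 ∨ q = 31 ∨ q = 32 then
    (4 * q - 4 * Real.sqrt q - 25 / 2) * (q : ℝ) ^ (n - 2)
  else
    (4 * q - Real.sqrt (8 * q) - 33 / 2) * (q : ℝ) ^ (n - 2)

/-- A line of `PG(n,q)`: a linear subspace of dimension `2`. -/
def IsLine {n : ℕ} (l : Submodule F (Fin (n + 1) → F)) : Prop := Module.finrank F l = 2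

/-- A plane of `PG(n,q)`: a linear subspace of dimension `3`. -/
def IsPlane {n : ℕ} (W : Submodule F (Fin (n + 1) → F)) : Prop := Module.finrank F W = 3

/-- The line `l` is an `α`-secant to `supp c`. -/
def secant {p n : ℕ} (c : Pt F n → ZMod p) (l : Submodule F (Fin (n + 1) → F)) (α : ℕ) : Prop :=
  IsLine l ∧ (ptsIn l ∩ supp c).ncard = α

/-- The restriction of `c` to the plane `W` is a linear combination of at most two lines of `W`. -/
def TwoLineComb (p : ℕ) {n : ℕ} (c : Pt F n → ZMod p) (W : Submodule F (Fin (n + 1) → F)) :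
    Prop :=
  ∃ l₁ l₂ : Submodule F (Fin (n + 1) → F), IsLine l₁ ∧ IsLine l₂ ∧ l₁ ≤ W ∧ l₂ ≤ W ∧
    ∃ a b : ZMod p, ∀ P : Pt F n, ptIn P W → c P = a * incVec p l₁ P + b * incVec p l₂ P

/-- Type `T^△`: the restriction of `c` to the plane `W` is a linear combination (with nonzero
coefficients) of three nonconcurrent lines of `W`. -/
def TypeTri (p : ℕ) {n : ℕ} (c : Pt F n → ZMod p) (W : Submodule F (Fin (n + 1) → F)) : Prop :=
  ∃ l₁ l₂ l₃ : Submodule F (Fin (n + 1) → F),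
    IsLine l₁ ∧ IsLine l₂ ∧ IsLine l₃ ∧ l₁ ≤ W ∧ l₂ ≤ W ∧ l₃ ≤ W ∧
    l₁ ≠ l₂ ∧ l₁ ≠ l₃ ∧ l₂ ≠ l₃ ∧
    (¬ ∃ P : Pt F n, ptIn P l₁ ∧ ptIn P l₂ ∧ ptIn P l₃) ∧
    ∃ a₁ a₂ a₃ : ZMod p, a₁ ≠ 0 ∧ a₂ ≠ 0 ∧ a₃ ≠ 0 ∧
      ∀ P : Pt F n, ptIn P W →
        c P = a₁ * incVec p l₁ P + a₂ * incVec p l₂ P + a₃ * incVec p l₃ P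

/-- Type `T^★`: the restriction of `c` to the plane `W` is a linear combination (with nonzero
coefficients) of three distinct concurrent lines of `W`. -/
def TypeStar (p : ℕ) {n : ℕ} (c : Pt F n → ZMod p) (W : Submodule F (Fin (n + 1) → F)) : Prop :=
  ∃ l₁ l₂ l₃ : Submodule F (Fin (n + 1) → F),
    IsLine l₁ ∧ IsLine l₂ ∧ IsLine l₃ ∧ l₁ ≤ W ∧ l₂ ≤ W ∧ l₃ ≤ W ∧
    l₁ ≠ l₂ ∧ l₁ ≠ l₃ ∧ l₂ ≠ l₃ ∧
    (∃ P : Pt F n, ptIn P l₁ ∧ ptIn P l₂ ∧ ptIn P l₃) ∧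
    ∃ a₁ a₂ a₃ : ZMod p, a₁ ≠ 0 ∧ a₂ ≠ 0 ∧ a₃ ≠ 0 ∧
      ∀ P : Pt F n, ptIn P W →
        c P = a₁ * incVec p l₁ P + a₂ * incVec p l₂ P + a₃ * incVec p l₃ P

/-- The base code word `c₀` of the `T^odd` construction on `PG(2,p)`:
`c₀(0,1,a) = a`, `c₀(1,0,b) = b`, `c₀(1,1,c) = -c`, and `c₀ = 0` elsewhere. -/
def oddBase (p : ℕ) [Fact p.Prime] : Pt (ZMod p) 2 → ZMod p := fun P =>
  if P.rep 0 = 0 ∧ P.rep 1 ≠ 0 then P.rep 2 / P.rep 1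
  else if P.rep 1 = 0 ∧ P.rep 0 ≠ 0 then P.rep 2 / P.rep 0
  else if P.rep 0 = P.rep 1 ∧ P.rep 0 ≠ 0 then -(P.rep 2 / P.rep 0)
  else 0

/-- The line `m : X₀ = 0` of `PG(2,p)`. -/
def lineM1 (p : ℕ) [Fact p.Prime] : Submodule (ZMod p) (Fin 3 → ZMod p) :=
  LinearMap.ker (LinearMap.proj 0 : (Fin 3 → ZMod p) →ₗ[ZMod p] ZMod p)

/-- The line `m' : X₁ = 0` of `PG(2,p)`. -/
def lineM2 (p : ℕ) [Fact p.Prime] : Submodule (ZMod p) (Fin 3 → ZMod p) :=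
  LinearMap.ker (LinearMap.proj 1 : (Fin 3 → ZMod p) →ₗ[ZMod p] ZMod p)

/-- The line `m'' : X₀ = X₁` of `PG(2,p)`. -/
def lineM3 (p : ℕ) [Fact p.Prime] : Submodule (ZMod p) (Fin 3 → ZMod p) :=
  LinearMap.ker ((LinearMap.proj 0 : (Fin 3 → ZMod p) →ₗ[ZMod p] ZMod p) - LinearMap.proj 1)

/-- The code word `d = (γ c₀ + λ m + λ' m' + λ'' m'')^π` of the `T^odd` construction, where the
collineation `π` of `PG(2,p)` is the inverse of the homography induced by the linear
equivalence `g`. -/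
def oddWord (p : ℕ) [Fact p.Prime] (g : (Fin 3 → ZMod p) ≃ₗ[ZMod p] (Fin 3 → ZMod p))
    (γ lam lam' lam'' : ZMod p) : Pt (ZMod p) 2 → ZMod p := fun P =>
  γ * oddBase p (Projectivization.map g.toLinearMap g.injective P) +
    lam * incVec p (lineM1 p) (Projectivization.map g.toLinearMap g.injective P) +
    lam' * incVec p (lineM2 p) (Projectivization.map g.toLinearMap g.injective P) +
    lam'' * incVec p (lineM3 p) (Projectivization.map g.toLinearMap g.injective P)

/-- The semilinear embedding of `PG(2,p)` onto the plane of `PG(n,q)` spanned by the linearly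
independent vectors `b 0, b 1, b 2`, relative to the field embedding `σ : F_p → F`. -/
def planeEmbed {n : ℕ} {p : ℕ} [Fact p.Prime] (σ : ZMod p →+* F)
    (b : Fin 3 → (Fin (n + 1) → F)) (hb : LinearIndependent F b) :
    Pt (ZMod p) 2 → Pt F n := fun P =>
  Projectivization.mk F (∑ i, σ (P.rep i) • b i) (by
    intro hzero
    have h0 : ∀ i ∈ Finset.univ, σ (P.rep i) = 0 :=
      linearIndependent_iff'.mp hb Finset.univ (fun i => σ (P.rep i)) hzero
    have h1 : P.rep = 0 := funext fun i => σ.injective (by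
      simp only [Pi.zero_apply, map_zero]; exact h0 i (Finset.mem_univ i))
    exact P.rep_nonzero h1)

/-- Type `T^odd`: this requires `q = p` to be prime (`|F| = p`), and `c` restricted to the plane
`W` (spanned by the frame `b`) must coincide, via a semilinear identification of `W` with
`PG(2,p)`, with a code word `d` of the `T^odd` construction. -/
def TypeOdd (p : ℕ) [Fact p.Prime] [Fintype F] {n : ℕ} (c : Pt F n → ZMod p)
    (W : Submodule F (Fin (n + 1) → F)) : Prop :=
  Fintype.card F = p ∧
  ∃ (σ : ZMod p →+* F) (b : Fin 3 → (Fin (n + 1) → F)) (hb : LinearIndependent F b),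
    Submodule.span F (Set.range b) = W ∧
    ∃ (g : (Fin 3 → ZMod p) ≃ₗ[ZMod p] (Fin 3 → ZMod p)) (γ lam lam' lam'' : ZMod p), γ ≠ 0 ∧
      ∀ Q : Pt (ZMod p) 2, c (planeEmbed σ b hb Q) = oddWord p g γ lam lam' lam'' Q

/-- The list of plane types `T_0, T_{q+1}, T_{2q}, T_{2q+1}, T^odd, T^△, T^★`. -/
inductive PlaneT : Type where
  | T0 | Tq1 | T2q | T2q1 | Todd | Ttri | Tstar
deriving DecidableEq

/-- The restriction of `c` to the plane `W` is a code word of the given type. -/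
def PlaneIsType (p q : ℕ) [Fact p.Prime] [Fintype F] {n : ℕ} (c : Pt F n → ZMod p)
    (W : Submodule F (Fin (n + 1) → F)) : PlaneT → Prop
  | .T0 => TwoLineComb p c W ∧ wtRes c W = 0
  | .Tq1 => TwoLineComb p c W ∧ wtRes c W = q + 1
  | .T2q => TwoLineComb p c W ∧ wtRes c W = 2 * q
  | .T2q1 => TwoLineComb p c W ∧ wtRes c W = 2 * q + 1
  | .Todd => TypeOdd p c W
  | .Ttri => TypeTri p c W
  | .Tstar => TypeStar p c W

/-- The plane `W` is of type `𝒯`. -/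
def TypeT (p q : ℕ) [Fact p.Prime] [Fintype F] {n : ℕ} (c : Pt F n → ZMod p)
    (W : Submodule F (Fin (n + 1) → F)) : Prop :=
  IsPlane W ∧ ∃ t : PlaneT, PlaneIsType p q c W t

/-- The plane `W` is of type `𝒪`. -/
def TypeO (p q : ℕ) [Fact p.Prime] [Fintype F] {n : ℕ} (c : Pt F n → ZMod p)
    (W : Submodule F (Fin (n + 1) → F)) : Prop :=
  IsPlane W ∧ ¬ TypeT p q c W

/-- The restriction of `c` to the `k`-space `Sp` (linear dimension `k+1`) is of type `t`:
there is a `(k-3)`-space `κ ⊆ Sp` on which `c` is a scalar multiple of the all-one function,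
a plane `π ⊆ Sp` of type `t` disjoint from `κ`, and `c P = c (⟨κ, P⟩ ∩ π)` for every point
`P` of `Sp` outside `κ`. -/
def SpaceIsType (p q : ℕ) [Fact p.Prime] [Fintype F] {n : ℕ} (c : Pt F n → ZMod p)
    (Sp : Submodule F (Fin (n + 1) → F)) (k : ℕ) (t : PlaneT) : Prop :=
  Module.finrank F Sp = k + 1 ∧
  ∃ κ : Submodule F (Fin (n + 1) → F), Module.finrank F κ = k - 2 ∧ κ ≤ Sp ∧
    (∃ a : ZMod p, ∀ P : Pt F n, ptIn P κ → c P = a) ∧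
    ∃ π : Submodule F (Fin (n + 1) → F), IsPlane π ∧ π ≤ Sp ∧ π ⊓ κ = ⊥ ∧
      PlaneIsType p q c π t ∧
      ∀ P : Pt F n, ptIn P Sp → ¬ ptIn P κ →
        ∃ Q : Pt F n, ptIn Q π ∧
          Projectivization.submodule Q ≤ κ ⊔ Projectivization.submodule P ∧ c P = c Q

section Forms

variable {V : Type} [AddCommGroup V] [Module F V]

/-- A homogeneous function of degree `d` which is polynomial along lines, the linear coefficient
depending linearly on the direction. -/
def IsForm (d : ℕ) (g : V → F) : Prop :=
  (∀ (r : F) (v : V), g (r • v) = r ^ d * g v) ∧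
    ∀ u : V, ∃ L : Module.Dual F V, ∀ v : V, ∃ P : Polynomial F, P.natDegree ≤ d ∧
      (∀ t : F, P.eval t = g (u + t • v)) ∧ P.coeff d = g v ∧ P.coeff 1 = L v

theorem IsForm.zero (d : ℕ) : IsForm d (0 : V → F) :=
  ⟨by simp, fun u => ⟨0, fun v => ⟨0, by simp⟩⟩⟩

theorem IsForm.const (c : F) : IsForm 0 (fun _ : V => c) :=
  ⟨by simp, fun u => ⟨0, fun v => ⟨Polynomial.C c, by simp [Polynomial.coeff_C]⟩⟩⟩

theorem IsForm.dual (φ : Module.Dual F V) : IsForm 1 (fun v => φ v) :=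
  ⟨by simp, fun u => ⟨φ, fun v => ⟨Polynomial.C (φ v) * Polynomial.X + Polynomial.C (φ u), by
    compute_degree, by intro t; simp; ring, by simp [Polynomial.coeff_C], by
    simp [Polynomial.coeff_C]⟩⟩⟩

theorem IsForm.add {d : ℕ} {g g' : V → F} (h : IsForm d g) (h' : IsForm d g') :
    IsForm d (g + g') := by
  refine ⟨fun r v => by simp [h.1, h'.1]; ring, fun u => ?_⟩
  obtain ⟨L, hL⟩ := h.2 u
  obtain ⟨L', hL'⟩ := h'.2 u
  refine ⟨L + L', fun v => ?_⟩
  obtain ⟨P, h1, h2, h3, h4⟩ := hL v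
  obtain ⟨P', h1', h2', h3', h4'⟩ := hL' v
  exact ⟨P + P', Polynomial.natDegree_add_le_of_degree_le h1 h1', by simp [h2, h2'],
    by simp [h3, h3'], by simp [h4, h4']⟩

theorem IsForm.mul {d d' : ℕ} {g g' : V → F} (h : IsForm d g) (h' : IsForm d' g') :
    IsForm (d + d') (g * g') := by
  refine ⟨fun r v => by simp [h.1, h'.1]; ring, fun u => ?_⟩
  obtain ⟨L, hL⟩ := h.2 u
  obtain ⟨L', hL'⟩ := h'.2 u
  refine ⟨g u • L' + g' u • L, fun v => ?_⟩
  obtain ⟨P, h1, h2, h3, h4⟩ := hL v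
  obtain ⟨P', h1', h2', h3', h4'⟩ := hL' v
  refine ⟨P * P', Polynomial.natDegree_mul_le_of_le h1 h1', by simp [h2, h2'], ?_, ?_⟩
  · rw [Polynomial.coeff_mul_add_eq_of_natDegree_le h1 h1', h3, h3', Pi.mul_apply]
  · have e := h2 0
    have e' := h2' 0
    rw [← Polynomial.coeff_zero_eq_eval_zero, zero_smul, add_zero] at e e'
    rw [Polynomial.mul_coeff_one, e, e', h4, h4']
    simp; ring

theorem IsForm.smul {d : ℕ} {g : V → F} (c : F) (h : IsForm d g) : IsForm d (c • g) := by
  have := (IsForm.const (V := V) c).mul h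
  rw [zero_add] at this
  exact this

theorem IsForm.sub {d : ℕ} {g g' : V → F} (h : IsForm d g) (h' : IsForm d g') :
    IsForm d (g - g') := by
  have := h.add (h'.smul (-1))
  rwa [neg_one_smul, ← sub_eq_add_neg] at this

theorem IsForm.pow {d : ℕ} {g : V → F} (h : IsForm d g) (k : ℕ) : IsForm (d * k) (g ^ k) := by
  induction k with
  | zero => rw [mul_zero, pow_zero]; exact IsForm.const (1 : F)
  | succ k ih => rw [pow_succ, mul_add, mul_one]; exact ih.mul h

theorem IsForm.exists_dual {g : V → F} (h : IsForm 1 g) :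
    ∃ L : Module.Dual F V, ∀ v, g v = L v := by
  obtain ⟨L, hL⟩ := h.2 0
  refine ⟨L, fun v => ?_⟩
  obtain ⟨P, h1, h2, h3, h4⟩ := hL v
  rw [← h3, h4]

end Forms

section Codes

variable {V : Type} [AddCommGroup V] [Module F V]

/-- The function on vectors which is the indicator of the nonzero vectors of `ker φ`. -/
def chi (φ : Module.Dual F V) (v : V) : F := if v ≠ 0 ∧ φ v = 0 then 1 else 0

variable (F V) in
/-- The span of the indicator functions of the hyperplanes, as functions on vectors. -/
def hypCode : Submodule F (V → F) :=
  Submodule.span F {f | ∃ φ : Module.Dual F V, φ ≠ 0 ∧ f = chi φ}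

theorem chi_mem {φ : Module.Dual F V} (h : φ ≠ 0) : chi φ ∈ hypCode F V :=
  Submodule.subset_span ⟨φ, h, rfl⟩

theorem apply_smul_of_mem {f : V → F} (hf : f ∈ hypCode F V) {r : F} (hr : r ≠ 0) (v : V) :
    f (r • v) = f v := by
  induction hf using Submodule.span_induction with
  | mem x hx => obtain ⟨φ, -, rfl⟩ := hx; simp [chi, hr]
  | zero => rfl
  | add x y _ _ h1 h2 => simp [h1, h2]
  | smul c x _ h1 => simp [h1]

theorem apply_zero_of_mem {f : V → F} (hf : f ∈ hypCode F V) : f 0 = 0 := by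
  induction hf using Submodule.span_induction with
  | mem x hx => obtain ⟨φ, -, rfl⟩ := hx; simp [chi]
  | zero => rfl
  | add x y _ _ h1 h2 => simp [h1, h2]
  | smul c x _ h1 => simp [h1]

theorem add_smul_ne_zero {a b : V} (hb : b ∉ Submodule.span F {a}) (y : F) : b + y • a ≠ 0 := by
  intro h
  apply hb
  rw [Submodule.mem_span_singleton]
  exact ⟨-y, by rw [neg_smul]; exact (eq_neg_of_add_eq_zero_left h).symm⟩

theorem chi_add_smul {φ : Module.Dual F V} {a b : V} (hb : b ∉ Submodule.span F {a}) (y : F) :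
    chi φ (b + y • a) = if φ b + y * φ a = 0 then 1 else 0 := by
  have := add_smul_ne_zero hb y
  simp [chi, this]

theorem moment_chi [Fintype F] {φ : Module.Dual F V} {a b : V} (ha : φ a ≠ 0)
    (hb : b ∉ Submodule.span F {a}) (k : ℕ) :
    ∑ y : F, y ^ k * chi φ (b + y • a) = (-(φ b / φ a)) ^ k := by
  rw [Finset.sum_eq_single (-(φ b / φ a))]
  · rw [chi_add_smul hb, if_pos (by field_simp; ring), mul_one]
  · intro y _ hy
    rw [chi_add_smul hb, if_neg, mul_zero]
    intro h
    apply hy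
    field_simp
    linear_combination h
  · simp

/-- All line sums of `f` (counted on a base point `a` and the points `b + y • a`) equal `s`. -/
def HasLineSum [Fintype F] (f : V → F) (s : F) : Prop :=
  ∀ a b : V, a ≠ 0 → b ∉ Submodule.span F {a} → f a + ∑ y : F, f (b + y • a) = s

theorem hasLineSum_chi [Fintype F] (φ : Module.Dual F V) : HasLineSum (chi φ) 1 := by
  intro a b ha hb
  by_cases h : φ a = 0
  · simp only [chi_add_smul hb, h, mul_zero, add_zero]
    rw [Finset.sum_const, Finset.card_univ, nsmul_eq_mul, FiniteField.cast_card_eq_zero]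
    simp [chi, h, ha]
  · have := moment_chi h hb 0
    simp only [pow_zero, one_mul] at this
    rw [this]
    simp [chi, h]

theorem HasLineSum.add [Fintype F] {f g : V → F} {s t : F} (hf : HasLineSum f s)
    (hg : HasLineSum g t) : HasLineSum (f + g) (s + t) := by
  intro a b ha hb
  rw [← hf a b ha hb, ← hg a b ha hb]
  simp [Finset.sum_add_distrib]; ring

theorem HasLineSum.smul [Fintype F] {f : V → F} {s : F} (c : F) (hf : HasLineSum f s) :
    HasLineSum (c • f) (c * s) := by
  intro a b ha hb
  rw [← hf a b ha hb]
  simp [← Finset.mul_sum]; ring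

theorem exists_line_sum [Fintype F] {f : V → F} (hf : f ∈ hypCode F V) :
    ∃ s : F, HasLineSum f s := by
  induction hf using Submodule.span_induction with
  | mem x hx =>
    obtain ⟨φ, -, rfl⟩ := hx
    exact ⟨1, hasLineSum_chi φ⟩
  | zero => exact ⟨0, fun _ _ _ _ => by simp⟩
  | add x y _ _ h1 h2 =>
    obtain ⟨s, hs⟩ := h1
    obtain ⟨s', hs'⟩ := h2
    exact ⟨s + s', hs.add hs'⟩
  | smul c x _ h1 =>
    obtain ⟨s, hs⟩ := h1
    exact ⟨c * s, hs.smul c⟩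

theorem exists_moment_form [Fintype F] {f : V → F} (hf : f ∈ hypCode F V) (a : V)
    {k : ℕ} (hk : k + 2 ≤ Fintype.card F) :
    ∃ g : V → F, IsForm k g ∧ ∀ b, b ∉ Submodule.span F {a} →
      ∑ y : F, y ^ k * f (b + y • a) = g b := by
  induction hf using Submodule.span_induction with
  | mem x hx =>
    obtain ⟨φ, -, rfl⟩ := hx
    by_cases h : φ a = 0
    · refine ⟨0, IsForm.zero k, fun b hb => ?_⟩
      simp only [chi_add_smul hb, h, mul_zero, add_zero]
      rw [← Finset.sum_mul, FiniteField.sum_pow_lt_card_sub_one F k (by omega)]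
      simp
    · refine ⟨fun v => (-(φ v / φ a)) ^ k, ?_, fun b hb => moment_chi h hb k⟩
      have := (IsForm.dual ((-(φ a)⁻¹) • φ)).pow k
      rw [one_mul] at this
      convert this using 2 with v
      simp; ring
  | zero => exact ⟨0, IsForm.zero k, by simp⟩
  | add x y _ _ h1 h2 =>
    obtain ⟨g, hg, hg1⟩ := h1
    obtain ⟨g', hg', hg1'⟩ := h2
    refine ⟨g + g', hg.add hg', fun b hb => ?_⟩
    rw [Pi.add_apply, ← hg1 b hb, ← hg1' b hb]
    simp [mul_add, Finset.sum_add_distrib]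
  | smul c x _ h1 =>
    obtain ⟨g, hg, hg1⟩ := h1
    refine ⟨c • g, hg.smul c, fun b hb => ?_⟩
    rw [Pi.smul_apply, ← hg1 b hb]
    simp [Finset.mul_sum, mul_left_comm]

end Codes

section Moments

open Polynomial

theorem natDegree_det_le {w : ℕ} (A : Matrix (Fin w) (Fin w) F[X])
    (hA : ∀ i j, (A i j).natDegree ≤ i + j) : A.det.natDegree ≤ w * (w - 1) := by
  rw [Matrix.det_apply]
  refine Polynomial.natDegree_sum_le_of_forall_le _ _ fun σ _ => ?_
  have h1 : (∏ i, A (σ i) i).natDegree ≤ w * (w - 1) := by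
    refine (Polynomial.natDegree_prod_le _ _).trans ?_
    refine (Finset.sum_le_sum fun i _ => hA (σ i) i).trans ?_
    rw [Finset.sum_add_distrib, Equiv.sum_comp σ (fun i : Fin w => (i : ℕ)), ← two_mul, mul_comm,
      Fin.sum_univ_eq_sum_range (fun i => i) w, Finset.sum_range_id_mul_two]
  rcases Int.units_eq_one_or (Equiv.Perm.sign σ) with h | h <;> rw [h]
  · simpa using h1
  · simpa using h1

variable [Fintype F]

theorem sum_eval_mul_eq_zero {h : F → F} {m : ℕ} (hm : ∀ i < m, ∑ y : F, y ^ i * h y = 0)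
    {P : F[X]} (hP : P.natDegree < m) : ∑ y : F, P.eval y * h y = 0 := by
  have : ∀ y : F, P.eval y * h y = ∑ i ∈ Finset.range m, P.coeff i * (y ^ i * h y) := by
    intro y
    rw [Polynomial.eval_eq_sum_range' hP, Finset.sum_mul]
    exact Finset.sum_congr rfl fun i _ => by ring
  rw [Finset.sum_congr rfl fun y _ => this y, Finset.sum_comm]
  refine Finset.sum_eq_zero fun i hi => ?_
  rw [← Finset.mul_sum, hm i (Finset.mem_range.mp hi), mul_zero]

/-- A function on a finite field with at most `m` nonzero values whose first `m` moments vanish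
is zero. -/
theorem eq_zero_of_moments {h : F → F} {m : ℕ} (hm : ∀ i < m, ∑ y : F, y ^ i * h y = 0)
    (hs : (Finset.univ.filter fun y => h y ≠ 0).card ≤ m) (y : F) : h y = 0 := by
  by_contra hy
  set S := Finset.univ.filter fun y => h y ≠ 0 with hS
  have hyS : y ∈ S := by simp [hS, hy]
  have hd : (∏ z ∈ S.erase y, (X - C z)).natDegree < m := by
    rw [Polynomial.natDegree_finsetProd_X_sub_C_eq_card, Finset.card_erase_of_mem hyS]
    have : 0 < S.card := Finset.card_pos.mpr ⟨y, hyS⟩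
    omega
  have := sum_eval_mul_eq_zero hm hd
  rw [Finset.sum_eq_single y] at this
  · rcases mul_eq_zero.mp this with h0 | h0
    · rw [Polynomial.eval_prod, Finset.prod_eq_zero_iff] at h0
      obtain ⟨z, hz, hz0⟩ := h0
      rw [Polynomial.eval_sub, eval_X, eval_C, sub_eq_zero] at hz0
      exact (Finset.mem_erase.mp hz).1 hz0.symm
    · exact hy h0
  · intro z _ hz
    by_cases hz0 : h z = 0
    · rw [hz0, mul_zero]
    · rw [Polynomial.eval_prod, Finset.prod_eq_zero (i := z), zero_mul]
      · simp [hS, hz, hz0]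
      · simp
  · simp

theorem eq_of_moments {h : F → F} (hm : ∀ i, i + 2 ≤ Fintype.card F → ∑ y : F, y ^ i * h y = 0)
    (y z : F) : h y = h z := by
  have hq : 1 < Fintype.card F := Fintype.one_lt_card
  have key : ∑ x : F, ((X - C z) ^ (Fintype.card F - 1) -
      (X - C y) ^ (Fintype.card F - 1) : F[X]).eval x * h x = 0 := by
    refine sum_eval_mul_eq_zero (m := Fintype.card F - 1) (fun i hi => hm i (by omega)) ?_
    by_cases h0 : ((X - C z) ^ (Fintype.card F - 1) -
      (X - C y) ^ (Fintype.card F - 1) : F[X]) = 0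
    · rw [h0]; simp; omega
    · have h1 := Polynomial.degree_sub_lt_left (p := ((X - C z) ^ (Fintype.card F - 1) : F[X]))
        (q := (X - C y) ^ (Fintype.card F - 1)) (by simp) (pow_ne_zero _ (X_sub_C_ne_zero z))
        (by simp)
      rw [Polynomial.degree_pow, degree_X_sub_C, nsmul_eq_mul, mul_one] at h1
      exact (Polynomial.natDegree_lt_iff_degree_lt h0).mpr h1
  have e : ∀ a : F, ∑ x : F, (x - a) ^ (Fintype.card F - 1) * h x = (∑ x : F, h x) - h a := by
    intro a
    rw [eq_sub_iff_add_eq, ← Finset.sum_erase_add _ (fun x => (x - a) ^ (Fintype.card F - 1) * h x) (Finset.mem_univ a),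
      ← Finset.sum_erase_add _ h (Finset.mem_univ a), sub_self,
      zero_pow (by omega), zero_mul, add_zero]
    congr 1
    refine Finset.sum_congr rfl fun x hx => ?_
    rw [FiniteField.pow_card_sub_one_eq_one _ (sub_ne_zero.mpr (Finset.mem_erase.mp hx).1), one_mul]
  simp only [eval_sub, eval_pow, eval_X, eval_C, sub_mul, Finset.sum_sub_distrib, e] at key
  linear_combination key

/-- The number of nonzero values. -/
def nnz (h : F → F) : ℕ := (Finset.univ.filter fun y => h y ≠ 0).card

theorem sum_mul_eval_eq {h : F → F} {w : ℕ} {Q : F[X]} (hQ : Q.natDegree < w) (i : ℕ) :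
    ∑ j : Fin w, (∑ y : F, y ^ (i + j) * h y) * Q.coeff j = ∑ y : F, y ^ i * (h y * Q.eval y) := by
  simp only [Finset.sum_mul]
  rw [Finset.sum_comm]
  refine Finset.sum_congr rfl fun y _ => ?_
  rw [Polynomial.eval_eq_sum_range' hQ, Finset.sum_range, Finset.mul_sum, Finset.mul_sum]
  exact Finset.sum_congr rfl fun j _ => by ring

theorem hankel_det_ne_zero {h : F → F} {w : ℕ} (hw : nnz h = w) :
    (Matrix.of fun i j : Fin w => ∑ y : F, y ^ (i + j : ℕ) * h y).det ≠ 0 := by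
  intro hdet
  obtain ⟨v, hv, hv0⟩ := Matrix.exists_mulVec_eq_zero_iff.mpr hdet
  apply hv
  rcases Nat.eq_zero_or_pos w with rfl | hwpos
  · exact funext fun i => i.elim0
  set Q : F[X] := ∑ j : Fin w, C (v j) * X ^ (j : ℕ) with hQ
  have hcoeff : ∀ j : Fin w, Q.coeff j = v j := by
    intro j
    rw [hQ, Polynomial.finsetSum_coeff, Finset.sum_eq_single j]
    · simp
    · intro i _ hi
      rw [coeff_C_mul, coeff_X_pow, if_neg (fun h => hi (Fin.ext h.symm)), mul_zero]
    · simp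
  have hdeg : Q.natDegree < w := by
    refine lt_of_le_of_lt (Polynomial.natDegree_sum_le_of_forall_le (n := w - 1) _ _ fun j _ => ?_)
      (by omega)
    exact (natDegree_C_mul_X_pow_le _ _).trans (by omega)
  have h1 : ∀ y, h y * Q.eval y = 0 := by
    refine eq_zero_of_moments (m := w) (fun i hi => ?_) ?_
    · rw [← sum_mul_eval_eq hdeg i]
      have := congrFun hv0 ⟨i, hi⟩
      simpa [Matrix.mulVec, dotProduct, hcoeff] using this
    · rw [← hw]
      refine Finset.card_le_card fun y hy => ?_
      simp at hy ⊢
      exact hy.1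
  have hQ0 : Q = 0 := by
    refine Polynomial.eq_zero_of_natDegree_lt_card_of_eval_eq_zero' Q
      (Finset.univ.filter fun y => h y ≠ 0) (fun y hy => ?_) (by rw [← nnz, hw]; exact hdeg)
    simp at hy
    exact (mul_eq_zero.mp (h1 y)).resolve_left hy
  ext j
  rw [← hcoeff, hQ0]; simp

theorem pow_dvd_hankel_det {h : F → F} {w : ℕ} (t : F) (p : ℕ → F[X])
    (hp : ∀ k, (p k).eval t = ∑ y : F, y ^ k * h y) :
    (X - C t) ^ (w - nnz h) ∣ (Matrix.of fun i j : Fin w => p (i + j)).det := by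
  set S := Finset.univ.filter fun y => h y ≠ 0 with hS
  have hcard : nnz h = S.card := rfl
  set G : F[X] := ∏ z ∈ S, (X - C z) with hG
  have hGm : G.Monic := Polynomial.monic_prod_of_monic _ _ fun z _ => monic_X_sub_C z
  have hGd : G.natDegree = nnz h := Polynomial.natDegree_finsetProd_X_sub_C_eq_card _ _
  set Q : Fin w → F[X] := fun k => if (k : ℕ) < nnz h then X ^ (k : ℕ)
    else X ^ ((k : ℕ) - nnz h) * G with hQ
  have hQm : ∀ k, (Q k).Monic := by
    intro k
    simp only [hQ]
    split_ifs
    · exact monic_X_pow _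
    · exact (monic_X_pow _).mul hGm
  have hQd : ∀ k, (Q k).natDegree = k := by
    intro k
    simp only [hQ]
    split_ifs with hk
    · simp
    · rw [(monic_X_pow _).natDegree_mul hGm, hGd, natDegree_X_pow]; omega
  set A : Matrix (Fin w) (Fin w) F[X] := Matrix.of fun i j : Fin w => p (i + j) with hA
  set U : Matrix (Fin w) (Fin w) F[X] := Matrix.of fun j k => C ((Q k).coeff j) with hU
  have hUdet : U.det = 1 := by
    rw [Matrix.det_of_isUpperTriangular]
    · refine Finset.prod_eq_one fun k _ => ?_
      have := (hQm k).coeff_natDegree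
      rw [hQd] at this
      simp [hU, this]
    · intro i j hij
      simp only [hU, Matrix.of_apply]
      rw [Polynomial.coeff_eq_zero_of_natDegree_lt, C_0]
      rw [hQd]; exact hij
  have hdiv : ∀ i k : Fin w, (if (k : ℕ) < nnz h then 1 else X - C t) ∣ (A * U) i k := by
    intro i k
    split_ifs with hk
    · exact one_dvd _
    · rw [Polynomial.dvd_iff_isRoot, IsRoot.def, Matrix.mul_apply, Polynomial.eval_finsetSum]
      simp only [hA, hU, Matrix.of_apply, eval_mul, eval_C, hp]
      rw [sum_mul_eval_eq (by rw [hQd]; exact k.2)]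
      refine Finset.sum_eq_zero fun y _ => ?_
      by_cases hy : h y = 0
      · rw [hy]; simp
      · have : G.eval y = 0 := by
          rw [hG, eval_prod, Finset.prod_eq_zero (i := y)]
          · simp [hS, hy]
          · simp
        simp [hQ, hk, this]
  choose M hM using hdiv
  have e : (A * U) = Matrix.of fun i k : Fin w => (if (k : ℕ) < nnz h then 1 else X - C t) * M i k := by
    ext1 i k
    exact hM i k
  have hdet : A.det = (A * U).det := by rw [Matrix.det_mul, hUdet, mul_one]
  rw [hdet, e]
  have := Matrix.det_mul_row (fun k : Fin w => if (k : ℕ) < nnz h then (1 : F[X]) else X - C t)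
    (Matrix.of M)
  rw [show (Matrix.of fun i k : Fin w => (if (k : ℕ) < nnz h then 1 else X - C t) * M i k) =
    Matrix.of fun i j : Fin w => (if (j : ℕ) < nnz h then (1 : F[X]) else X - C t) *
      Matrix.of M i j from rfl, this]
  refine Dvd.dvd.mul_right ?_ _
  rw [Finset.prod_ite, Finset.prod_const_one, one_mul, Finset.prod_const]
  refine pow_dvd_pow _ (le_of_eq ?_)
  have h2 := Fin.sum_univ_eq_sum_range (fun k => if k < nnz h then 0 else 1) w
  rw [Finset.card_filter]
  have h3 : ∀ k : Fin w, (if ¬ (k : ℕ) < nnz h then 1 else 0) = if (k : ℕ) < nnz h then 0 else 1 :=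
    fun k => by split_ifs <;> simp_all
  rw [Finset.sum_congr rfl fun k _ => h3 k, h2]
  clear * -
  induction w with
  | zero => simp
  | succ w ih => rw [Finset.sum_range_succ, ← ih]; split_ifs <;> omega

/-- If the moments of a family of functions on a finite field depend polynomially on the parameter,
with the `k`-th moment of degree at most `k`, then the number of nonzero values
cannot drop too much. -/
theorem sum_nnz_deficit_le (h : F → F → F)
    (hp : ∀ k, ∃ P : F[X], P.natDegree ≤ k ∧ ∀ t, P.eval t = ∑ y : F, y ^ k * h t y) :
    ∑ t : F, (nnz (h 0) - nnz (h t)) ≤ nnz (h 0) * (nnz (h 0) - 1) := by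
  choose p hpd hpe using hp
  set w := nnz (h 0) with hw
  set A : Matrix (Fin w) (Fin w) F[X] := Matrix.of fun i j : Fin w => p (i + j) with hA
  have hne : A.det ≠ 0 := by
    intro h0
    have h1 := congrArg (Polynomial.evalRingHom 0) h0
    rw [RingHom.map_det, map_zero] at h1
    refine hankel_det_ne_zero hw.symm ?_
    have e : (Matrix.of fun i j : Fin w => ∑ y : F, y ^ (i + j : ℕ) * h 0 y) =
        (Polynomial.evalRingHom 0).mapMatrix A := by
      ext i j
      simp [hA, hpe]
    rw [e]
    exact h1
  have hdvd : ∏ t : F, (X - C t) ^ (w - nnz (h t)) ∣ A.det := by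
    refine Finset.prod_dvd_of_coprime (fun t _ t' _ htt => ?_) fun t _ => ?_
    · exact IsCoprime.pow (Polynomial.pairwise_coprime_X_sub_C (s := fun x : F => x)
        (fun a b h => h) htt)
    · exact pow_dvd_hankel_det t p (fun k => hpe k t)
  have h2 := Polynomial.natDegree_le_of_dvd hdvd hne
  rw [Polynomial.natDegree_prod_of_monic _ _ (fun t _ => (monic_X_sub_C t).pow _)] at h2
  simp only [Polynomial.natDegree_pow, natDegree_X_sub_C, mul_one] at h2
  exact h2.trans (natDegree_det_le A fun i j => hpd _)

end Moments

section Lines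

variable {V : Type} [AddCommGroup V] [Module F V]

theorem add_smul_not_mem {a b : V} (hb : b ∉ Submodule.span F {a}) (y : F) :
    b + y • a ∉ Submodule.span F {a} := fun h =>
  hb ((Submodule.add_mem_iff_left _ (Submodule.smul_mem _ _ (Submodule.mem_span_singleton_self a))).mp h)

theorem ne_zero_of_not_mem {W : Submodule F V} {b : V} (hb : b ∉ W) : b ≠ 0 :=
  fun h => hb (h ▸ W.zero_mem)

theorem not_mem_span_symm {a b : V} (ha : a ≠ 0) (hb : b ∉ Submodule.span F {a}) :
    a ∉ Submodule.span F {b} := by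
  intro h
  obtain ⟨c, hc⟩ := Submodule.mem_span_singleton.mp h
  have hc0 : c ≠ 0 := by rintro rfl; exact ha (by rw [← hc, zero_smul])
  exact hb (Submodule.mem_span_singleton.mpr ⟨c⁻¹, by rw [← hc, smul_smul, inv_mul_cancel₀ hc0, one_smul]⟩)

theorem not_mem_span_add {a b : V} (ha : a ≠ 0) (hb : b ∉ Submodule.span F {a}) (y : F) :
    a ∉ Submodule.span F {b + y • a} :=
  not_mem_span_symm ha (add_smul_not_mem hb y)

theorem not_mem_span_of_pair {a b v : V} (h : v ∉ Submodule.span F {a, b}) :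
    v ∉ Submodule.span F {a} ∧ v ∉ Submodule.span F {b} :=
  ⟨fun h' => h (Submodule.span_mono (by simp) h'), fun h' => h (Submodule.span_mono (by simp) h')⟩

theorem add_smul_not_mem_of_pair {a u v : V} (hu : u ∉ Submodule.span F {a})
    (h : v ∉ Submodule.span F {a, u}) (t : F) : u + t • v ∉ Submodule.span F {a} := by
  intro h'
  rcases eq_or_ne t 0 with rfl | ht
  · exact hu (by simpa using h')
  · obtain ⟨c, hc⟩ := Submodule.mem_span_singleton.mp h'
    refine h (Submodule.mem_span_pair.mpr ⟨t⁻¹ * c, -t⁻¹, ?_⟩)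
    rw [mul_smul, hc, smul_add, smul_smul, inv_mul_cancel₀ ht]
    module

theorem add_add_ne_zero_of_pair {a u v : V} (h : v ∉ Submodule.span F {a, u}) (x y : F) :
    v + x • a + y • u ∉ Submodule.span F {a, u} := by
  intro h'
  apply h
  have : v = (v + x • a + y • u) - (x • a + y • u) := by abel
  rw [this]
  exact Submodule.sub_mem _ h' (Submodule.mem_span_pair.mpr ⟨x, y, rfl⟩)

variable [Fintype F]

/-- The number of nonzero values of `f` on the points `b + y • a`. -/
def lw (f : V → F) (a b : V) : ℕ := nnz fun y => f (b + y • a)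

theorem lw_le (f : V → F) (a b : V) : lw f a b ≤ Fintype.card F :=
  (Finset.card_le_univ _)

theorem nnz_pos {h : F → F} {y : F} (hy : h y ≠ 0) : 0 < nnz h :=
  Finset.card_pos.mpr ⟨y, by simp [hy]⟩

theorem nnz_two_le {h : F → F} {y z : F} (hyz : y ≠ z) (hy : h y ≠ 0) (hz : h z ≠ 0) :
    2 ≤ nnz h := by
  rw [← Finset.card_pair hyz]
  refine Finset.card_le_card fun x hx => ?_
  simp at hx ⊢
  rcases hx with rfl | rfl <;> assumption

theorem nnz_comp_add (h : F → F) (c : F) : nnz (fun y => h (y + c)) = nnz h := by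
  refine Finset.card_bij (fun y _ => y + c) (by simp) (by simp) fun y hy => ⟨y - c, ?_, by simp⟩
  simpa using hy

theorem lw_add_smul (f : V → F) (a b : V) (y : F) : lw f a (b + y • a) = lw f a b := by
  rw [lw, lw, ← nnz_comp_add (fun z => f (b + z • a)) y]
  congr 1
  ext z
  congr 1
  module

theorem nnz_eq (h : F → F) (y : F) : nnz h = (if h y ≠ 0 then 1 else 0) +
    ((Finset.univ.erase y).filter fun z => h z ≠ 0).card := by
  rw [nnz, ← Finset.insert_erase (Finset.mem_univ y), Finset.filter_insert,
    Finset.erase_insert (by simp)]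
  split_ifs
  · rw [Finset.card_insert_of_notMem (by simp), add_comm]
  · simp

theorem lw_symm {f : V → F} (hf : f ∈ hypCode F V) (a b : V) :
    (if f a ≠ 0 then 1 else 0) + lw f a b = (if f b ≠ 0 then 1 else 0) + lw f b a := by
  rw [lw, lw, nnz_eq _ (0 : F), nnz_eq (fun y => f (a + y • b)) (0 : F)]
  simp only [zero_smul, add_zero]
  rw [add_left_comm]
  congr 2
  have key : ∀ (a b : V) (y : F), y ≠ 0 → f (a + y⁻¹ • b) = f (b + y • a) := by
    intro a b y hy
    rw [← apply_smul_of_mem hf hy (a + y⁻¹ • b), smul_add, smul_smul, mul_inv_cancel₀ hy, one_smul,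
      add_comm]
  refine Finset.card_bij (fun y _ => y⁻¹) ?_ (by simp) ?_
  · intro y hy
    simp at hy ⊢
    exact ⟨hy.1, by rw [key a b y hy.1]; exact hy.2⟩
  · intro y hy
    simp at hy
    refine ⟨y⁻¹, ?_, by simp⟩
    simp [hy.1]
    rw [key b a y hy.1]; exact hy.2

theorem exists_moment_poly {f : V → F} (hf : f ∈ hypCode F V) (a u v : V)
    (h : ∀ t : F, u + t • v ∉ Submodule.span F {a}) (k : ℕ) :
    ∃ P : Polynomial F, P.natDegree ≤ k ∧
      ∀ t, P.eval t = ∑ y : F, y ^ k * f (u + t • v + y • a) := by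
  by_cases hk : k + 2 ≤ Fintype.card F
  · obtain ⟨g, hg, hg1⟩ := exists_moment_form hf a hk
    obtain ⟨L, hL⟩ := hg.2 u
    obtain ⟨P, h1, h2, -⟩ := hL v
    exact ⟨P, h1, fun t => by rw [h2, hg1 _ (h t)]⟩
  · have hd := Lagrange.degree_interpolate_lt (s := Finset.univ) (v := id)
      (fun t : F => ∑ y : F, y ^ k * f (u + t • v + y • a)) Function.injective_id.injOn
    refine ⟨Lagrange.interpolate Finset.univ id
      fun t : F => ∑ y : F, y ^ k * f (u + t • v + y • a), ?_, fun t => ?_⟩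
    · rw [Finset.card_univ] at hd
      by_cases h0 : Lagrange.interpolate Finset.univ id
        (fun t : F => ∑ y : F, y ^ k * f (u + t • v + y • a)) = 0
      · rw [h0]; simp
      · have := (Polynomial.natDegree_lt_iff_degree_lt h0).mpr hd
        omega
    · exact Lagrange.eval_interpolate_at_node (v := id) _ Function.injective_id.injOn
        (Finset.mem_univ t)

theorem sum_lw_deficit_le {f : V → F} (hf : f ∈ hypCode F V) (a u v : V)
    (h : ∀ t : F, u + t • v ∉ Submodule.span F {a}) :
    ∑ t : F, (lw f a u - lw f a (u + t • v)) ≤ lw f a u * (lw f a u - 1) := by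
  have := sum_nnz_deficit_le (fun t y => f (u + t • v + y • a)) (exists_moment_poly hf a u v h)
  simpa only [lw, zero_smul, add_zero] using this

theorem le_sum_lw {f : V → F} (hf : f ∈ hypCode F V) (a u v : V)
    (h : ∀ t : F, u + t • v ∉ Submodule.span F {a}) :
    lw f a u * (Fintype.card F - lw f a u) ≤
      ∑ t ∈ Finset.univ.erase (0 : F), lw f a (u + t • v) := by
  have h1 := sum_lw_deficit_le hf a u v h
  set w := lw f a u with hw
  have hwq : w ≤ Fintype.card F := lw_le f a u
  rw [← Finset.sum_erase_add _ _ (Finset.mem_univ (0 : F)), zero_smul, add_zero, ← hw,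
    Nat.sub_self, add_zero] at h1
  have h2 : (Fintype.card F - 1) * w ≤ ∑ t ∈ Finset.univ.erase (0 : F), (w - lw f a (u + t • v)) +
      ∑ t ∈ Finset.univ.erase (0 : F), lw f a (u + t • v) := by
    rw [← Finset.sum_add_distrib]
    calc (Fintype.card F - 1) * w = ∑ t ∈ Finset.univ.erase (0 : F), w := by
          rw [Finset.sum_const, Finset.card_erase_of_mem (Finset.mem_univ _), Finset.card_univ,
            smul_eq_mul]
      _ ≤ _ := Finset.sum_le_sum fun t _ => by omega
  rcases Nat.eq_zero_or_pos w with h0 | h0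
  · rw [h0]; simp
  · have h3 : w * (Fintype.card F - w) + w * (w - 1) = (Fintype.card F - 1) * w := by
      rw [← mul_add, mul_comm]
      congr 1
      omega
    omega

variable [Fintype V]

/-- The number of vectors at which `f` is nonzero. -/
def nzc (f : V → F) : ℕ := (Finset.univ.filter fun v => f v ≠ 0).card

omit [AddCommGroup V] [Module F V] [Fintype F] in
theorem card_filter_le_nzc {α : Type*} (f : V → F) (X : Finset α) (e : α → V)
    (he : Set.InjOn e X) : (X.filter fun x => f (e x) ≠ 0).card ≤ nzc f := by
  refine Finset.card_le_card_of_injOn e (fun x hx => ?_) (he.mono fun x hx => (Finset.mem_filter.mp hx).1)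
  simp at hx ⊢
  exact hx.2

theorem card_span_singleton_le (a : V) :
    (Finset.univ.filter fun v => v ∈ Submodule.span F {a}).card ≤ Fintype.card F := by
  rw [← Finset.card_univ]
  refine (Finset.card_le_card (t := Finset.univ.image fun c : F => c • a) fun v hv => ?_).trans
    Finset.card_image_le
  simp [Submodule.mem_span_singleton] at hv ⊢
  exact hv

theorem card_span_pair_le (a b : V) :
    (Finset.univ.filter fun v => v ∈ Submodule.span F {a, b}).card ≤ Fintype.card F ^ 2 := by
  have : Fintype.card F ^ 2 = (Finset.univ : Finset (F × F)).card := by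
    rw [Finset.card_univ, Fintype.card_prod, sq]
  rw [this]
  refine (Finset.card_le_card (t := Finset.univ.image fun c : F × F => c.1 • a + c.2 • b)
    fun v hv => ?_).trans Finset.card_image_le
  simp [Submodule.mem_span_pair] at hv ⊢
  exact hv

omit [Fintype F] in
theorem card_not_mem (W : Submodule F V) (m : ℕ)
    (h : (Finset.univ.filter fun v => v ∈ W).card ≤ m) :
    Fintype.card V - m ≤ (Finset.univ.filter fun v => v ∉ W).card := by
  have := Finset.card_filter_add_card_filter_not (s := (Finset.univ : Finset V)) (fun v => v ∈ W)
  rw [Finset.card_univ] at this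
  omega

theorem secant_count {f : V → F} (hf : f ∈ hypCode F V) {a u : V} (hu : u ∉ Submodule.span F {a}) :
    (Fintype.card V - Fintype.card F ^ 2) * (lw f a u * (Fintype.card F - lw f a u)) ≤
      (Fintype.card F - 1) * Fintype.card F * nzc f := by
  set T := Finset.univ.filter fun v => v ∉ Submodule.span F {a, u} with hT
  have h1 := card_not_mem _ _ (card_span_pair_le (F := F) a u)
  have h2 : T.card * (lw f a u * (Fintype.card F - lw f a u)) ≤
      ∑ v ∈ T, ∑ t ∈ Finset.univ.erase (0 : F), lw f a (u + t • v) := by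
    rw [← smul_eq_mul, ← Finset.sum_const]
    refine Finset.sum_le_sum fun v hv => le_sum_lw hf a u v fun t => ?_
    simp only [hT, Finset.mem_filter, Finset.mem_univ, true_and] at hv
    exact add_smul_not_mem_of_pair hu hv t
  refine (Nat.mul_le_mul_right _ h1).trans (h2.trans ?_)
  have h3 : ∀ t ∈ Finset.univ.erase (0 : F), ∑ v ∈ T, lw f a (u + t • v) ≤
      Fintype.card F * nzc f := by
    intro t ht
    have ht0 : t ≠ 0 := (Finset.mem_erase.mp ht).1
    simp only [lw, nnz, Finset.card_filter]
    rw [Finset.sum_comm]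
    simp only [← Finset.card_filter]
    refine (Finset.sum_le_sum fun y _ => card_filter_le_nzc f T (fun v => u + t • v + y • a)
      ?_).trans ?_
    · intro v _ v' _ hvv
      simpa [ht0] using hvv
    · simp
  rw [Finset.sum_comm]
  refine (Finset.sum_le_sum h3).trans ?_
  rw [Finset.sum_const, Finset.card_erase_of_mem (Finset.mem_univ _), Finset.card_univ,
    smul_eq_mul, mul_assoc]

theorem lw_dichotomy {f : V → F} (hf : f ∈ hypCode F V) {m : ℕ}
    (hm : 2 * m + 2 ≤ Fintype.card F)
    (hN : ∀ w, m + 1 ≤ w → w + m + 1 ≤ Fintype.card F →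
      (Fintype.card F - 1) * Fintype.card F * nzc f <
        (Fintype.card V - Fintype.card F ^ 2) * (w * (Fintype.card F - w)))
    {a b : V} (ha : f a ≠ 0) (hb : b ∉ Submodule.span F {a}) :
    lw f a b < m ∨ Fintype.card F ≤ lw f a b + m := by
  by_contra! hcon
  have ha0 : a ≠ 0 := by rintro rfl; exact ha (apply_zero_of_mem hf)
  rcases Nat.lt_or_ge m (lw f a b) with h1 | h1
  · exact absurd (secant_count hf hb) (not_le.mpr (hN _ h1 (by omega)))
  · have h2 : lw f a b = m := le_antisymm h1 hcon.1
    have : ∃ y : F, f (b + y • a) = 0 := by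
      by_contra! h0
      have : lw f a b = Fintype.card F := by
        rw [lw, nnz, Finset.filter_true_of_mem (fun y _ => h0 y), Finset.card_univ]
      omega
    obtain ⟨y, hy⟩ := this
    have h3 := lw_symm hf a (b + y • a)
    rw [lw_add_smul, h2, if_pos ha, if_neg (by simp [hy])] at h3
    have h4 := secant_count hf (not_mem_span_add ha0 hb y)
    exact absurd h4 (not_le.mpr (hN _ (by omega) (by omega)))

omit [Fintype V] in
theorem card_roots_le {P : Polynomial F} {d : ℕ} (hP : P.natDegree ≤ d) (h0 : P ≠ 0) :
    (Finset.univ.filter fun t => P.eval t = 0).card ≤ d := by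
  refine (Polynomial.card_le_degree_of_subset_roots fun t ht => ?_).trans hP
  simp at ht
  simp [h0, ht]

theorem form_zero_count {d : ℕ} {g : V → F} (hg : IsForm d g) (T : Submodule F V) {u : V}
    (hu : u ∈ T) (hgu : g u ≠ 0) :
    Fintype.card F * (Finset.univ.filter fun v => v ∈ T ∧ g v = 0).card ≤
      d * (Finset.univ.filter fun v => v ∈ T).card := by
  have h1 : ∀ v ∈ Finset.univ.filter fun v => v ∈ T,
      (Finset.univ.filter fun t : F => g (v + t • u) = 0).card ≤ d := by
    intro v _
    obtain ⟨L, hL⟩ := hg.2 v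
    obtain ⟨P, h1, h2, h3, -⟩ := hL u
    have := card_roots_le h1 (by rintro rfl; exact hgu (by simpa using h3.symm))
    simpa only [h2] using this
  have h2 := Finset.sum_le_sum h1
  simp only [Finset.sum_const, smul_eq_mul, Finset.card_filter (fun t : F => _)] at h2
  rw [Finset.sum_comm, mul_comm _ d] at h2
  refine le_trans (le_of_eq ?_) h2
  rw [← Finset.card_univ, ← smul_eq_mul, ← Finset.sum_const]
  refine Finset.sum_congr rfl fun t _ => ?_
  rw [← Finset.card_filter, Finset.filter_filter]
  refine Finset.card_bij (fun v _ => v - t • u) ?_ (by simp) ?_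
  · intro v hv
    simp only [Finset.mem_filter, Finset.mem_univ, true_and] at hv ⊢
    exact ⟨T.sub_mem hv.1 (T.smul_mem t hu), by simpa using hv.2⟩
  · intro v hv
    simp only [Finset.mem_filter, Finset.mem_univ, true_and] at hv
    refine ⟨v + t • u, ?_, by simp⟩
    simp only [Finset.mem_filter, Finset.mem_univ, true_and]
    exact ⟨T.add_mem hv.1 (T.smul_mem t hu), hv.2⟩

end Lines

section Cones

variable {V : Type} [AddCommGroup V] [Module F V]

/-- The span of the indicator functions of the hyperplanes through `κ`. -/
def coneCode (κ : Submodule F V) : Submodule F (V → F) :=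
  Submodule.span F {f | ∃ φ : Module.Dual F V, φ ≠ 0 ∧ κ ≤ LinearMap.ker φ ∧ f = chi φ}

theorem chi_mem_coneCode {κ : Submodule F V} {φ : Module.Dual F V} (h : φ ≠ 0)
    (hκ : κ ≤ LinearMap.ker φ) : chi φ ∈ coneCode κ :=
  Submodule.subset_span ⟨φ, h, hκ, rfl⟩

variable (F V) in
/-- The indicator function of the nonzero vectors. -/
def allOne (v : V) : F := if v = 0 then 0 else 1

theorem allOne_mem_of_dual [Fintype F] {κ : Submodule F V} {φ ψ : Module.Dual F V} (hψ : ψ ≠ 0)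
    (hφ : φ ∉ Submodule.span F {ψ}) (h1 : κ ≤ LinearMap.ker φ) (h2 : κ ≤ LinearMap.ker ψ) :
    allOne F V ∈ coneCode κ := by
  have : allOne F V = ∑ t : F, chi (φ + t • ψ) + chi ψ := by
    ext v
    simp only [Pi.add_apply, Finset.sum_apply, chi, allOne, LinearMap.add_apply,
      LinearMap.smul_apply, smul_eq_mul]
    by_cases hv : v = 0
    · simp [hv]
    by_cases hψv : ψ v = 0
    · simp only [hψv, hv, mul_zero, add_zero]
      rw [Finset.sum_const, Finset.card_univ, nsmul_eq_mul, FiniteField.cast_card_eq_zero]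
      simp [hv]
    · rw [Finset.sum_eq_single (-(φ v / ψ v))]
      · simp [hv, hψv]
      · intro t _ ht
        rw [if_neg]
        rintro ⟨-, h⟩
        apply ht
        field_simp
        linear_combination h
      · simp
  rw [this]
  refine Submodule.add_mem _ (Submodule.sum_mem _ fun t _ => chi_mem_coneCode
    (add_smul_ne_zero hφ t) fun v hv => ?_) (chi_mem_coneCode hψ h2)
  have e1 := h1 hv
  have e2 := h2 hv
  rw [LinearMap.mem_ker] at e1 e2
  simp [e1, e2]

theorem allOne_mem [Fintype F] [FiniteDimensional F V] {κ : Submodule F V}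
    (hκ : Module.finrank F κ + 3 = Module.finrank F V) : allOne F V ∈ coneCode κ := by
  have h1 := Subspace.finrank_add_finrank_dualAnnihilator_eq κ
  obtain ⟨ψ, hψ, hψ0⟩ := Submodule.exists_mem_ne_zero_of_ne_bot
    (show κ.dualAnnihilator ≠ ⊥ by
      intro h
      rw [h, finrank_bot] at h1
      omega)
  have : ∃ φ ∈ κ.dualAnnihilator, φ ∉ Submodule.span F {ψ} := by
    by_contra! h
    have h2 := Submodule.finrank_mono (show κ.dualAnnihilator ≤ Submodule.span F {ψ} from h)
    have h3 := finrank_span_le_card (R := F) ({ψ} : Set (Module.Dual F V))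
    simp at h3
    omega
  obtain ⟨φ, hφ, hφψ⟩ := this
  rw [Submodule.mem_dualAnnihilator] at hψ hφ
  exact allOne_mem_of_dual hψ0 hφψ (fun v hv => hφ v hv)
    (fun v hv => hψ v hv)

/-- A code word which is invariant under translation by `κ` outside `κ` is a combination
of hyperplanes through `κ`. -/
theorem mem_coneCode_of_invariant [Fintype F] [FiniteDimensional F V] {κ : Submodule F V}
    (hκ : Module.finrank F κ + 3 = Module.finrank F V) {f : V → F} (hf : f ∈ hypCode F V)
    (hinv : ∀ v ∉ κ, ∀ k ∈ κ, f (v + k) = f v) : f ∈ coneCode κ := by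
  obtain ⟨π, hπ⟩ := κ.exists_isCompl
  set P := π.projection κ hπ.symm with hP
  have hPker : ∀ v, P v = 0 ↔ v ∈ κ := fun v => Submodule.projection_apply_eq_zero_iff _
  have hPsub : ∀ v, v - P v ∈ κ := fun v => Submodule.sub_projection_mem _ v
  have key : ∀ g ∈ hypCode F V, ∃ c : F, HasLineSum g c ∧
      (fun v => if v ∈ κ then (if v = 0 then 0 else c) else g (P v)) ∈ coneCode κ := by
    intro g hg
    induction hg using Submodule.span_induction with
    | mem x hx =>
      obtain ⟨φ, -, rfl⟩ := hx
      refine ⟨1, hasLineSum_chi φ, ?_⟩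
      by_cases h : φ ∘ₗ P = 0
      · convert allOne_mem hκ using 1
        ext v
        simp only [allOne]
        split_ifs with h1 h2 h2
        · rfl
        · rfl
        · exact absurd (h2 ▸ κ.zero_mem) h1
        · have h3 : φ (P v) = 0 := DFunLike.congr_fun h v
          simp [chi, h3, hPker, h1]
      · convert chi_mem_coneCode h (κ := κ) ?_ using 1
        · ext v
          simp only [chi]
          by_cases h1 : v ∈ κ
          · have := (hPker v).mpr h1
            by_cases h2 : v = 0 <;> simp [h1, h2, this]
          · have h2 : v ≠ 0 := fun h2 => h1 (h2 ▸ κ.zero_mem)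
            simp [h1, h2, hPker]
        · intro v hv
          rw [LinearMap.mem_ker, LinearMap.comp_apply, (hPker v).mpr hv, map_zero]
    | zero =>
      refine ⟨0, fun _ _ _ _ => by simp, ?_⟩
      convert Submodule.zero_mem _ using 1
      ext v
      simp
    | add x y _ _ h1 h2 =>
      obtain ⟨c, hc, h1⟩ := h1
      obtain ⟨d, hd, h2⟩ := h2
      refine ⟨c + d, hc.add hd, ?_⟩
      convert Submodule.add_mem _ h1 h2 using 1
      ext v
      simp only [Pi.add_apply]
      split_ifs <;> simp
    | smul a x _ h1 =>
      obtain ⟨c, hc, h1⟩ := h1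
      refine ⟨a * c, hc.smul a, ?_⟩
      convert Submodule.smul_mem _ a h1 using 1
      ext v
      simp only [Pi.smul_apply, smul_eq_mul]
      split_ifs <;> simp
  obtain ⟨c, hc, hmem⟩ := key f hf
  convert hmem using 1
  ext v
  split_ifs with h1 h2
  · rw [h2]; exact apply_zero_of_mem hf
  · have : κ ≠ ⊤ := by
      rintro rfl
      rw [finrank_top] at hκ
      omega
    obtain ⟨b, -, hb⟩ := SetLike.exists_of_lt (lt_top_iff_ne_top.mpr this)
    have h3 := hc v b h2 fun h => hb ((Submodule.span_singleton_le_iff_mem v κ).mpr h1 h)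
    rw [Finset.sum_congr rfl fun y _ => hinv b hb (y • v) (κ.smul_mem y h1), Finset.sum_const,
      Finset.card_univ, nsmul_eq_mul, FiniteField.cast_card_eq_zero, zero_mul, add_zero] at h3
    exact h3
  · have := hinv (P v) (fun h => h1 ?_) (v - P v) (hPsub v)
    · rw [← this]; congr 1; abel
    · have h2 := κ.add_mem h (hPsub v)
      rwa [add_sub_cancel] at h2

theorem exists_le_finrank_eq [FiniteDimensional F V] {W : Submodule F V} {m : ℕ}
    (hm : m ≤ Module.finrank F W) : ∃ κ ≤ W, Module.finrank F κ = m := by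
  obtain ⟨b, hb⟩ := exists_linearIndependent_of_le_finrank hm
  refine ⟨(Submodule.span F (Set.range b)).map W.subtype, Submodule.map_subtype_le _ _, ?_⟩
  rw [Submodule.finrank_map_subtype_eq, finrank_span_eq_card hb]
  simp

theorem finrank_le_finrank_inf_ker [FiniteDimensional F V] (W : Submodule F V)
    (φ : Module.Dual F V) :
    Module.finrank F W ≤ Module.finrank F (W ⊓ LinearMap.ker φ : Submodule F V) + 1 := by
  have h1 := Submodule.finrank_sup_add_finrank_inf_eq W (LinearMap.ker φ)
  have h2 := LinearMap.finrank_range_add_finrank_ker φ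
  have h3 := Submodule.finrank_le (LinearMap.range φ)
  have h4 := Submodule.finrank_le (W ⊔ LinearMap.ker φ)
  rw [Module.finrank_self] at h3
  omega

theorem exists_cone_of_pair [FiniteDimensional F V] (hV : 3 ≤ Module.finrank F V)
    (φ ψ : Module.Dual F V) : ∃ κ : Submodule F V,
      Module.finrank F κ + 3 = Module.finrank F V ∧ κ ≤ LinearMap.ker φ ∧ κ ≤ LinearMap.ker ψ := by
  have h1 := finrank_le_finrank_inf_ker (⊤ : Submodule F V) φ
  have h2 := finrank_le_finrank_inf_ker (⊤ ⊓ LinearMap.ker φ) ψ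
  rw [finrank_top] at h1
  obtain ⟨κ, hκ, hκ1⟩ := exists_le_finrank_eq (m := Module.finrank F V - 3)
    (W := ⊤ ⊓ LinearMap.ker φ ⊓ LinearMap.ker ψ) (by omega)
  exact ⟨κ, by omega, (hκ.trans inf_le_left).trans inf_le_right, hκ.trans inf_le_right⟩

/-- The conclusion of the main theorem, for functions on vectors. -/
def IsConical (f : V → F) : Prop :=
  ∃ κ : Submodule F V, Module.finrank F κ + 3 = Module.finrank F V ∧ f ∈ coneCode κ

theorem isConical_of_two [FiniteDimensional F V] (hV : 3 ≤ Module.finrank F V)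
    {φ ψ : Module.Dual F V} (hφ : φ ≠ 0) (hψ : ψ ≠ 0) (a b : F) :
    IsConical (a • chi φ + b • chi ψ) := by
  obtain ⟨κ, hκ, h1, h2⟩ := exists_cone_of_pair hV φ ψ
  exact ⟨κ, hκ, Submodule.add_mem _ (Submodule.smul_mem _ _ (chi_mem_coneCode hφ h1))
    (Submodule.smul_mem _ _ (chi_mem_coneCode hψ h2))⟩

theorem isConical_of_card_two [Fintype F] [FiniteDimensional F V]
    (hV : 3 ≤ Module.finrank F V) (hq : Fintype.card F = 2) {f : V → F} (hf : f ∈ hypCode F V) :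
    IsConical f := by
  have h01 : ∀ x : F, x = 0 ∨ x = 1 := by
    intro x
    have := FiniteField.pow_card x
    rw [hq] at this
    rcases eq_or_ne x 0 with h | h
    · exact Or.inl h
    · exact Or.inr (mul_left_cancel₀ h (by rw [mul_one, ← sq, this]))
  have h2 : (1 : F) + 1 = 0 := by
    have := FiniteField.cast_card_eq_zero F
    rw [hq] at this
    rw [one_add_one_eq_two]
    exact_mod_cast this
  have hchi : ∀ (φ : Module.Dual F V) (v : V), v ≠ 0 → chi φ v = 1 + φ v := by
    intro φ v hv
    rcases h01 (φ v) with h | h <;> simp [chi, h, hv, h2]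
  have key : ∃ (e : F) (φ : Module.Dual F V), ∀ v, v ≠ 0 → f v = e + φ v := by
    induction hf using Submodule.span_induction with
    | mem x hx =>
      obtain ⟨φ, -, rfl⟩ := hx
      exact ⟨1, φ, hchi φ⟩
    | zero => exact ⟨0, 0, by simp⟩
    | add x y _ _ h1 h2 =>
      obtain ⟨e, φ, h1⟩ := h1
      obtain ⟨d, ψ, h2⟩ := h2
      exact ⟨e + d, φ + ψ, fun v hv => by simp [h1 v hv, h2 v hv]; ring⟩
    | smul a x _ h1 =>
      obtain ⟨e, φ, h1⟩ := h1
      exact ⟨a * e, a • φ, fun v hv => by simp [h1 v hv]; ring⟩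
  obtain ⟨e, φ, h⟩ := key
  obtain ⟨κ, hκ, hφ, -⟩ := exists_cone_of_pair hV φ φ
  refine ⟨κ, hκ, ?_⟩
  by_cases h0 : φ = 0
  · have : f = e • allOne F V := by
      ext v
      rcases eq_or_ne v 0 with rfl | hv
      · simp [allOne, apply_zero_of_mem hf]
      · simp [allOne, hv, h v hv, h0]
    rw [this]
    exact Submodule.smul_mem _ _ (allOne_mem hκ)
  · have : f = (e - 1) • allOne F V + chi φ := by
      ext v
      rcases eq_or_ne v 0 with rfl | hv
      · simp [allOne, chi, apply_zero_of_mem hf]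
      · simp [allOne, hv, h v hv, hchi φ v hv]; ring
    rw [this]
    exact Submodule.add_mem _ (Submodule.smul_mem _ _ (allOne_mem hκ)) (chi_mem_coneCode h0 hφ)

end Cones

section Transfer

theorem exists_ker_eq {n : ℕ} {W : Submodule F (Fin (n + 1) → F)} (hW : Module.finrank F W = n) :
    ∃ φ : Module.Dual F (Fin (n + 1) → F), φ ≠ 0 ∧ W = LinearMap.ker φ := by
  have hlt : W < ⊤ := by
    rw [lt_top_iff_ne_top]
    rintro rfl
    rw [finrank_top, Module.finrank_fin_fun] at hW
    omega
  obtain ⟨φ, hφ, hle⟩ := W.exists_le_ker_of_lt_top hlt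
  refine ⟨φ, hφ, Submodule.eq_of_le_of_finrank_le hle ?_⟩
  have h1 := LinearMap.finrank_range_add_finrank_ker φ
  have h2 : LinearMap.range φ = ⊤ := LinearMap.range_eq_top.mpr (LinearMap.surjective hφ)
  rw [h2, finrank_top, Module.finrank_self, Module.finrank_fin_fun] at h1
  omega

theorem finrank_ker_dual {n : ℕ} {φ : Module.Dual F (Fin (n + 1) → F)} (hφ : φ ≠ 0) :
    Module.finrank F (LinearMap.ker φ) = n := by
  have h1 := LinearMap.finrank_range_add_finrank_ker φ
  have h2 : LinearMap.range φ = ⊤ := LinearMap.range_eq_top.mpr (LinearMap.surjective hφ)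
  rw [h2, finrank_top, Module.finrank_self, Module.finrank_fin_fun] at h1
  omega

theorem ptIn_mk_ker {n : ℕ} (φ : Module.Dual F (Fin (n + 1) → F)) {v : Fin (n + 1) → F}
    (hv : v ≠ 0) : ptIn (Projectivization.mk F v hv) (LinearMap.ker φ) ↔ φ v = 0 := by
  rw [ptIn, Projectivization.submodule_mk, Submodule.span_singleton_le_iff_mem, LinearMap.mem_ker]

variable {p n : ℕ}

/-- A word, as a function on vectors with values in `F`. -/
def toVec [Algebra (ZMod p) F] (c : Pt F n → ZMod p) (v : Fin (n + 1) → F) : F :=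
  if hv : v = 0 then 0 else algebraMap (ZMod p) F (c (Projectivization.mk F v hv))

theorem toVec_mem [Algebra (ZMod p) F] {c : Pt F n → ZMod p} (hc : c ∈ code F p n) :
    toVec c ∈ hypCode F (Fin (n + 1) → F) := by
  induction hc using Submodule.span_induction with
  | mem x hx =>
    obtain ⟨W, hW, rfl⟩ := hx
    obtain ⟨φ, hφ, rfl⟩ := exists_ker_eq hW
    convert chi_mem hφ using 1
    ext v
    by_cases hv : v = 0
    · simp [toVec, chi, hv]
    · simp only [toVec, chi, incVec, hv, ptIn_mk_ker, dif_neg, not_false_eq_true]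
      split_ifs <;> simp_all
  | zero =>
    convert Submodule.zero_mem _ using 1
    ext v
    simp [toVec]
  | add x y _ _ h1 h2 =>
    convert Submodule.add_mem _ h1 h2 using 1
    ext v
    by_cases hv : v = 0 <;> simp [toVec, hv]
  | smul a x _ h1 =>
    convert Submodule.smul_mem _ (algebraMap (ZMod p) F a) h1 using 1
    ext v
    by_cases hv : v = 0 <;> simp [toVec, hv]

theorem comp_rep_mem [Algebra (ZMod p) F] {κ : Submodule F (Fin (n + 1) → F)}
    {f : (Fin (n + 1) → F) → F} (hf : f ∈ coneCode κ) (ρ : F →ₗ[ZMod p] ZMod p) :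
    (fun P : Pt F n => ρ (f P.rep)) ∈ Submodule.span (ZMod p)
      (incVec p '' {H : Submodule F (Fin (n + 1) → F) | Module.finrank F H = n ∧ κ ≤ H}) := by
  induction hf using Submodule.span_induction generalizing ρ with
  | mem x hx =>
    obtain ⟨φ, hφ, hκ, rfl⟩ := hx
    have : (fun P : Pt F n => ρ (chi φ P.rep)) = ρ 1 • incVec p (LinearMap.ker φ) := by
      ext P
      have h1 := ptIn_mk_ker φ P.rep_nonzero
      rw [Projectivization.mk_rep] at h1
      simp only [chi, incVec, h1, Pi.smul_apply, P.rep_nonzero, ne_eq, not_false_eq_true, true_and]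
      split_ifs <;> simp
    rw [this]
    exact Submodule.smul_mem _ _ (Submodule.subset_span ⟨_, ⟨finrank_ker_dual hφ, hκ⟩, rfl⟩)
  | zero =>
    convert Submodule.zero_mem _ using 1
    ext P
    simp
  | add x y _ _ h1 h2 =>
    convert Submodule.add_mem _ (h1 ρ) (h2 ρ) using 1
    ext P
    simp
  | smul a x _ h1 => exact h1 (ρ ∘ₗ LinearMap.mulLeft (ZMod p) a)

theorem exists_combination [Fact p.Prime] [Algebra (ZMod p) F] {c : Pt F n → ZMod p}
    {κ : Submodule F (Fin (n + 1) → F)} (h : toVec c ∈ coneCode κ) :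
    ∃ (s : Finset (Submodule F (Fin (n + 1) → F)))
        (a : Submodule F (Fin (n + 1) → F) → ZMod p),
        (∀ H ∈ s, Module.finrank F H = n ∧ κ ≤ H) ∧
        c = ∑ H ∈ s, a H • incVec p H := by
  obtain ⟨ρ, hρ⟩ := LinearMap.exists_leftInverse_of_injective (Algebra.linearMap (ZMod p) F)
    (LinearMap.ker_eq_bot.mpr (algebraMap (ZMod p) F).injective)
  have h1 := comp_rep_mem h ρ
  have h2 : (fun P : Pt F n => ρ (toVec c P.rep)) = c := by
    ext P
    rw [toVec, dif_neg P.rep_nonzero, Projectivization.mk_rep]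
    exact DFunLike.congr_fun hρ (c P)
  rw [h2, Finsupp.mem_span_image_iff_linearCombination] at h1
  obtain ⟨l, hl, hlc⟩ := h1
  refine ⟨l.support, l, fun H hH => hl hH, ?_⟩
  rw [← hlc, Finsupp.linearCombination_apply, Finsupp.sum]

theorem nzc_toVec [Fintype F] [Fact p.Prime] [Algebra (ZMod p) F] (c : Pt F n → ZMod p) :
    nzc (toVec c) = (Fintype.card F - 1) * wt c := by
  have hinj : ∀ x : ZMod p, algebraMap (ZMod p) F x = 0 ↔ x = 0 := fun x => by
    rw [map_eq_zero_iff _ (algebraMap (ZMod p) F).injective]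
  have hfin : (supp c).Finite := Set.toFinite _
  rw [wt, Set.ncard_eq_toFinset_card _ hfin, nzc, ← Fintype.card_units, ← Finset.card_univ,
    ← Finset.card_product]
  symm
  refine Finset.card_bij (fun x _ => x.1 • x.2.rep) ?_ ?_ ?_
  · rintro ⟨u, P⟩ h
    simp only [Finset.mem_product, Finset.mem_univ, true_and, Set.Finite.mem_toFinset] at h
    have h0 : u • P.rep ≠ 0 := by simp [P.rep_nonzero, Units.smul_def]
    rw [Finset.mem_filter, toVec, dif_neg h0, ne_eq, hinj,
      show Projectivization.mk F (u • P.rep) h0 = P from ?_]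
    · exact ⟨Finset.mem_univ _, h⟩
    · conv_rhs => rw [← P.mk_rep]
      rw [Projectivization.mk_eq_mk_iff]
      exact ⟨u, rfl⟩
  · rintro ⟨u, P⟩ _ ⟨u', P'⟩ _ h
    simp only at h
    have h0 : u • P.rep ≠ 0 := by simp [P.rep_nonzero, Units.smul_def]
    have hP : P = P' := by
      rw [← P.mk_rep, ← P'.mk_rep, Projectivization.mk_eq_mk_iff]
      exact ⟨u⁻¹ * u', by rw [mul_smul, ← h, inv_smul_smul]⟩
    subst hP
    simp only [Prod.mk.injEq, and_true]
    have := smul_left_injective F P.rep_nonzero (show (u : F) • P.rep = (u' : F) • P.rep from h)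
    exact Units.ext this
  · intro v hv
    replace hv := (Finset.mem_filter.mp hv).2
    rw [toVec] at hv
    by_cases h0 : v = 0
    · simp [h0] at hv
    rw [dif_neg h0, ne_eq, hinj] at hv
    obtain ⟨u, hu⟩ := Projectivization.exists_smul_eq_mk_rep F v h0
    refine ⟨(u⁻¹, Projectivization.mk F v h0), ?_, ?_⟩
    · simpa [supp] using hv
    · simp only
      rw [← hu, inv_smul_smul]

theorem statement_of_isConical [Fact p.Prime] [Algebra (ZMod p) F] {c : Pt F n → ZMod p}
    (h : IsConical (toVec c)) :
    ∃ κ : Submodule F (Fin (n + 1) → F), Module.finrank F κ = n - 2 ∧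
      ∃ (s : Finset (Submodule F (Fin (n + 1) → F)))
        (a : Submodule F (Fin (n + 1) → F) → ZMod p),
        (∀ H ∈ s, Module.finrank F H = n ∧ κ ≤ H) ∧
        c = ∑ H ∈ s, a H • incVec p H := by
  obtain ⟨κ, hκ, hmem⟩ := h
  rw [Module.finrank_fin_fun] at hκ
  exact ⟨κ, by omega, exists_combination hmem⟩

end Transfer

section Apex

variable {V : Type} [AddCommGroup V] [Module F V] [Fintype F]

theorem moment_shift {h : F → F} {k : ℕ} (hk : ∀ i < k, ∑ y : F, y ^ i * h y = 0) (c : F) :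
    ∑ y : F, y ^ k * h (c + y) = ∑ y : F, y ^ k * h y := by
  have e : ∑ y : F, y ^ k * h (c + y) = ∑ y : F, (y - c) ^ k * h y := by
    rw [← Equiv.sum_comp (Equiv.addLeft c) (fun y => (y - c) ^ k * h y)]
    simp
  rw [e, ← sub_eq_zero, ← Finset.sum_sub_distrib]
  rcases Nat.eq_zero_or_pos k with rfl | hk0
  · simp
  have hd : ((Polynomial.X - Polynomial.C c) ^ k - Polynomial.X ^ k : Polynomial F).natDegree < k := by
    by_cases h0 : ((Polynomial.X - Polynomial.C c) ^ k - Polynomial.X ^ k : Polynomial F) = 0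
    · rw [h0]; simpa using hk0
    · have h1 := Polynomial.degree_sub_lt_left (p := ((Polynomial.X - Polynomial.C c) ^ k : Polynomial F))
        (q := Polynomial.X ^ k) (by simp) (pow_ne_zero _ (Polynomial.X_sub_C_ne_zero c))
        (by simp)
      rw [Polynomial.degree_pow, Polynomial.degree_X_sub_C, nsmul_eq_mul, mul_one] at h1
      exact (Polynomial.natDegree_lt_iff_degree_lt h0).mpr h1
  have := sum_eval_mul_eq_zero hk hd
  simpa [sub_mul] using this

/-- If the line sums through `P` vanish, then either `f` is invariant under translation by `P`,
or some moment with respect to `P` is a nontrivial form while all earlier moments vanish. -/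
theorem invariant_or_form {f : V → F} (hf : f ∈ hypCode F V) {P : V}
    {m : ℕ} (hm : 1 ≤ m) (hzero : ∀ i < m, ∀ v ∉ Submodule.span F {P},
      ∑ y : F, y ^ i * f (v + y • P) = 0) :
    (∀ v ∉ Submodule.span F {P}, ∀ y : F, f (v + y • P) = f v) ∨
      ∃ (k : ℕ) (g : V → F), m ≤ k ∧ k + 2 ≤ Fintype.card F ∧ IsForm k g ∧
        (∃ b ∉ Submodule.span F {P}, g b ≠ 0) ∧ (∀ v ∈ Submodule.span F {P}, g v = 0) ∧
        ∀ v ∉ Submodule.span F {P}, g v ≠ 0 → k + 1 ≤ lw f P v := by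
  by_cases h : ∃ k, k + 2 ≤ Fintype.card F ∧ ∃ v ∉ Submodule.span F {P},
      ∑ y : F, y ^ k * f (v + y • P) ≠ 0
  · right
    obtain ⟨hk, b, hb, hb0⟩ := Nat.find_spec h
    have hmin : ∀ i < Nat.find h, ∀ v ∉ Submodule.span F {P},
        ∑ y : F, y ^ i * f (v + y • P) = 0 := by
      intro i hi v hv
      have := Nat.find_min h hi
      push Not at this
      exact this (by omega) v hv
    have hmk : m ≤ Nat.find h := by
      by_contra! hlt
      exact hb0 (hzero _ hlt b hb)
    set k := Nat.find h
    obtain ⟨g, hg, hg1⟩ := exists_moment_form hf P hk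
    have hP : g P = 0 := by
      obtain ⟨L, hL⟩ := hg.2 b
      obtain ⟨Q, h1, h2, h3, -⟩ := hL P
      have hc : ∀ t, Q.eval t = g b := by
        intro t
        rw [h2, ← hg1 _ (add_smul_not_mem hb t), ← hg1 _ hb]
        have := moment_shift (h := fun y => f (b + y • P)) (fun i hi => hmin i hi b hb) t
        simp only [add_smul, ← add_assoc] at this
        exact this
      have hQ : Q = Polynomial.C (g b) := by
        refine Polynomial.eq_of_natDegree_lt_card_of_eval_eq' Q (Polynomial.C (g b)) Finset.univ ?_ ?_
        · intro t _
          rw [hc, Polynomial.eval_C]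
        · rw [Polynomial.natDegree_C, Finset.card_univ, max_lt_iff]
          omega
      rw [← h3, hQ, Polynomial.coeff_C, if_neg (by omega)]
    refine ⟨k, g, hmk, hk, hg, ⟨b, hb, by rwa [← hg1 b hb]⟩, ?_, ?_⟩
    · intro v hv
      obtain ⟨c, rfl⟩ := Submodule.mem_span_singleton.mp hv
      rw [hg.1, hP, mul_zero]
    · intro v hv hgv
      by_contra! hlt
      have := eq_zero_of_moments (h := fun y => f (v + y • P)) (m := k)
        (fun i hi => hmin i hi v hv) (by exact Nat.lt_succ_iff.mp hlt)
      apply hgv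
      rw [← hg1 v hv]
      simp [this]
  · left
    push Not at h
    intro v hv y
    have := eq_of_moments (h := fun y => f (v + y • P)) (fun i hi => h i hi v hv) y 0
    simpa using this

/-- Around each point `P` of the support, `f` is, up to a multiple of one hyperplane not
through `P`, invariant under translation by `P`. -/
def HasApexes (f : V → F) (s : F) : Prop :=
  ∀ P : V, f P ≠ 0 →
    (f P = s → ∀ v ∉ Submodule.span F {P}, ∀ y : F, f (v + y • P) = f v) ∧
    (f P ≠ s → ∃ φ : Module.Dual F V, φ P ≠ 0 ∧
      ∀ v ∉ Submodule.span F {P}, ∀ y : F, (f - (s - f P) • chi φ) (v + y • P) =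
        (f - (s - f P) • chi φ) v)

theorem lw_sub_chi_le (f : V → F) {P : V} {φ : Module.Dual F V} (hφ : φ P ≠ 0) (c : F) {v : V}
    (hv : v ∉ Submodule.span F {P}) : lw (f - c • chi φ) P v ≤ lw f P v + 1 := by
  rw [lw, lw, nnz, nnz]
  refine (Finset.card_le_card (t := insert (-(φ v / φ P))
    (Finset.univ.filter fun y => f (v + y • P) ≠ 0)) fun y hy => ?_).trans
    (Finset.card_insert_le _ _)
  simp only [Finset.mem_filter, Finset.mem_univ, true_and, Finset.mem_insert] at hy ⊢
  by_contra! h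
  apply hy
  simp only [Pi.sub_apply, Pi.smul_apply, chi_add_smul hv, h.2]
  rw [if_neg]
  · simp
  · intro h0
    apply h.1
    field_simp
    linear_combination h0

theorem exists_moment_dual {f : V → F} (hf : f ∈ hypCode F V) {s : F} (hs : HasLineSum f s)
    (hq : 3 ≤ Fintype.card F) {P b : V} (hP : P ≠ 0) (hb : b ∉ Submodule.span F {P}) :
    ∃ ψ : Module.Dual F V, ψ P = -(s - f P) ∧
      ∀ v ∉ Submodule.span F {P}, ∑ y : F, y * f (v + y • P) = ψ v := by
  obtain ⟨g, hg, hg1⟩ := exists_moment_form hf P (k := 1) hq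
  obtain ⟨ψ, hψ⟩ := hg.exists_dual
  simp only [pow_one] at hg1
  refine ⟨ψ, ?_, fun v hv => by rw [← hψ, hg1 v hv]⟩
  have h1 := hg1 b hb
  have h2 := hg1 (b + (1 : F) • P) (add_smul_not_mem hb 1)
  have h3 := hs P b hP hb
  rw [hψ, map_add, map_smul, ← hψ b, ← h1, ← Equiv.sum_comp (Equiv.addRight (-1 : F))] at h2
  simp only [Equiv.coe_addRight, smul_eq_mul, one_mul, add_mul, Finset.sum_add_distrib] at h2
  have e : ∀ y : F, b + (1 : F) • P + (y + -1) • P = b + y • P := fun y => by module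
  simp only [e, neg_one_mul, Finset.sum_neg_distrib] at h2
  linear_combination -h2 - h3

/-- The properties of a point violating the apex property. -/
theorem hasApexes_of_no_form {f : V → F} (hf : f ∈ hypCode F V) {s : F} (hs : HasLineSum f s)
    (hq : 3 ≤ Fintype.card F) (hV : ∀ P : V, ∃ b, b ∉ Submodule.span F {P})
    (h1 : ∀ (P : V) (k : ℕ) (g : V → F), f P ≠ 0 → 1 ≤ k → k + 2 ≤ Fintype.card F → IsForm k g →
      (∃ b ∉ Submodule.span F {P}, g b ≠ 0) → (∀ v ∈ Submodule.span F {P}, g v = 0) →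
      ((∀ v ∉ Submodule.span F {P}, g v ≠ 0 → k + 1 ≤ lw f P v) ∨
        (2 ≤ k ∧ ∀ v ∉ Submodule.span F {P}, 1 ≤ lw f P v ∧ (g v ≠ 0 → k ≤ lw f P v))) → False) :
    HasApexes f s := by
  intro P hP
  have hP0 : P ≠ 0 := by rintro rfl; exact hP (apply_zero_of_mem hf)
  constructor
  · intro hPs
    refine (invariant_or_form hf le_rfl fun i hi v hv => ?_).resolve_right ?_
    · have := hs P v hP0 hv
      obtain rfl : i = 0 := by omega
      simp only [pow_zero, one_mul]
      linear_combination this - hPs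
    · rintro ⟨k, g, hk, hkq, hg, hgb, hg0, hgl⟩
      exact h1 P k g hP hk hkq hg hgb hg0 (Or.inl hgl)
  · intro hPs
    obtain ⟨b, hb⟩ := hV P
    obtain ⟨φ, hφP, hφ⟩ := exists_moment_dual hf hs hq hP0 hb
    have hμ : s - f P ≠ 0 := sub_ne_zero.mpr (Ne.symm hPs)
    have hφ0 : φ P ≠ 0 := by rw [hφP]; exact neg_ne_zero.mpr hμ
    refine ⟨φ, hφ0, ?_⟩
    have hf' : f - (s - f P) • chi φ ∈ hypCode F V :=
      Submodule.sub_mem _ hf (Submodule.smul_mem _ _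
        (chi_mem (by rintro rfl; exact hφ0 (LinearMap.zero_apply _))))
    refine (invariant_or_form hf' (show 1 ≤ 2 by norm_num) fun i hi v hv => ?_).resolve_right ?_
    · have e1 := moment_chi hφ0 hv i
      have e2 := hs P v hP0 hv
      have e3 := hφ v hv
      simp only [Pi.sub_apply, Pi.smul_apply, smul_eq_mul, mul_sub, Finset.sum_sub_distrib]
      have e4 : ∑ y : F, y ^ i * ((s - f P) * chi φ (v + y • P)) =
          (s - f P) * (-(φ v / φ P)) ^ i := by
        rw [← e1, Finset.mul_sum]
        exact Finset.sum_congr rfl fun y _ => by ring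
      rw [e4]
      interval_cases i
      · simp only [pow_zero, one_mul, mul_one]
        linear_combination e2
      · simp only [pow_one]
        rw [e3, hφP]
        field_simp
        ring
    · rintro ⟨k, g, hk, hkq, hg, hgb, hg0, hgl⟩
      refine h1 P k g hP (by omega) hkq hg hgb hg0 (Or.inr ⟨hk, fun v hv => ⟨?_, fun hgv => ?_⟩⟩)
      · by_contra! hlt
        have h2 : ∀ y : F, f (v + y • P) = 0 := by
          intro y
          by_contra hy
          have : 0 < lw f P v := nnz_pos hy
          omega
        have e2 := hs P v hP0 hv
        simp only [h2, Finset.sum_const_zero, add_zero] at e2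
        exact hPs e2
      · have := hgl v hv hgv
        have := lw_sub_chi_le f hφ0 (s - f P) hv
        omega

variable [Fintype V]

theorem sum_lw_univ (f : V → F) (P : V) : ∑ v : V, lw f P v = Fintype.card F * nzc f := by
  simp only [lw, nnz, Finset.card_filter]
  rw [Finset.sum_comm]
  simp only [← Finset.card_filter]
  rw [← Finset.card_univ, ← smul_eq_mul, ← Finset.sum_const]
  refine Finset.sum_congr rfl fun y _ => ?_
  refine Finset.card_bij (fun v _ => v + y • P) (by simp) (by simp) fun v hv => ⟨v - y • P, ?_, by simp⟩
  simpa using hv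

omit [Fintype V] in
theorem lw_self {f : V → F} (hf : f ∈ hypCode F V) {P : V} (hP : f P ≠ 0) (v : V)
    (hv : v ∈ Submodule.span F {P}) : Fintype.card F - 1 ≤ lw f P v := by
  obtain ⟨c, rfl⟩ := Submodule.mem_span_singleton.mp hv
  rw [lw, nnz, ← Finset.card_univ, ← Finset.card_erase_of_mem (Finset.mem_univ (-c))]
  refine Finset.card_le_card fun y hy => ?_
  have : c + y ≠ 0 := fun h => (Finset.mem_erase.mp hy).1 (by linear_combination h)
  simp only [Finset.mem_filter, Finset.mem_univ, true_and]
  rw [← add_smul, apply_smul_of_mem hf this]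
  exact hP

theorem form_nonzero_count {d : ℕ} {g : V → F} (hg : IsForm d g) {u : V} (hgu : g u ≠ 0) :
    Fintype.card F * Fintype.card V ≤
      d * Fintype.card V + Fintype.card F * (Finset.univ.filter fun v => g v ≠ 0).card := by
  have h1 := form_zero_count hg ⊤ Submodule.mem_top hgu
  have h2 := Finset.card_filter_add_card_filter_not (s := (Finset.univ : Finset V)) (fun v => g v = 0)
  simp only [Submodule.mem_top, true_and, Finset.filter_true, Finset.card_univ] at h1 h2
  rw [← h2, mul_add]
  rw [h2]
  exact Nat.add_le_add_right h1 _

theorem card_span_singleton {P : V} (hP : P ≠ 0) :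
    (Finset.univ.filter fun v => v ∈ Submodule.span F {P}).card = Fintype.card F := by
  rw [← Finset.card_univ]
  symm
  refine Finset.card_bij (fun c _ => c • P) ?_ ?_ ?_
  · intro c _
    simp only [Finset.mem_filter, Finset.mem_univ, true_and]
    exact Submodule.smul_mem _ _ (Submodule.mem_span_singleton_self P)
  · intro c _ d _ h
    exact smul_left_injective F hP h
  · intro v hv
    simp only [Finset.mem_filter, Finset.mem_univ, true_and] at hv
    obtain ⟨c, hc⟩ := Submodule.mem_span_singleton.mp hv
    exact ⟨c, Finset.mem_univ c, hc⟩

theorem form_case_arith {q k Z N M : ℕ} (hk : 1 ≤ k) (hkq : k + 2 ≤ q)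
    (h1 : q * M ≤ k * M + q * Z) (h2 : q ^ 2 * N ≤ 2 * (q - 1) * M)
    (h3 : q * (q - 1) + (k + 1) * Z ≤ q * N) : False := by
  obtain ⟨r, rfl⟩ : ∃ r, q = k + 2 + r := ⟨q - (k + 2), by omega⟩
  obtain ⟨j, rfl⟩ : ∃ j, k = j + 1 := ⟨k - 1, by omega⟩
  have e : j + 1 + 2 + r - 1 = j + 2 + r := by omega
  rw [e] at h2 h3
  zify at *
  have h4 := mul_le_mul_of_nonneg_left h1 (show (0 : ℤ) ≤ j + 2 by positivity)
  have h5 := mul_le_mul_of_nonneg_left h3 (show (0 : ℤ) ≤ j + 1 + 2 + r by positivity)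
  have h6 : (0 : ℤ) ≤ j * r * M := by positivity
  have h7 : (0 : ℤ) < (j + 1 + 2 + r) ^ 2 * (j + 2 + r) := by positivity
  nlinarith

theorem form_case_arith_sub {q k A Z N M : ℕ} (hk : 2 ≤ k) (hkq : k + 2 ≤ q) (hA : M ≤ A + q)
    (h1 : q * M ≤ k * M + q * Z) (h2 : q ^ 2 * N ≤ 2 * (q - 1) * M)
    (h3 : q * (q - 1) + (A + (k - 1) * Z) ≤ q * N) : False := by
  obtain ⟨r, rfl⟩ : ∃ r, q = k + 2 + r := ⟨q - (k + 2), by omega⟩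
  obtain ⟨j, rfl⟩ : ∃ j, k = j + 2 := ⟨k - 2, by omega⟩
  have e : j + 2 + 2 + r - 1 = j + 3 + r := by omega
  have e' : j + 2 - 1 = j + 1 := by omega
  rw [e] at h2 h3
  rw [e'] at h3
  zify at *
  have h4 := mul_le_mul_of_nonneg_left h1 (show (0 : ℤ) ≤ j + 1 by positivity)
  have h5 := mul_le_mul_of_nonneg_left h3 (show (0 : ℤ) ≤ j + 2 + 2 + r by positivity)
  have h8 := mul_le_mul_of_nonneg_left hA (show (0 : ℤ) ≤ j + 2 + 2 + r by positivity)
  have h6 : (0 : ℤ) ≤ (j * r + j) * M := by positivity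
  have h7 : (0 : ℤ) < (j + 2 + 2 + r) ^ 2 * (j + 2 + r) := by positivity
  nlinarith

/-- Words of weight at most `2 q^(n-1)` have the apex property. -/
theorem hasApexes_of_nzc_le {f : V → F} (hf : f ∈ hypCode F V) {s : F} (hs : HasLineSum f s)
    (hq : 3 ≤ Fintype.card F) (hV : ∀ P : V, ∃ b, b ∉ Submodule.span F {P})
    (hN : Fintype.card F ^ 2 * nzc f ≤ 2 * (Fintype.card F - 1) * Fintype.card V) :
    HasApexes f s := by
  refine hasApexes_of_no_form hf hs hq hV ?_
  intro P k g hP hk hkq hg ⟨b, hb, hgb⟩ hg0 hcase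
  have hP0 : P ≠ 0 := by rintro rfl; exact hP (apply_zero_of_mem hf)
  have hcount := form_nonzero_count hg hgb
  set Z := (Finset.univ.filter fun v => g v ≠ 0).card with hZ
  have hsum := sum_lw_univ f P
  have hsplit := Finset.sum_filter_add_sum_filter_not Finset.univ
    (fun v => v ∈ Submodule.span F {P}) (fun v => lw f P v)
  have hspan : Fintype.card F * (Fintype.card F - 1) ≤ ∑ v ∈ Finset.univ.filter (fun v => v ∈ Submodule.span F {P}),
      lw f P v := by
    conv_lhs => rw [← card_span_singleton (F := F) hP0, ← smul_eq_mul, card_span_singleton hP0]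
    nth_rewrite 1 [← card_span_singleton (F := F) hP0]
    rw [← Finset.sum_const]
    refine Finset.sum_le_sum fun v hv => ?_
    exact lw_self hf hP v (by simpa using hv)
  have hZ' : (Finset.univ.filter fun v => g v ≠ 0) =
      (Finset.univ.filter fun v => v ∉ Submodule.span F {P}).filter fun v => g v ≠ 0 := by
    ext v
    simp only [Finset.mem_filter, Finset.mem_univ, true_and]
    exact ⟨fun h => ⟨fun h' => h (hg0 v h'), h⟩, fun h => h.2⟩
  rw [← hsplit] at hsum
  rcases hcase with h | ⟨hk2, h⟩
  · have hA : (k + 1) * Z ≤ ∑ v ∈ Finset.univ.filter (fun v => v ∉ Submodule.span F {P}),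
        lw f P v := by
      rw [hZ, hZ', mul_comm, ← smul_eq_mul, ← Finset.sum_const]
      refine le_trans (Finset.sum_le_sum fun v hv => ?_) (Finset.sum_le_sum_of_subset
        (Finset.filter_subset _ _))
      simp only [Finset.mem_filter, Finset.mem_univ, true_and] at hv
      exact h v hv.1 hv.2
    exact form_case_arith hk hkq hcount hN (hsum ▸ Nat.add_le_add hspan hA)
  · have hA : ((Finset.univ.filter fun v => v ∉ Submodule.span F {P}).card) + (k - 1) * Z ≤
        ∑ v ∈ Finset.univ.filter (fun v => v ∉ Submodule.span F {P}), lw f P v := by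
      rw [hZ, hZ', Finset.card_filter (fun v => g v ≠ 0), Finset.card_eq_sum_ones, Finset.mul_sum,
        ← Finset.sum_add_distrib]
      refine Finset.sum_le_sum fun v hv => ?_
      simp only [Finset.mem_filter, Finset.mem_univ, true_and] at hv
      have := h v hv
      split_ifs with h2
      · have := this.2 h2
        omega
      · omega
    have hc := card_not_mem (F := F) _ _ (card_span_singleton_le P)
    exact form_case_arith_sub hk2 hkq (Nat.sub_le_iff_le_add.mp hc) hcount hN (hsum ▸ Nat.add_le_add hspan hA)

end Apex

section Dichotomy

variable {V : Type} [AddCommGroup V] [Module F V] [Fintype F]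

theorem two_le_lw {f : V → F} {a b : V} {y z : F} (hyz : y ≠ z) (hy : f (b + y • a) ≠ 0)
    (hz : f (b + z • a) ≠ 0) : 2 ≤ lw f a b :=
  nnz_two_le (h := fun y => f (b + y • a)) hyz hy hz

theorem exists_of_lw_pos {f : V → F} {a b : V} (h : 0 < lw f a b) : ∃ y : F, f (b + y • a) ≠ 0 := by
  obtain ⟨y, hy⟩ := Finset.card_pos.mp h
  exact ⟨y, (Finset.mem_filter.mp hy).2⟩

theorem card_form_ne_zero {d : ℕ} {g : V → F} (hg : IsForm d g) (u : V) {v : V} (hv : g v ≠ 0) :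
    Fintype.card F ≤ (Finset.univ.filter fun t : F => g (u + t • v) ≠ 0).card + d := by
  obtain ⟨L, hL⟩ := hg.2 u
  obtain ⟨Q, h1, h2, h3, -⟩ := hL v
  have hQ : Q ≠ 0 := by
    rintro rfl
    exact hv (by rw [← h3, Polynomial.coeff_zero])
  have h4 := card_roots_le h1 hQ
  have h5 := Finset.card_filter_add_card_filter_not (s := (Finset.univ : Finset F))
    (fun t => g (u + t • v) = 0)
  simp only [h2] at h4
  rw [Finset.card_univ] at h5
  simp only [ne_eq]
  omega

variable [Fintype V]

theorem sum_sum_lw_univ (f : V → F) (P x : V) :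
    ∑ v : V, ∑ y : F, lw f x (v + y • P) = Fintype.card F ^ 2 * nzc f := by
  rw [Finset.sum_comm]
  have : ∀ y : F, ∑ v : V, lw f x (v + y • P) = Fintype.card F * nzc f := fun y => by
    rw [← sum_lw_univ f x]
    exact Equiv.sum_comp (Equiv.addRight (y • P)) (lw f x)
  simp only [this, Finset.sum_const, Finset.card_univ, smul_eq_mul]
  ring

theorem hasApexes_of_dichotomy {f : V → F} (hf : f ∈ hypCode F V) {s : F} (hs : HasLineSum f s)
    (hq : 3 ≤ Fintype.card F) (hV : ∀ P : V, ∃ b, b ∉ Submodule.span F {P}) {d : ℕ}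
    (hd : ∀ a, f a ≠ 0 → ∀ b ∉ Submodule.span F {a}, lw f a b ≤ 1 ∨ Fintype.card F ≤ lw f a b + d)
    (hN : Fintype.card F ^ 2 * nzc f < (Fintype.card V - Fintype.card F ^ 2) *
      ((Fintype.card F - 2 * d) * (Fintype.card F - d))) :
    HasApexes f s := by
  refine hasApexes_of_no_form hf hs hq hV ?_
  intro P k g hP hk hkq hg ⟨b, hb, hgb⟩ hg0 hcase
  have hP0 : P ≠ 0 := by rintro rfl; exact hP (apply_zero_of_mem hf)
  have h2 : ∀ v ∉ Submodule.span F {P}, g v ≠ 0 → 2 ≤ lw f P v := by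
    intro v hv hgv
    rcases hcase with h | ⟨hk2, h⟩
    · have := h v hv hgv
      omega
    · have := (h v hv).2 hgv
      omega
  have hlong : ∀ v ∉ Submodule.span F {P}, g v ≠ 0 → Fintype.card F ≤ lw f P v + d := by
    intro v hv hgv
    have := h2 v hv hgv
    rcases hd P hP v hv with h | h
    · omega
    · exact h
  obtain ⟨y0, hy0⟩ := exists_of_lw_pos (lt_of_lt_of_le zero_lt_two (h2 b hb hgb))
  set x := b + y0 • P with hx
  have hxP : x ∉ Submodule.span F {P} := add_smul_not_mem hb y0
  have hmain : ∀ v ∉ Submodule.span F {P, x},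
      (Fintype.card F - 2 * d) * (Fintype.card F - d) ≤ ∑ y : F, lw f x (v + y • P) := by
    intro v hv
    have hvb : ∀ t : F, v + t • b ∉ Submodule.span F {P} := by
      intro t ht
      apply hv
      have e : v = (v + t • b) + ((t * y0) • P - t • x) := by rw [hx]; module
      rw [e]
      refine Submodule.add_mem _ (Submodule.span_mono (by simp) ht)
        (Submodule.sub_mem _ ?_ ?_)
      · exact Submodule.smul_mem _ _ (Submodule.subset_span (by simp))
      · exact Submodule.smul_mem _ _ (Submodule.subset_span (by simp))
    have hc := card_form_ne_zero hg v hgb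
    obtain ⟨t1, ht1, t2, ht2, ht⟩ := Finset.one_lt_card.mp
      (show 1 < (Finset.univ.filter fun t : F => g (v + t • b) ≠ 0).card by omega)
    simp only [Finset.mem_filter, Finset.mem_univ, true_and] at ht1 ht2
    have hcol : ∀ t : F, g (v + t • b) ≠ 0 → Fintype.card F ≤
        (Finset.univ.filter fun y : F => f (v + y • P + t • x) ≠ 0).card + d := by
      intro t ht
      have h1 := hlong _ (hvb t) ht
      rw [← lw_add_smul f P (v + t • b) (t * y0)] at h1
      have e : ∀ y : F, v + t • b + (t * y0) • P + y • P = v + y • P + t • x := fun y => by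
        rw [hx]; module
      simpa only [lw, nnz, e] using h1
    have h1 := hcol t1 ht1
    have h2 := hcol t2 ht2
    have h3 := Finset.card_inter_add_card_union
      (Finset.univ.filter fun y : F => f (v + y • P + t1 • x) ≠ 0)
      (Finset.univ.filter fun y : F => f (v + y • P + t2 • x) ≠ 0)
    have h4 := Finset.card_le_univ ((Finset.univ.filter fun y : F => f (v + y • P + t1 • x) ≠ 0) ∪
      (Finset.univ.filter fun y : F => f (v + y • P + t2 • x) ≠ 0))
    set I := (Finset.univ.filter fun y : F => f (v + y • P + t1 • x) ≠ 0) ∩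
      (Finset.univ.filter fun y : F => f (v + y • P + t2 • x) ≠ 0)
    calc (Fintype.card F - 2 * d) * (Fintype.card F - d) ≤ I.card * (Fintype.card F - d) :=
          Nat.mul_le_mul_right _ (by omega)
      _ = ∑ y ∈ I, (Fintype.card F - d) := by rw [Finset.sum_const, smul_eq_mul]
      _ ≤ ∑ y ∈ I, lw f x (v + y • P) := by
          refine Finset.sum_le_sum fun y hy => ?_
          simp only [I, Finset.mem_inter, Finset.mem_filter, Finset.mem_univ, true_and] at hy
          have h5 := two_le_lw ht hy.1 hy.2
          have h6 : v + y • P ∉ Submodule.span F {x} := by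
            intro h
            apply hv
            have e : v = (v + y • P) - y • P := by module
            rw [e]
            exact Submodule.sub_mem _ (Submodule.span_mono (by simp) h)
              (Submodule.smul_mem _ _ (Submodule.subset_span (by simp)))
          rcases hd x hy0 _ h6 with h | h <;> omega
      _ ≤ ∑ y : F, lw f x (v + y • P) :=
          Finset.sum_le_sum_of_subset (Finset.subset_univ I)
  have hc := card_not_mem (F := F) _ _ (card_span_pair_le P x)
  have hle : (Fintype.card V - Fintype.card F ^ 2) *
      ((Fintype.card F - 2 * d) * (Fintype.card F - d)) ≤ Fintype.card F ^ 2 * nzc f := by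
    rw [← sum_sum_lw_univ f P x]
    refine (Nat.mul_le_mul_right _ hc).trans ?_
    rw [← smul_eq_mul, ← Finset.sum_const]
    refine le_trans (Finset.sum_le_sum fun v hv => ?_)
      (Finset.sum_le_sum_of_subset (Finset.filter_subset _ _))
    exact hmain v (Finset.mem_filter.mp hv).2
  omega

end Dichotomy

section Structure

variable {V : Type} [AddCommGroup V] [Module F V] [Fintype F]

theorem eq_smul_chi_of_submodule {g : V → F} {b : F} (hb : b ≠ 0) {M : Submodule F V} (hM : M ≠ ⊤)
    (hg : ∀ v, g v = if v ≠ 0 ∧ v ∈ M then b else 0) (hs : HasLineSum g b) :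
    ∃ ψ : Module.Dual F V, ψ ≠ 0 ∧ g = b • chi ψ := by
  obtain ⟨u, hu⟩ : ∃ u, u ∉ M := by
    by_contra! h
    exact hM (eq_top_iff.mpr fun v _ => h v)
  have hu0 : u ≠ 0 := ne_zero_of_not_mem hu
  have hcompl : ∀ v, ∃ y : F, v + y • u ∈ M := by
    intro v
    by_cases hv : v ∈ Submodule.span F {u}
    · obtain ⟨c, rfl⟩ := Submodule.mem_span_singleton.mp hv
      exact ⟨-c, by simp⟩
    · by_contra! h
      have := hs u v hu0 hv
      simp only [hg, hu, h, and_false, if_false, Finset.sum_const_zero, add_zero] at this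
      exact hb this.symm
  obtain ⟨ψ, hψ, hle⟩ := Submodule.exists_le_ker_of_lt_top M (lt_top_iff_ne_top.mpr hM)
  have hψu : ψ u ≠ 0 := by
    intro h
    apply hψ
    ext v
    obtain ⟨y, hy⟩ := hcompl v
    have := LinearMap.mem_ker.mp (hle hy)
    simpa [h] using this
  refine ⟨ψ, hψ, funext fun v => ?_⟩
  have hiff : v ∈ M ↔ ψ v = 0 := by
    refine ⟨fun h => LinearMap.mem_ker.mp (hle h), fun h => ?_⟩
    obtain ⟨y, hy⟩ := hcompl v
    have := LinearMap.mem_ker.mp (hle hy)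
    rw [map_add, map_smul, h, zero_add, smul_eq_mul] at this
    have hy0 : y = 0 := (mul_eq_zero.mp this).resolve_right hψu
    simpa [hy0] using hy
  simp only [hg, hiff, Pi.smul_apply, chi, smul_eq_mul, mul_ite, mul_one, mul_zero]

omit [Fintype F] in
theorem not_mem_span_of_dual {φ : Module.Dual F V} {P h : V} (hP : φ P ≠ 0) (hh : φ h = 0)
    (h0 : h ≠ 0) : h ∉ Submodule.span F {P} := by
  intro hm
  obtain ⟨c, rfl⟩ := Submodule.mem_span_singleton.mp hm
  rw [map_smul, smul_eq_mul] at hh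
  rw [(mul_eq_zero.mp hh).resolve_right hP, zero_smul] at h0
  exact h0 rfl

variable [Fintype V]

theorem sum_ker_lw_le (f : V → F) {φ : Module.Dual F V} {P : V} (hP : φ P ≠ 0) :
    ∑ h ∈ Finset.univ.filter (fun h => φ h = 0), lw f P h ≤ nzc f := by
  have := card_filter_le_nzc f ((Finset.univ.filter fun h => φ h = 0) ×ˢ (Finset.univ : Finset F))
    (fun x => x.1 + x.2 • P) (by
      rintro ⟨h, y⟩ hx ⟨h', y'⟩ hx' he
      simp only [Finset.coe_product, Set.mem_prod, Finset.mem_coe, Finset.mem_filter,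
        Finset.mem_univ, true_and, and_true] at hx hx'
      simp only at he
      have e := congrArg φ he
      rw [map_add, map_add, hx, hx', map_smul, map_smul, zero_add, zero_add] at e
      obtain rfl : y = y' := mul_right_cancel₀ hP e
      rw [add_right_cancel he])
  refine le_trans (le_of_eq ?_) this
  rw [Finset.card_filter, Finset.sum_product]
  refine Finset.sum_congr rfl fun h _ => ?_
  rw [lw, nnz, Finset.card_filter]

theorem card_ker {φ : Module.Dual F V} {P : V} (hP : φ P ≠ 0) :
    Fintype.card F * (Finset.univ.filter fun h => φ h = 0).card = Fintype.card V := by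
  rw [mul_comm, ← Finset.card_univ (α := F), ← Finset.card_product, ← Finset.card_univ]
  refine Finset.card_bij (fun x _ => x.1 + x.2 • P) (by simp) ?_ ?_
  · rintro ⟨h, y⟩ hx ⟨h', y'⟩ hx' he
    simp only [Finset.mem_product, Finset.mem_filter,
        Finset.mem_univ, true_and, and_true] at hx hx'
    simp only at he
    have e := congrArg φ he
    rw [map_add, map_add, hx, hx', map_smul, map_smul, zero_add, zero_add] at e
    obtain rfl : y = y' := mul_right_cancel₀ hP e
    rw [add_right_cancel he]
  · intro v _
    refine ⟨(v - (φ v / φ P) • P, φ v / φ P), ?_, by simp⟩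
    simp [hP]

/-- The number of points of the hyperplane `φ` on which `f - c • chi φ` is nonzero. -/
def residual (f : V → F) (c : F) (φ : Module.Dual F V) : ℕ :=
  (Finset.univ.filter fun h => φ h = 0 ∧ (f - c • chi φ) h ≠ 0).card

omit [Fintype F] [Fintype V] in
theorem sub_chi_apply_of_ne (f : V → F) (c : F) {φ : Module.Dual F V} {v : V} (h : φ v ≠ 0) :
    (f - c • chi φ) v = f v := by
  simp [chi, h]

omit [Fintype F] [Fintype V] in
theorem sub_chi_apply_of_eq (f : V → F) (c : F) {φ : Module.Dual F V} {v : V} (h : φ v = 0)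
    (h0 : v ≠ 0) : (f - c • chi φ) v = f v - c := by
  simp [chi, h, h0]

theorem residual_le {f : V → F} (hf : f ∈ hypCode F V) (hq : 3 ≤ Fintype.card F) {P : V}
    {φ : Module.Dual F V} {c : F} (hP : f P ≠ 0) (hφ : φ P ≠ 0) (hc : c ≠ 0)
    (hinv : ∀ v ∉ Submodule.span F {P}, ∀ y : F,
      (f - c • chi φ) (v + y • P) = (f - c • chi φ) v)
    {J : ℕ} (hV : Fintype.card V = Fintype.card F * (Fintype.card F * J))
    (hN : 2 * nzc f ≤ (Fintype.card F ^ 2 - Fintype.card F + 2) * J) :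
    2 * residual f c φ + J + 2 ≤ Fintype.card F * J := by
  have hK : (Finset.univ.filter fun h => φ h = 0).card = Fintype.card F * J :=
    Nat.eq_of_mul_eq_mul_left (by omega) ((card_ker hφ).trans hV)
  have h1 := sum_ker_lw_le f hφ
  have hmem : (0 : V) ∈ Finset.univ.filter (fun h => φ h = 0) := by simp
  rw [← Finset.add_sum_erase _ _ hmem] at h1
  have h2 := lw_self hf hP 0 (Submodule.zero_mem _)
  have h3 : ((Finset.univ.filter fun h => φ h = 0).erase 0).card +
      (Fintype.card F - 2) * residual f c φ ≤
      ∑ h ∈ (Finset.univ.filter fun h => φ h = 0).erase 0, lw f P h := by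
    have e : residual f c φ = (((Finset.univ.filter fun h => φ h = 0).erase 0).filter
        fun h => (f - c • chi φ) h ≠ 0).card := by
      rw [residual]
      congr 1
      ext h
      simp only [Finset.mem_filter, Finset.mem_univ, true_and, Finset.mem_erase]
      refine ⟨fun hh => ⟨⟨?_, hh.1⟩, hh.2⟩, fun hh => ⟨hh.1.2, hh.2⟩⟩
      rintro rfl
      apply hh.2
      simp [chi, apply_zero_of_mem hf]
    rw [e, Finset.card_filter (fun h => (f - c • chi φ) h ≠ 0), Finset.card_eq_sum_ones,
      Finset.mul_sum, ← Finset.sum_add_distrib]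
    refine Finset.sum_le_sum fun h hh => ?_
    simp only [Finset.mem_filter, Finset.mem_univ, true_and, Finset.mem_erase] at hh
    have hhP := not_mem_span_of_dual hφ hh.2 hh.1
    split_ifs with h4
    · rw [mul_one]
      have h5 : Fintype.card F - 1 ≤ lw f P h := by
        rw [lw, nnz, ← Finset.card_univ, ← Finset.card_erase_of_mem (Finset.mem_univ (0 : F))]
        refine Finset.card_le_card fun y hy => ?_
        have hy0 := (Finset.mem_erase.mp hy).1
        simp only [Finset.mem_filter, Finset.mem_univ, true_and]
        rw [← sub_chi_apply_of_ne f c (φ := φ), hinv h hhP]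
        · exact h4
        · simp [hh.2, hy0, hφ]
      omega
    · rw [mul_zero, add_zero]
      rw [not_not, sub_chi_apply_of_eq f c hh.2 hh.1, sub_eq_zero] at h4
      exact nnz_pos (h := fun y => f (h + y • P)) (y := 0) (by simpa [h4] using hc)
  rw [Finset.card_erase_of_mem hmem, hK] at h3
  obtain ⟨r, hr⟩ : ∃ r, Fintype.card F = r + 3 := ⟨Fintype.card F - 3, by omega⟩
  rw [hr] at hN h2 h3 ⊢
  have e1 : (r + 3) ^ 2 - (r + 3) + 2 = r ^ 2 + 5 * r + 8 := by
    have : (r + 3) ^ 2 = (r ^ 2 + 5 * r + 6) + (r + 3) := by ring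
    omega
  have e2 : r + 3 - 2 = r + 1 := by omega
  have e3 : r + 3 - 1 = r + 2 := by omega
  rw [e1] at hN
  rw [e2] at h3
  rw [e3] at h2
  have h6 : 2 * (r + 2 + ((r + 3) * J + (r + 1) * residual f c φ)) ≤
      (r ^ 2 + 5 * r + 8) * J + 2 := by omega
  have h7 : (r + 1) * (2 * residual f c φ + J + 2) ≤ (r + 1) * ((r + 3) * J) := by nlinarith
  exact Nat.le_of_mul_le_mul_left h7 (by omega)

/-- If the support together with zero is additively closed, it is a submodule. -/
def supportSubmodule {f : V → F} (hf : f ∈ hypCode F V)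
    (h : ∀ u v, f u ≠ 0 → f v ≠ 0 → v ∉ Submodule.span F {u} → f (u + v) ≠ 0) :
    Submodule F V where
  carrier := {v | v = 0 ∨ f v ≠ 0}
  zero_mem' := Or.inl rfl
  add_mem' := by
    rintro u v (rfl | hu) (rfl | hv)
    · simp
    · simpa using Or.inr hv
    · simpa using Or.inr hu
    · by_cases hs : v ∈ Submodule.span F {u}
      · obtain ⟨c, rfl⟩ := Submodule.mem_span_singleton.mp hs
        have e : u + c • u = (1 + c) • u := by module
        rw [e]
        by_cases hc : 1 + c = 0
        · left
          rw [hc, zero_smul]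
        · right
          rwa [apply_smul_of_mem hf hc]
      · exact Or.inr (h u v hu hv hs)
  smul_mem' := by
    rintro c v (rfl | hv)
    · simp
    · by_cases hc : c = 0
      · left
        rw [hc, zero_smul]
      · right
        rwa [apply_smul_of_mem hf hc]

omit [Fintype V] in
theorem eq_smul_chi_of_closed {f : V → F} (hf : f ∈ hypCode F V)
    (h : ∀ u v, f u ≠ 0 → f v ≠ 0 → v ∉ Submodule.span F {u} → f (u + v) ≠ 0)
    {b : F} (hb : b ≠ 0) (hfb : ∀ v, f v ≠ 0 → f v = b) (hs : HasLineSum f b)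
    {x : V} (hx0 : x ≠ 0) (hx : f x = 0) :
    ∃ ψ : Module.Dual F V, ψ ≠ 0 ∧ f = b • chi ψ := by
  refine eq_smul_chi_of_submodule hb (M := supportSubmodule hf h) ?_ ?_ hs
  · intro htop
    have : x ∈ supportSubmodule hf h := htop ▸ Submodule.mem_top
    rcases this with h' | h'
    · exact hx0 h'
    · exact h' hx
  · intro v
    have hmem : v ∈ supportSubmodule hf h ↔ v = 0 ∨ f v ≠ 0 := Iff.rfl
    rw [hmem]
    by_cases hv : f v = 0
    · rw [if_neg (by tauto), hv]
    · have hv0 : v ≠ 0 := by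
        rintro rfl
        exact hv (apply_zero_of_mem hf)
      rw [if_pos ⟨hv0, Or.inr hv⟩, hfb v hv]

theorem residual_add_residual {f : V → F}
    {X : V} {φ χ : Module.Dual F V} {c e : F} (hφX : φ X ≠ 0) (hχX : χ X ≠ 0)
    (hc : c ≠ 0)
    (hinv : ∀ v ∉ Submodule.span F {X}, ∀ y : F,
      (f - e • chi χ) (v + y • X) = (f - e • chi χ) v)
    {J : ℕ} (hV : Fintype.card V = Fintype.card F * (Fintype.card F * J))
    {u : V} (hu : φ u = 0) (hχu : χ u ≠ 0) :
    Fintype.card F * J ≤ J + residual f c φ + residual f e χ := by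
  have hq : 0 < Fintype.card F := Fintype.card_pos
  have hK : (Finset.univ.filter fun h => φ h = 0).card = Fintype.card F * J :=
    Nat.eq_of_mul_eq_mul_left hq ((card_ker hφX).trans hV)
  have h1 : (Finset.univ.filter fun h => φ h = 0 ∧ χ h = 0).card ≤ J := by
    have := form_zero_count (IsForm.dual χ) (LinearMap.ker φ) (u := u) hu hχu
    simp only [LinearMap.mem_ker, one_mul] at this
    rw [hK] at this
    exact Nat.le_of_mul_le_mul_left this hq
  have h2 : (Finset.univ.filter fun h => φ h = 0 ∧ χ h ≠ 0 ∧ (f - c • chi φ) h = 0).card ≤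
      residual f e χ := by
    refine Finset.card_le_card_of_injOn (fun h => h - (χ h / χ X) • X) ?_ ?_
    · intro h hh
      simp only [Finset.coe_filter, Finset.mem_univ, true_and, Set.mem_ofPred_eq] at hh ⊢
      refine ⟨by simp [hχX], ?_⟩
      have h0 : h ≠ 0 := by
        rintro rfl
        exact hh.2.1 (map_zero χ)
      have := hinv h (not_mem_span_of_dual hφX hh.1 h0) (-(χ h / χ X))
      rw [neg_smul, ← sub_eq_add_neg] at this
      rw [this, sub_chi_apply_of_ne f e hh.2.1]
      have h3 := hh.2.2
      rw [sub_chi_apply_of_eq f c hh.1 h0, sub_eq_zero] at h3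
      rwa [h3]
    · intro h hh h' hh' he
      simp only [Finset.coe_filter, Finset.mem_univ, true_and, Set.mem_ofPred_eq] at hh hh' he
      have e1 := congrArg φ he
      rw [map_sub, map_sub, hh.1, hh'.1, map_smul, map_smul, zero_sub, zero_sub, neg_inj] at e1
      rw [mul_right_cancel₀ hφX e1] at he
      exact sub_left_injective he
  have h3 : Finset.univ.filter (fun h => φ h = 0) ⊆
      (Finset.univ.filter fun h => φ h = 0 ∧ χ h = 0) ∪
      (Finset.univ.filter fun h => φ h = 0 ∧ (f - c • chi φ) h ≠ 0) ∪
      (Finset.univ.filter fun h => φ h = 0 ∧ χ h ≠ 0 ∧ (f - c • chi φ) h = 0) := by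
    intro h hh
    simp only [Finset.mem_filter, Finset.mem_univ, true_and, Finset.mem_union] at hh ⊢
    tauto
  have h4 := (Finset.card_le_card h3).trans (Finset.card_union_le _ _)
  have h5 := Finset.card_union_le (Finset.univ.filter fun h => φ h = 0 ∧ χ h = 0)
    (Finset.univ.filter fun h => φ h = 0 ∧ (f - c • chi φ) h ≠ 0)
  rw [hK] at h4
  have : residual f c φ = (Finset.univ.filter fun h => φ h = 0 ∧ (f - c • chi φ) h ≠ 0).card := rfl
  omega

end Structure

section Structure

variable {V : Type} [AddCommGroup V] [Module F V] [Fintype F] [Fintype V]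

omit [Fintype V] in
theorem hasLineSum_sub {f : V → F} {s : F} (hs : HasLineSum f s) (c : F) (φ : Module.Dual F V) :
    HasLineSum (f - c • chi φ) (s - c) := by
  have := hs.add ((hasLineSum_chi φ).smul (-c))
  rw [mul_one] at this
  rwa [sub_eq_add_neg, sub_eq_add_neg, ← neg_smul]

omit [Fintype F] [Fintype V] in
theorem isConical_zero [FiniteDimensional F V] (hd : 3 ≤ Module.finrank F V) :
    IsConical (0 : V → F) := by
  obtain ⟨κ, -, hκ⟩ := exists_le_finrank_eq (W := (⊤ : Submodule F V))
    (m := Module.finrank F V - 3) (by rw [finrank_top]; omega)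
  exact ⟨κ, by omega, Submodule.zero_mem _⟩

theorem isConical_of_invariant_all {f : V → F} (hf : f ∈ hypCode F V)
    {s : F} (hs : HasLineSum f s) (hd : 3 ≤ Module.finrank F V)
    (hall : ∀ P, f P ≠ 0 → f P = s)
    (hinv : ∀ P, f P ≠ 0 → ∀ v ∉ Submodule.span F {P}, ∀ y : F, f (v + y • P) = f v)
    {x : V} (hx0 : x ≠ 0) (hx : f x = 0) : IsConical f := by
  by_cases h0 : f = 0
  · rw [h0]
    exact isConical_zero hd
  obtain ⟨P, hP⟩ : ∃ P, f P ≠ 0 := by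
    by_contra! h
    exact h0 (funext h)
  have hs0 : s ≠ 0 := by rw [← hall P hP]; exact hP
  obtain ⟨ψ, hψ, e⟩ := eq_smul_chi_of_closed hf (fun u v hu hv huv => by
    have := hinv u hu v huv 1
    rw [one_smul, add_comm] at this
    rwa [this]) hs0 hall hs hx0 hx
  have := isConical_of_two hd hψ hψ s 0
  rwa [zero_smul, add_zero, ← e] at this

/-- A word of small weight with the apex property is a combination of at most two hyperplanes. -/
theorem isConical_of_hasApexes {f : V → F} (hf : f ∈ hypCode F V) {s : F} (hs : HasLineSum f s)
    (hq : 3 ≤ Fintype.card F) (hd : 3 ≤ Module.finrank F V) (hA : HasApexes f s)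
    {J : ℕ} (hJ : 0 < J) (hV : Fintype.card V = Fintype.card F * (Fintype.card F * J))
    (hN : 2 * nzc f ≤ (Fintype.card F ^ 2 - Fintype.card F + 2) * J) : IsConical f := by
  by_cases hall : ∀ P, f P ≠ 0 → f P = s
  · obtain ⟨x, hx0, hx⟩ : ∃ x : V, x ≠ 0 ∧ f x = 0 := by
      by_contra! h
      have h1 : (Finset.univ.erase (0 : V)).card ≤ nzc f :=
        Finset.card_le_card fun v hv => by
          simpa using h v (Finset.mem_erase.mp hv).1
      rw [Finset.card_erase_of_mem (Finset.mem_univ _), Finset.card_univ, hV] at h1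
      obtain ⟨r, hr⟩ : ∃ r, Fintype.card F = r + 3 := ⟨Fintype.card F - 3, by omega⟩
      rw [hr] at hN h1
      have e1 : (r + 3) ^ 2 - (r + 3) + 2 = r ^ 2 + 5 * r + 8 := by
        have : (r + 3) ^ 2 = (r ^ 2 + 5 * r + 6) + (r + 3) := by ring
        omega
      rw [e1] at hN
      have h2 : (r + 3) * ((r + 3) * J) ≤ nzc f + 1 := by omega
      nlinarith
    exact isConical_of_invariant_all hf hs hd hall
      (fun P hP => (hA P hP).1 (hall P hP)) hx0 hx
  push Not at hall
  obtain ⟨P, hP, hPs⟩ := hall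
  obtain ⟨φ, hφP, hinvP⟩ := (hA P hP).2 hPs
  have hc : s - f P ≠ 0 := sub_ne_zero.mpr (Ne.symm hPs)
  set c := s - f P with hcdef
  have hΛ := residual_le hf hq hP hφP hc hinvP hV hN
  have hK : (Finset.univ.filter fun h => φ h = 0).card = Fintype.card F * J :=
    Nat.eq_of_mul_eq_mul_left (by omega) ((card_ker hφP).trans hV)
  have hΛdef : residual f c φ = (Finset.univ.filter fun h => φ h = 0 ∧ (f - c • chi φ) h ≠ 0).card :=
    rfl
  have hsplit := Finset.card_filter_add_card_filter_not (s := Finset.univ.filter fun h => φ h = 0)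
    (fun h => (f - c • chi φ) h ≠ 0)
  rw [Finset.filter_filter, Finset.filter_filter, hK, ← hΛdef] at hsplit
  -- all apexes outside the hyperplane agree
  have hX : ∀ X, f X ≠ 0 → φ X ≠ 0 → f X = f P ∧ ∀ v ∉ Submodule.span F {X}, ∀ y : F,
      (f - c • chi φ) (v + y • X) = (f - c • chi φ) v := by
    intro X hX hφX
    by_cases hXs : f X = s
    · exfalso
      have hinv := (hA X hX).1 hXs
      have h1 := sum_ker_lw_le f hφX
      have h2 : (((Finset.univ.filter fun h => φ h = 0 ∧ ¬ (f - c • chi φ) h ≠ 0).erase 0).card) *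
          Fintype.card F ≤ ∑ h ∈ Finset.univ.filter (fun h => φ h = 0), lw f X h := by
        rw [← smul_eq_mul, ← Finset.sum_const]
        refine le_trans (Finset.sum_le_sum fun h hh => ?_) (Finset.sum_le_sum_of_subset (?_ :
          (Finset.univ.filter fun h => φ h = 0 ∧ ¬ (f - c • chi φ) h ≠ 0).erase 0 ⊆ _))
        · simp only [Finset.mem_erase, Finset.mem_filter, Finset.mem_univ, true_and, not_not] at hh
          have h3 := hh.2.2
          rw [sub_chi_apply_of_eq f c hh.2.1 hh.1, sub_eq_zero] at h3
          rw [lw, nnz, Finset.filter_true_of_mem, Finset.card_univ]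
          intro y _
          rw [hinv h (not_mem_span_of_dual hφX hh.2.1 hh.1), h3]
          exact hc
        · intro h hh
          simp only [Finset.mem_erase, Finset.mem_filter, Finset.mem_univ, true_and] at hh ⊢
          exact hh.2.1
      have h3 := Finset.pred_card_le_card_erase
        (s := Finset.univ.filter fun h => φ h = 0 ∧ ¬ (f - c • chi φ) h ≠ 0) (a := (0 : V))
      obtain ⟨r, hr⟩ : ∃ r, Fintype.card F = r + 3 := ⟨Fintype.card F - 3, by omega⟩
      have e1 : (r + 3) ^ 2 - (r + 3) + 2 = r ^ 2 + 5 * r + 8 := by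
        have : (r + 3) ^ 2 = (r ^ 2 + 5 * r + 6) + (r + 3) := by ring
        omega
      rw [hr] at hN h2 hΛ hsplit
      rw [e1] at hN
      set a := ((Finset.univ.filter fun h => φ h = 0 ∧ ¬ (f - c • chi φ) h ≠ 0).erase (0 : V)).card
      have h4 : (r + 3) * J + J ≤ 2 * a := by omega
      have h5 : a * (r + 3) ≤ nzc f := h2.trans h1
      nlinarith
    obtain ⟨χ, hχX, hinvX⟩ := (hA X hX).2 hXs
    have he : s - f X ≠ 0 := sub_ne_zero.mpr (Ne.symm hXs)
    have hΛX := residual_le hf hq hX hχX he hinvX hV hN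
    have hker : ∀ u, φ u = 0 → χ u = 0 := by
      intro u hu
      by_contra hχu
      have := residual_add_residual hφX hχX hc hinvX hV hu hχu
      omega
    have hker' : ∀ u, χ u = 0 → φ u = 0 := by
      intro u hu
      have h1 := hker (u - (φ u / φ X) • X) (by simp [hφX])
      rw [map_sub, hu, zero_sub, neg_eq_zero, map_smul, smul_eq_mul] at h1
      have h2 := (mul_eq_zero.mp h1).resolve_right hχX
      exact (div_eq_zero_iff.mp h2).resolve_right hφX
    have hchi : chi χ = chi φ := by
      funext v
      have : χ v = 0 ↔ φ v = 0 := ⟨hker' v, hker v⟩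
      simp only [chi, this]
    have hres : residual f (s - f X) χ =
        (Finset.univ.filter fun h => φ h = 0 ∧ (f - (s - f X) • chi φ) h ≠ 0).card := by
      rw [residual, hchi]
      congr 1
      ext v
      simp only [Finset.mem_filter, Finset.mem_univ, true_and]
      exact and_congr_left fun _ => ⟨hker' v, hker v⟩
    rw [hchi] at hinvX
    have heq : f X = f P := by
      by_contra hne
      have hcov : Finset.univ.filter (fun h => φ h = 0) ⊆ insert (0 : V)
          ((Finset.univ.filter fun h => φ h = 0 ∧ (f - c • chi φ) h ≠ 0) ∪
          (Finset.univ.filter fun h => φ h = 0 ∧ (f - (s - f X) • chi φ) h ≠ 0)) := by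
        intro h hh
        simp only [Finset.mem_filter, Finset.mem_univ, true_and, Finset.mem_union,
          Finset.mem_insert] at hh ⊢
        by_cases h0 : h = 0
        · exact Or.inl h0
        · right
          rw [sub_chi_apply_of_eq f c hh h0, sub_chi_apply_of_eq f _ hh h0]
          by_contra! h'
          have h1 := h'.1 hh
          have h2 := h'.2 hh
          apply hne
          rw [hcdef] at h1
          linear_combination h2 - h1
      have h1 := (Finset.card_le_card hcov).trans (Finset.card_insert_le _ _)
      have h2 := Finset.card_union_le (Finset.univ.filter fun h => φ h = 0 ∧ (f - c • chi φ) h ≠ 0)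
          (Finset.univ.filter fun h => φ h = 0 ∧ (f - (s - f X) • chi φ) h ≠ 0)
      rw [hK] at h1
      omega
    refine ⟨heq, ?_⟩
    rwa [heq] at hinvX
  set g := f - c • chi φ with hg
  have hgc : g ∈ hypCode F V :=
    Submodule.sub_mem _ hf (Submodule.smul_mem _ _
      (chi_mem (by rintro rfl; exact hφP (LinearMap.zero_apply _))))
  have hgf : ∀ v, φ v ≠ 0 → g v = f v := fun v hv => sub_chi_apply_of_ne f c hv
  have hne0 : ∀ u, g u ≠ 0 → u ≠ 0 := by
    rintro u hu rfl
    exact hu (apply_zero_of_mem hgc)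
  have hin : ∀ u, u ≠ 0 → φ u = 0 → g (u + P) = g u := by
    intro u hu0 hu
    have := hinvP u (not_mem_span_of_dual hφP hu hu0) 1
    rwa [one_smul] at this
  have hgs : HasLineSum g (f P) := by
    have := hasLineSum_sub hs c φ
    rwa [hcdef, sub_sub_cancel, ← hcdef] at this
  obtain ⟨x, hx0, hx⟩ : ∃ x : V, x ≠ 0 ∧ g x = 0 := by
    have h2 : 1 < (Finset.univ.filter fun h => φ h = 0 ∧ ¬ g h ≠ 0).card := by omega
    obtain ⟨x, hx, hx0⟩ := Finset.exists_mem_ne h2 0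
    simp only [Finset.mem_filter, Finset.mem_univ, true_and, not_not] at hx
    exact ⟨x, hx0, hx.2⟩
  have hclosed : ∀ u v, g u ≠ 0 → g v ≠ 0 → v ∉ Submodule.span F {u} → g (u + v) ≠ 0 := by
    have hside : ∀ u v, g u ≠ 0 → φ u ≠ 0 → v ∉ Submodule.span F {u} → g (v + u) = g v := by
      intro u v hu hφu hv
      have := (hX u (by rwa [← hgf u hφu]) hφu).2 v hv 1
      rwa [one_smul] at this
    intro u v hu hv huv
    by_cases hφu : φ u = 0
    · by_cases hφv : φ v = 0
      · have h1 : g (u + P) ≠ 0 := by rwa [hin u (hne0 u hu) hφu]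
        have hφ1 : φ (u + P) ≠ 0 := by rwa [map_add, hφu, zero_add]
        have huv0 : u + v ≠ 0 := by
          intro h
          apply huv
          rw [eq_neg_of_add_eq_zero_right h]
          exact Submodule.neg_mem _ (Submodule.mem_span_singleton_self u)
        have h2 := hside (u + P) v h1 hφ1 (not_mem_span_of_dual hφ1 hφv (hne0 v hv))
        have h3 := hin (u + v) huv0 (by rw [map_add, hφu, hφv, zero_add])
        rw [← h3, show u + v + P = v + (u + P) by abel, h2]
        exact hv
      · rw [hside v u hv hφv (not_mem_span_symm (hne0 u hu) huv)]
        exact hu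
    · rw [add_comm, hside u v hu hφu huv]
      exact hv
  have hval : ∀ v, g v ≠ 0 → g v = f P := by
    intro v hv
    by_cases hφv : φ v = 0
    · have h1 := hin v (hne0 v hv) hφv
      have hφ1 : φ (v + P) ≠ 0 := by rwa [map_add, hφv, zero_add]
      rw [← h1, hgf _ hφ1]
      refine (hX _ ?_ hφ1).1
      rw [← hgf _ hφ1, h1]
      exact hv
    · rw [hgf v hφv]
      exact (hX v (by rwa [← hgf v hφv]) hφv).1
  obtain ⟨ψ, hψ, e⟩ := eq_smul_chi_of_closed hgc hclosed hP hval hgs hx0 hx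
  have h1 := isConical_of_two hd (φ := φ) (ψ := ψ)
    (by rintro rfl; exact hφP (LinearMap.zero_apply _)) hψ c (f P)
  rw [← e, hg] at h1
  rwa [add_sub_cancel] at h1

end Structure

section ThreeHyperplanes

variable {V : Type} [AddCommGroup V] [Module F V] [Fintype F]

omit [Fintype F] in
theorem exists_cone_of_triple [FiniteDimensional F V] (hd : 3 ≤ Module.finrank F V)
    (φ ψ χ : Module.Dual F V) : ∃ κ : Submodule F V,
      Module.finrank F κ + 3 = Module.finrank F V ∧ κ ≤ LinearMap.ker φ ∧ κ ≤ LinearMap.ker ψ ∧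
        κ ≤ LinearMap.ker χ := by
  have h1 := finrank_le_finrank_inf_ker (⊤ : Submodule F V) φ
  have h2 := finrank_le_finrank_inf_ker (⊤ ⊓ LinearMap.ker φ : Submodule F V) ψ
  have h3 := finrank_le_finrank_inf_ker (⊤ ⊓ LinearMap.ker φ ⊓ LinearMap.ker ψ : Submodule F V) χ
  rw [finrank_top] at h1
  obtain ⟨κ, hκ, hr⟩ := exists_le_finrank_eq
    (W := (⊤ ⊓ LinearMap.ker φ ⊓ LinearMap.ker ψ ⊓ LinearMap.ker χ : Submodule F V))
    (m := Module.finrank F V - 3) (by omega)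
  refine ⟨κ, by omega, fun v hv => ?_, fun v hv => ?_, fun v hv => ?_⟩
  · exact (hκ hv).1.1.2
  · exact (hκ hv).1.2
  · exact (hκ hv).2

theorem apply_of_single_zero {f : V → F} {s : F} (hs : HasLineSum f s)
    {φ₁ φ₂ φ₃ : Module.Dual F V} (hS : ∀ v, φ₁ v ≠ 0 → φ₂ v ≠ 0 → φ₃ v ≠ 0 → f v = 0)
    {R v : V} (h1 : φ₁ R ≠ 0) (h2 : φ₂ R = 0) (h3 : φ₃ R = 0)
    (hv1 : φ₁ v = 0) (hv2 : φ₂ v ≠ 0) (hv3 : φ₃ v ≠ 0) : f v = s - f R := by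
  have hR : R ≠ 0 := by rintro rfl; exact h1 (map_zero _)
  have hv : v ∉ Submodule.span F {R} := by
    intro h
    obtain ⟨c, rfl⟩ := Submodule.mem_span_singleton.mp h
    exact hv2 (by rw [map_smul, h2, smul_zero])
  have := hs R v hR hv
  rw [Fintype.sum_eq_single (0 : F)] at this
  · rw [zero_smul, add_zero] at this
    linear_combination this
  · intro y hy
    exact hS _ (by simp [hv1, hy, h1]) (by simpa [h2] using hv2) (by simpa [h3] using hv3)

theorem apply_of_double_zero {f : V → F} {s : F} (hs : HasLineSum f s)
    {φ₁ φ₂ φ₃ : Module.Dual F V} (hS : ∀ v, φ₁ v ≠ 0 → φ₂ v ≠ 0 → φ₃ v ≠ 0 → f v = 0)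
    {R₁ R₂ v : V} (h11 : φ₁ R₁ ≠ 0) (h12 : φ₂ R₁ = 0) (h13 : φ₃ R₁ = 0)
    (h21 : φ₁ R₂ = 0) (h22 : φ₂ R₂ ≠ 0) (h23 : φ₃ R₂ = 0)
    (hv1 : φ₁ v = 0) (hv2 : φ₂ v = 0) (hv3 : φ₃ v ≠ 0) :
    f v = s - f R₁ - ∑ _y ∈ Finset.univ.erase (0 : F), (s - f R₂) := by
  have hR : R₁ ≠ 0 := by rintro rfl; exact h11 (map_zero _)
  have hv : v ∉ Submodule.span F {R₁} := by
    intro h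
    obtain ⟨c, rfl⟩ := Submodule.mem_span_singleton.mp h
    exact hv3 (by rw [map_smul, h13, smul_zero])
  have := hs R₁ v hR hv
  rw [← Finset.add_sum_erase _ _ (Finset.mem_univ (0 : F)), zero_smul, add_zero] at this
  have e : ∑ y ∈ Finset.univ.erase (0 : F), f (v + y • R₁) =
      ∑ _y ∈ Finset.univ.erase (0 : F), (s - f R₂) := by
    refine Finset.sum_congr rfl fun y hy => ?_
    have hy0 := (Finset.mem_erase.mp hy).1
    exact apply_of_single_zero (φ₁ := φ₂) (φ₂ := φ₁) (φ₃ := φ₃) hs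
      (fun v a b c => hS v b a c) h22 h21 h23 (by simp [hv2, h12]) (by simp [hv1, hy0, h11])
      (by simpa [h13] using hv3)
  rw [e] at this
  linear_combination this

theorem isConical_of_independent [FiniteDimensional F V] (hd : 3 ≤ Module.finrank F V)
    {f : V → F} (hf : f ∈ hypCode F V) {s : F} (hs : HasLineSum f s)
    {φ₁ φ₂ φ₃ : Module.Dual F V} (hS : ∀ v, φ₁ v ≠ 0 → φ₂ v ≠ 0 → φ₃ v ≠ 0 → f v = 0)
    {R₁ R₂ R₃ : V} (h11 : φ₁ R₁ ≠ 0) (h12 : φ₂ R₁ = 0) (h13 : φ₃ R₁ = 0)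
    (h21 : φ₁ R₂ = 0) (h22 : φ₂ R₂ ≠ 0) (h23 : φ₃ R₂ = 0)
    (h31 : φ₁ R₃ = 0) (h32 : φ₂ R₃ = 0) (h33 : φ₃ R₃ ≠ 0) : IsConical f := by
  obtain ⟨κ, hκ, hκ1, hκ2, hκ3⟩ := exists_cone_of_triple hd φ₁ φ₂ φ₃
  have hker : ∀ v, φ₁ v = 0 → φ₂ v = 0 → φ₃ v = 0 → v ∈ κ := by
    have hle : κ ≤ LinearMap.ker (φ₁.prod (φ₂.prod φ₃)) := by
      intro v hv
      change (φ₁ v, φ₂ v, φ₃ v) = 0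
      rw [LinearMap.mem_ker.mp (hκ1 hv), LinearMap.mem_ker.mp (hκ2 hv),
        LinearMap.mem_ker.mp (hκ3 hv)]
      rfl
    have hsurj : Function.Surjective (φ₁.prod (φ₂.prod φ₃)) := by
      rintro ⟨x, y, z⟩
      refine ⟨(x / φ₁ R₁) • R₁ + (y / φ₂ R₂) • R₂ + (z / φ₃ R₃) • R₃, ?_⟩
      simp [h11, h12, h13, h21, h22, h23, h31, h32, h33]
    have hr := LinearMap.finrank_range_add_finrank_ker (φ₁.prod (φ₂.prod φ₃))
    rw [LinearMap.range_eq_top.mpr hsurj, finrank_top, Module.finrank_prod, Module.finrank_prod,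
      Module.finrank_self] at hr
    have heq := Submodule.eq_of_le_of_finrank_eq hle (by omega)
    intro v h1 h2 h3
    rw [heq]
    change (φ₁ v, φ₂ v, φ₃ v) = 0
    rw [h1, h2, h3]
    rfl
  refine ⟨κ, hκ, mem_coneCode_of_invariant hκ hf fun v hv k hk => ?_⟩
  have hk1 : φ₁ (v + k) = φ₁ v := by rw [map_add, LinearMap.mem_ker.mp (hκ1 hk), add_zero]
  have hk2 : φ₂ (v + k) = φ₂ v := by rw [map_add, LinearMap.mem_ker.mp (hκ2 hk), add_zero]
  have hk3 : φ₃ (v + k) = φ₃ v := by rw [map_add, LinearMap.mem_ker.mp (hκ3 hk), add_zero]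
  have hS2 : ∀ v, φ₂ v ≠ 0 → φ₁ v ≠ 0 → φ₃ v ≠ 0 → f v = 0 := fun v a b c => hS v b a c
  have hS3 : ∀ v, φ₃ v ≠ 0 → φ₁ v ≠ 0 → φ₂ v ≠ 0 → f v = 0 := fun v a b c => hS v b c a
  have hS4 : ∀ v, φ₁ v ≠ 0 → φ₃ v ≠ 0 → φ₂ v ≠ 0 → f v = 0 := fun v a b c => hS v a c b
  have hS5 : ∀ v, φ₂ v ≠ 0 → φ₃ v ≠ 0 → φ₁ v ≠ 0 → f v = 0 := fun v a b c => hS v c a b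
  by_cases a : φ₁ v = 0 <;> by_cases b : φ₂ v = 0 <;> by_cases c : φ₃ v = 0
  · exact absurd (hker v a b c) hv
  · rw [apply_of_double_zero hs hS h11 h12 h13 h21 h22 h23 a b c,
      apply_of_double_zero hs hS h11 h12 h13 h21 h22 h23 (hk1.trans a) (hk2.trans b) (by rwa [hk3])]
  · rw [apply_of_double_zero hs hS4 h11 h13 h12 h31 h33 h32 a c b,
      apply_of_double_zero hs hS4 h11 h13 h12 h31 h33 h32 (hk1.trans a) (hk3.trans c) (by rwa [hk2])]
  · rw [apply_of_single_zero hs hS h11 h12 h13 a b c,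
      apply_of_single_zero hs hS h11 h12 h13 (hk1.trans a) (by rwa [hk2]) (by rwa [hk3])]
  · rw [apply_of_double_zero hs hS5 h22 h23 h21 h32 h33 h31 b c a,
      apply_of_double_zero hs hS5 h22 h23 h21 h32 h33 h31 (hk2.trans b) (hk3.trans c) (by rwa [hk1])]
  · rw [apply_of_single_zero hs hS2 h22 h21 h23 b a c,
      apply_of_single_zero hs hS2 h22 h21 h23 (hk2.trans b) (by rwa [hk1]) (by rwa [hk3])]
  · rw [apply_of_single_zero hs hS3 h33 h31 h32 c a b,
      apply_of_single_zero hs hS3 h33 h31 h32 (hk3.trans c) (by rwa [hk1]) (by rwa [hk2])]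
  · rw [hS v a b c, hS _ (by rwa [hk1]) (by rwa [hk2]) (by rwa [hk3])]

theorem isConical_of_concurrent [FiniteDimensional F V] (hd : 3 ≤ Module.finrank F V)
    (hq : 3 ≤ Fintype.card F)
    {f : V → F} (hf : f ∈ hypCode F V) {s : F} (hs : HasLineSum f s)
    {φ₁ φ₂ : Module.Dual F V} (hS : ∀ v, φ₁ v ≠ 0 → φ₂ v ≠ 0 → φ₁ v ≠ φ₂ v → f v = 0)
    {e₁ e₂ : V} (h11 : φ₁ e₁ = 1) (h12 : φ₂ e₁ = 0) (h21 : φ₁ e₂ = 0) (h22 : φ₂ e₂ = 1) :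
    IsConical f := by
  have he₁ : e₁ ≠ 0 := by rintro rfl; rw [map_zero] at h11; exact zero_ne_one h11
  have he₂ : e₂ ≠ 0 := by rintro rfl; rw [map_zero] at h22; exact zero_ne_one h22
  have hm2 : ∀ v, φ₁ v ≠ 0 → v ∉ Submodule.span F {e₂} := by
    intro v hv h
    obtain ⟨c, rfl⟩ := Submodule.mem_span_singleton.mp h
    exact hv (by rw [map_smul, h21, smul_zero])
  have hm1 : ∀ v, φ₂ v ≠ 0 → v ∉ Submodule.span F {e₁} := by
    intro v hv h
    obtain ⟨c, rfl⟩ := Submodule.mem_span_singleton.mp h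
    exact hv (by rw [map_smul, h12, smul_zero])
  obtain ⟨ψ, -, hψ⟩ := exists_moment_dual hf hs hq he₂ (hm2 e₁ (by rw [h11]; exact one_ne_zero))
  obtain ⟨κ, hκ, hκ1, hκ2, hκ3⟩ := exists_cone_of_triple hd φ₁ φ₂ ψ
  have hk1 : ∀ v, ∀ k ∈ κ, φ₁ (v + k) = φ₁ v := fun v k hk => by
    rw [map_add, LinearMap.mem_ker.mp (hκ1 hk), add_zero]
  have hk2 : ∀ v, ∀ k ∈ κ, φ₂ (v + k) = φ₂ v := fun v k hk => by
    rw [map_add, LinearMap.mem_ker.mp (hκ2 hk), add_zero]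
  have hk3 : ∀ v, ∀ k ∈ κ, ψ (v + k) = ψ v := fun v k hk => by
    rw [map_add, LinearMap.mem_ker.mp (hκ3 hk), add_zero]
  have hdiag : ∀ v, φ₁ v ≠ 0 → φ₂ v = φ₁ v →
      f (v - φ₁ v • e₂) = -(ψ v) / φ₁ v ∧ f v = s - f e₂ + ψ v / φ₁ v := by
    intro v h1 h2
    have hz : ∀ y : F, y ≠ 0 ∧ y ≠ -φ₁ v → f (v + y • e₂) = 0 := by
      rintro y ⟨hy, hy'⟩
      refine hS _ (by simpa [h21] using h1) ?_ ?_
      · simp only [map_add, map_smul, h22, h2, smul_eq_mul, mul_one]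
        exact fun h => hy' (by linear_combination h)
      · simpa [h21, h22, h2] using hy
    have hne : (0 : F) ≠ -φ₁ v := fun h => h1 (neg_eq_zero.mp h.symm)
    have a1 := hψ v (hm2 v h1)
    have a2 := hs e₂ v he₂ (hm2 v h1)
    rw [Fintype.sum_eq_add 0 (-φ₁ v) hne (fun y hy => by rw [hz y hy, mul_zero])] at a1
    rw [Fintype.sum_eq_add 0 (-φ₁ v) hne hz] at a2
    simp only [zero_mul, zero_add, zero_smul, add_zero, neg_smul, ← sub_eq_add_neg] at a1 a2
    have a3 : f (v - φ₁ v • e₂) = -(ψ v) / φ₁ v := by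
      rw [eq_div_iff h1]
      linear_combination -a1
    refine ⟨a3, ?_⟩
    rw [a3] at a2
    rw [neg_div] at a2
    linear_combination a2
  have hA : ∀ v, φ₁ v ≠ 0 → φ₂ v = φ₁ v → ∀ k ∈ κ, f (v + k) = f v := by
    intro v h1 h2 k hk
    rw [(hdiag v h1 h2).2, (hdiag (v + k) (by rwa [hk1 v k hk])
      (by rw [hk1 v k hk, hk2 v k hk, h2])).2, hk1 v k hk, hk3 v k hk]
  have hB : ∀ v, φ₁ v ≠ 0 → φ₂ v = 0 → ∀ k ∈ κ, f (v + k) = f v := by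
    have key : ∀ v, φ₁ v ≠ 0 → φ₂ v = 0 → f v = -ψ (v + φ₁ v • e₂) / φ₁ v := by
      intro v h1 h2
      have e : φ₁ (v + φ₁ v • e₂) = φ₁ v := by rw [map_add, map_smul, h21, smul_zero, add_zero]
      have := (hdiag (v + φ₁ v • e₂) (by rwa [e]) (by
        rw [e, map_add, map_smul, h2, h22, zero_add, smul_eq_mul, mul_one])).1
      rwa [e, add_sub_cancel_right] at this
    intro v h1 h2 k hk
    rw [key v h1 h2, key (v + k) (by rwa [hk1 v k hk]) (by rw [hk2 v k hk, h2]), hk1 v k hk,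
      add_right_comm, hk3 _ k hk]
  have hC : ∀ v, φ₁ v = 0 → φ₂ v ≠ 0 → ∀ k ∈ κ, f (v + k) = f v := by
    have key : ∀ v, φ₁ v = 0 → φ₂ v ≠ 0 → f v = s - f e₁ - f (v + φ₂ v • e₁) := by
      intro v h1 h2
      have a2 := hs e₁ v he₁ (hm1 v h2)
      rw [Fintype.sum_eq_add 0 (φ₂ v) (Ne.symm h2)] at a2
      · rw [zero_smul, add_zero] at a2
        linear_combination a2
      · rintro y ⟨hy, hy'⟩
        refine hS _ (by simpa [h11, h1] using hy) (by simpa [h12] using h2) ?_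
        simpa [h11, h12, h1] using hy'
    intro v h1 h2 k hk
    rw [key v h1 h2, key (v + k) (by rw [hk1 v k hk, h1]) (by rwa [hk2 v k hk]), hk2 v k hk,
      add_right_comm, hA _ _ _ k hk]
    · simpa [h1, h11] using h2
    · simp [h1, h11, h12]
  refine ⟨κ, hκ, mem_coneCode_of_invariant hκ hf fun v hv k hk => ?_⟩
  by_cases a : φ₁ v = 0 <;> by_cases b : φ₂ v = 0
  · have hvk : v + k ∉ κ := fun h => hv ((Submodule.add_mem_iff_left κ hk).mp h)
    have key : ∀ u, u ∉ κ → φ₁ u = 0 → f u = s - f e₁ -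
        ∑ y ∈ Finset.univ.erase (0 : F), f (u + y • e₁) := by
      intro u hu h1
      have hm : u ∉ Submodule.span F {e₁} := by
        intro h
        obtain ⟨c, rfl⟩ := Submodule.mem_span_singleton.mp h
        rw [map_smul, h11, smul_eq_mul, mul_one] at h1
        rw [h1, zero_smul] at hu
        exact hu (Submodule.zero_mem κ)
      have a2 := hs e₁ u he₁ hm
      rw [← Finset.add_sum_erase _ _ (Finset.mem_univ (0 : F)), zero_smul, add_zero] at a2
      linear_combination a2
    rw [key v hv a, key (v + k) hvk ((hk1 v k hk).trans a)]
    congr 1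
    refine Finset.sum_congr rfl fun y hy => ?_
    rw [add_right_comm]
    exact hB _ (by simpa [a, h11] using (Finset.mem_erase.mp hy).1) (by simp [b, h12]) k hk
  · exact hC v a b k hk
  · exact hB v a b k hk
  · by_cases c : φ₁ v = φ₂ v
    · exact hA v a c.symm k hk
    · rw [hS v a b c, hS]
      · rwa [hk1 v k hk]
      · rwa [hk2 v k hk]
      · rwa [hk1 v k hk, hk2 v k hk]

theorem isConical_of_three [FiniteDimensional F V] (hd : 3 ≤ Module.finrank F V)
    (hq : 3 ≤ Fintype.card F)
    {f : V → F} (hf : f ∈ hypCode F V) {s : F} (hs : HasLineSum f s)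
    {φ₁ φ₂ φ₃ : Module.Dual F V} (hS : ∀ v, φ₁ v ≠ 0 → φ₂ v ≠ 0 → φ₃ v ≠ 0 → f v = 0)
    {P Q : V} {y : F} (h11 : φ₁ P ≠ 0) (h12 : φ₁ Q = 0) (h21 : φ₂ P = 0) (h22 : φ₂ Q ≠ 0)
    (hy : y ≠ 0) (h31 : φ₃ P ≠ 0) (h32 : φ₃ (Q + y • P) = 0) : IsConical f := by
  have h32' : φ₃ Q = -(y * φ₃ P) := by
    rw [map_add, map_smul, smul_eq_mul] at h32
    linear_combination h32
  set α := (φ₁ P)⁻¹ • φ₁ with hα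
  set β := (y * (φ₂ Q)⁻¹) • φ₂ with hβ
  set γ := (φ₃ P)⁻¹ • φ₃ with hγ
  have a1 : α P = 1 := by simp [hα, h11]
  have a2 : α (y⁻¹ • Q) = 0 := by simp [hα, h12]
  have b1 : β P = 0 := by simp [hβ, h21]
  have b2 : β (y⁻¹ • Q) = 1 := by
    simp only [hβ, LinearMap.smul_apply, map_smul, smul_eq_mul]
    field_simp
  have c1 : γ P = 1 := by simp [hγ, h31]
  have c2 : γ (y⁻¹ • Q) = -1 := by
    simp only [hγ, LinearMap.smul_apply, map_smul, smul_eq_mul, h32']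
    field_simp
  have hS' : ∀ v, α v ≠ 0 → β v ≠ 0 → γ v ≠ 0 → f v = 0 := by
    intro v a b c
    refine hS v ?_ ?_ ?_
    · rintro h
      exact a (by simp [hα, h])
    · rintro h
      exact b (by simp [hβ, h])
    · rintro h
      exact c (by simp [hγ, h])
  by_cases hdep : ∀ v, γ v = α v - β v
  · exact isConical_of_concurrent hd hq hf hs
      (fun v h1 h2 h3 => hS' v h1 h2 (by rw [hdep]; exact sub_ne_zero.mpr h3)) a1 b1 a2 b2
  · push Not at hdep
    obtain ⟨k, hk⟩ := hdep
    set R := k - α k • P - β k • (y⁻¹ • Q) with hR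
    have r1 : α R = 0 := by rw [hR, map_sub, map_sub, map_smul, map_smul, a1, a2]; simp
    have r2 : β R = 0 := by rw [hR, map_sub, map_sub, map_smul, map_smul, b1, b2]; simp
    have r3 : γ R ≠ 0 := by
      rw [hR, map_sub, map_sub, map_smul _ (α k), map_smul _ (β k), c1, c2, smul_eq_mul, smul_eq_mul]
      intro h
      exact hk (by linear_combination h)
    refine isConical_of_independent hd hf hs hS' (R₁ := P - (γ R)⁻¹ • R)
      (R₂ := y⁻¹ • Q + (γ R)⁻¹ • R) (R₃ := R) ?_ ?_ ?_ ?_ ?_ ?_ r1 r2 r3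
    · rw [map_sub, map_smul, r1, a1]; simp
    · rw [map_sub, map_smul, r2, b1]; simp
    · rw [map_sub, map_smul, c1]; simp [r3]
    · rw [map_add, map_smul _ (γ R)⁻¹, r1, a2]; simp
    · rw [map_add, map_smul _ (γ R)⁻¹, r2, b2]; simp
    · rw [map_add, map_smul _ (γ R)⁻¹, c2]; simp [r3]

end ThreeHyperplanes

section TwoPoint

variable {V : Type} [AddCommGroup V] [Module F V] [Fintype F]

theorem eq_zero_of_eval_eq_zero {P : Polynomial F} {d : ℕ} (hP : P.natDegree ≤ d)
    (hd : d < Fintype.card F) (h : ∀ t, P.eval t = 0) : P = 0 :=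
  Polynomial.eq_zero_of_natDegree_lt_card_of_eval_eq_zero P (f := fun t : F => t)
    Function.injective_id h (hP.trans_lt hd)

theorem exists_two_point {h : F → F} (hh : nnz h ≤ 2) : ∃ y₁ y₂ a₁ a₂ : F, y₁ ≠ y₂ ∧
    ∀ y, h y = (if y = y₁ then a₁ else 0) + (if y = y₂ then a₂ else 0) := by
  have h2 : 2 ≤ (Finset.univ : Finset F).card := by
    rw [Finset.card_univ]; exact Fintype.one_lt_card
  obtain ⟨s, hs, -, hc⟩ := Finset.exists_subsuperset_card_eq
    (Finset.filter_subset (fun y => h y ≠ 0) Finset.univ) hh h2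
  obtain ⟨y₁, y₂, hne, rfl⟩ := Finset.card_eq_two.mp hc
  refine ⟨y₁, y₂, h y₁, h y₂, hne, fun y => ?_⟩
  by_cases h1 : y = y₁
  · subst h1; simp [hne]
  by_cases h2 : y = y₂
  · subst h2; simp [h1]
  rw [if_neg h1, if_neg h2, add_zero]
  by_contra h0
  have := hs (Finset.mem_filter.mpr ⟨Finset.mem_univ y, h0⟩)
  simp [h1, h2] at this

theorem exists_two_point_forms {f : V → F} (hf : f ∈ hypCode F V) (a : V)
    (hq : 5 ≤ Fintype.card F) : ∃ Γ D : V → F, IsForm 4 Γ ∧ IsForm 2 D ∧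
      ∀ b, b ∉ Submodule.span F {a} → ∀ y₁ y₂ a₁ a₂ : F,
        (∀ y, f (b + y • a) = (if y = y₁ then a₁ else 0) + (if y = y₂ then a₂ else 0)) →
        Γ b = a₁ * a₂ * y₁ * y₂ * (y₁ - y₂) ^ 2 ∧ D b = a₁ * a₂ * (y₁ - y₂) ^ 2 := by
  obtain ⟨m0, h0, e0⟩ := exists_moment_form hf a (k := 0) (by omega)
  obtain ⟨m1, h1, e1⟩ := exists_moment_form hf a (k := 1) (by omega)
  obtain ⟨m2, h2, e2⟩ := exists_moment_form hf a (k := 2) (by omega)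
  obtain ⟨m3, h3, e3⟩ := exists_moment_form hf a (k := 3) (by omega)
  refine ⟨m1 * m3 - m2 ^ 2, m0 * m2 - m1 ^ 2, (h1.mul h3).sub (h2.pow 2),
    (by simpa using h0.mul h2 : IsForm 2 (m0 * m2)).sub (by simpa using h1.pow 2),
    fun b hb y₁ y₂ a₁ a₂ h => ?_⟩
  have key : ∀ k : ℕ, ∑ y : F, y ^ k * f (b + y • a) = y₁ ^ k * a₁ + y₂ ^ k * a₂ := by
    intro k
    simp only [h, mul_add, mul_ite, mul_zero, Finset.sum_add_distrib, Finset.sum_ite_eq',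
      Finset.mem_univ, if_true]
  simp only [Pi.sub_apply, Pi.mul_apply, Pi.pow_apply, ← e0 b hb, ← e1 b hb, ← e2 b hb, ← e3 b hb,
    key]
  constructor <;> ring

theorem two_point_of_eq_two {h : F → F} (hh : nnz h = 2) (h0 : h 0 ≠ 0) :
    ∃ y a₁ a₂ : F, y ≠ 0 ∧ a₁ ≠ 0 ∧ a₂ ≠ 0 ∧
      ∀ x, h x = (if x = 0 then a₁ else 0) + (if x = y then a₂ else 0) := by
  have h1 := nnz_eq h 0
  rw [if_pos h0, hh] at h1
  obtain ⟨y, hy⟩ := Finset.card_eq_one.mp (by omega :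
    ((Finset.univ.erase (0 : F)).filter fun z => h z ≠ 0).card = 1)
  have hm : ∀ z, z ≠ 0 ∧ h z ≠ 0 ↔ z = y := fun z => by
    have := Finset.ext_iff.mp hy z
    simpa using this
  obtain ⟨hy0, hyh⟩ := (hm y).mpr rfl
  refine ⟨y, h 0, h y, hy0, h0, hyh, fun x => ?_⟩
  by_cases hx : x = 0
  · subst hx; simp [hy0.symm]
  by_cases hxy : x = y
  · subst hxy; simp [hx]
  rw [if_neg hx, if_neg hxy, add_zero]
  by_contra h2
  exact hxy ((hm x).mp ⟨hx, h2⟩)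

theorem sum_lw_comm (f : V → F) (v x z : V) :
    ∑ b : F, lw f z (v + b • x) = ∑ a : F, lw f x (v + a • z) := by
  simp only [lw, nnz, Finset.card_filter]
  rw [Finset.sum_comm]
  simp only [add_right_comm]

theorem sum_lw_transversal_le {f : V → F} (hf : f ∈ hypCode F V) (x z v : V) (c : F) :
    ∑ t ∈ Finset.univ.erase (0 : F), lw f (z + c • x) (x + t • v) ≤
      ∑ b : F, lw f z (v + b • x) := by
  simp only [lw, nnz, ← Finset.card_sigma]
  refine Finset.card_le_card_of_injOn
    (fun p => ⟨(1 + p.2 * c) * p.1⁻¹, p.2 * p.1⁻¹⟩) ?_ ?_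
  · rintro ⟨t, y⟩ hp
    simp only [Finset.coe_sigma, Set.mem_sigma_iff, Finset.mem_coe, Finset.mem_erase,
      Finset.mem_univ, and_true, Finset.mem_filter, true_and] at hp ⊢
    obtain ⟨ht, hp⟩ := hp
    rw [← apply_smul_of_mem hf ht]
    convert hp using 2
    simp only [smul_add, smul_smul]
    rw [mul_left_comm, mul_inv_cancel₀ ht, mul_left_comm, mul_inv_cancel₀ ht]
    module
  · rintro ⟨t, y⟩ hp ⟨t', y'⟩ hp' h
    simp only [Finset.coe_sigma, Set.mem_sigma_iff, Finset.mem_coe, Finset.mem_erase,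
      Finset.mem_univ, and_true, Finset.mem_filter, true_and] at hp hp'
    simp only [Sigma.mk.injEq, heq_eq_eq] at h
    have h1 : t⁻¹ = t'⁻¹ := by linear_combination h.1 - c * h.2
    have h2 : t = t' := inv_injective h1
    subst h2
    have h3 := mul_right_cancel₀ (inv_ne_zero hp.1) h.2
    subst h3
    rfl

end TwoPoint

section ThreeSecant

variable {V : Type} [AddCommGroup V] [Module F V] [Fintype F]

theorem IsForm.line_eq_zero_of_card {d : ℕ} {g : V → F} (hg : IsForm d g) {u v : V}
    (h : d < (Finset.univ.filter fun t : F => g (u + t • v) = 0).card) (t : F) :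
    g (u + t • v) = 0 := by
  obtain ⟨L, hL⟩ := hg.2 u
  obtain ⟨P, h1, h2, -⟩ := hL v
  by_contra h0
  have hP : P ≠ 0 := by rintro rfl; exact h0 (by rw [← h2, Polynomial.eval_zero])
  have := card_roots_le h1 hP
  simp only [h2] at this
  omega

/-- A line through two points of the support with exactly three points in the support yields a
linear form vanishing at one of the points and not at the other, on whose kernel the quartic form
`Γ` vanishes at all points where the total intersection is small. -/
theorem exists_tangent_dual {f : V → F} (hf : f ∈ hypCode F V) (hq : 29 ≤ Fintype.card F)
    (hd : ∀ a, f a ≠ 0 → ∀ b, b ∉ Submodule.span F {a} →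
      lw f a b < 3 ∨ Fintype.card F ≤ lw f a b + 3)
    {x z : V} (hx : f x ≠ 0) (hz : f z ≠ 0) (hzx : z ∉ Submodule.span F {x})
    (hl : lw f x z = 2) :
    ∃ (L : Module.Dual F V) (Γ D : V → F), L z = 0 ∧ L x ≠ 0 ∧ IsForm 4 Γ ∧ IsForm 2 D ∧
      D z ≠ 0 ∧ Γ z = 0 ∧
      (∀ v, L v = 0 → ∑ a : F, lw f x (v + a • z) + 16 ≤ 4 * Fintype.card F → Γ v = 0) ∧
      (∀ v, v ∉ Submodule.span F {x} → lw f x v ≤ 2 → Γ v = 0 → f v = 0 → D v = 0) := by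
  obtain ⟨Γ, D, hΓ, hD, hΓD⟩ := exists_two_point_forms hf x (by omega)
  have hx0 : x ≠ 0 := by rintro rfl; exact hx (apply_zero_of_mem hf)
  have hz0 : z ≠ 0 := by rintro rfl; exact hz (apply_zero_of_mem hf)
  obtain ⟨y, a₁, a₂, hy, ha₁, ha₂, hh⟩ := two_point_of_eq_two hl (by simpa using hz)
  have hzt : ∀ t : F, Γ (z + t • x) = a₁ * a₂ * y ^ 2 * (t ^ 2 - y * t) := by
    intro t
    rw [(hΓD _ (add_smul_not_mem hzx t) (0 - t) (y - t) a₁ a₂ fun s => ?_).1]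
    · ring
    · have := hh (s + t)
      simp only [eq_sub_iff_add_eq]
      rw [← this]
      congr 1
      module
  have hDz : D z ≠ 0 := by
    rw [(hΓD z hzx 0 y a₁ a₂ hh).2]
    exact mul_ne_zero (mul_ne_zero ha₁ ha₂) (pow_ne_zero _ (by simpa using hy))
  have hΓz : Γ z = 0 := by simpa using hzt 0
  obtain ⟨L, hL⟩ := hΓ.2 z
  have hLz : L z = 0 := by
    obtain ⟨P, h1, h2, h3, h4⟩ := hL z
    rw [← h4, eq_zero_of_eval_eq_zero h1 (by omega) fun t => ?_, Polynomial.coeff_zero]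
    rw [h2, show z + t • z = (1 + t) • z by module, hΓ.1, hΓz, mul_zero]
  have hLx : L x ≠ 0 := by
    obtain ⟨P, h1, h2, h3, h4⟩ := hL x
    have hP : P - Polynomial.C (a₁ * a₂ * y ^ 2) *
        (Polynomial.X ^ 2 - Polynomial.C y * Polynomial.X) = 0 := by
      refine eq_zero_of_eval_eq_zero (d := 4) ?_ (by omega) fun t => ?_
      · refine (Polynomial.natDegree_sub_le _ _).trans (max_le h1 ?_)
        compute_degree!
      · simp [h2, hzt]
    rw [← h4, sub_eq_zero.mp hP]
    rw [Polynomial.coeff_C_mul, Polynomial.coeff_sub, Polynomial.coeff_C_mul,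
      Polynomial.coeff_X_pow, Polynomial.coeff_X_one]
    simp [hy, ha₁, ha₂]
  refine ⟨L, Γ, D, hLz, hLx, hΓ, hD, hDz, hΓz, ?_, ?_⟩
  swap
  · intro v hv hvl hΓv hfv
    obtain ⟨y₁, y₂, b₁, b₂, hne, hb⟩ := exists_two_point hvl
    obtain ⟨e1, e2⟩ := hΓD v hv y₁ y₂ b₁ b₂ hb
    have h0 := hb 0
    rw [zero_smul, add_zero, hfv] at h0
    by_cases h1 : y₁ = 0
    · subst h1
      rw [if_pos rfl, if_neg hne, add_zero] at h0
      rw [e2, ← h0]; ring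
    by_cases h2 : y₂ = 0
    · subst h2
      rw [if_neg (Ne.symm h1), if_pos rfl, zero_add] at h0
      rw [e2, ← h0]; ring
    rw [e1] at hΓv
    have h3 : b₁ * b₂ = 0 := by
      have h4 : y₁ * y₂ * (y₁ - y₂) ^ 2 ≠ 0 :=
        mul_ne_zero (mul_ne_zero h1 h2) (pow_ne_zero _ (sub_ne_zero.mpr hne))
      exact (mul_eq_zero.mp (by linear_combination hΓv :
        b₁ * b₂ * (y₁ * y₂ * (y₁ - y₂) ^ 2) = 0)).resolve_right h4
    rw [e2, h3, zero_mul]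
  have hΓf : ∀ v, v ∉ Submodule.span F {x} → lw f x v ≤ 2 → f v ≠ 0 → Γ v = 0 := by
    intro v hv hvl hfv
    obtain ⟨y₁, y₂, b₁, b₂, hne, hb⟩ := exists_two_point hvl
    obtain ⟨e1, e2⟩ := hΓD v hv y₁ y₂ b₁ b₂ hb
    have h0 := hb 0
    rw [zero_smul, add_zero] at h0
    rw [e1]
    by_cases h1 : y₁ = 0
    · rw [h1]; ring
    by_cases h2 : y₂ = 0
    · rw [h2]; ring
    rw [if_neg (Ne.symm h1), if_neg (Ne.symm h2), add_zero] at h0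
    exact absurd h0 hfv
  intro v hLv hn
  by_cases hvz : v ∈ Submodule.span F {z}
  · obtain ⟨c, rfl⟩ := Submodule.mem_span_singleton.mp hvz
    rw [hΓ.1, hΓz, mul_zero]
  have hv : v ∉ Submodule.span F {x, z} := by
    intro h
    obtain ⟨c, d, rfl⟩ := Submodule.mem_span_pair.mp h
    rw [map_add, map_smul, map_smul, hLz, smul_zero, add_zero, smul_eq_mul] at hLv
    have hc := (mul_eq_zero.mp hLv).resolve_right hLx
    rw [hc, zero_smul, zero_add] at hvz
    exact hvz (Submodule.smul_mem _ _ (Submodule.mem_span_singleton_self z))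
  have hxz : x ∉ Submodule.span F {z} := not_mem_span_symm hx0 hzx
  have hsum := sum_lw_comm f v x z
  -- a point on the line outside the support
  obtain ⟨c, hc⟩ : ∃ c : F, c ∉ ({0, y} : Finset F) := by
    by_contra! h
    have := Finset.card_le_card (fun c _ => h c : (Finset.univ : Finset F) ⊆ {0, y})
    rw [Finset.card_univ] at this
    have := Finset.card_le_two (a := (0 : F)) (b := y)
    omega
  simp only [Finset.mem_insert, Finset.mem_singleton, not_or] at hc
  have hfc : f (z + c • x) = 0 := by rw [hh, if_neg hc.1, if_neg hc.2, add_zero]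
  have hlc : lw f (z + c • x) x = 3 := by
    have := lw_symm hf x (z + c • x)
    rw [if_pos hx, hfc, lw_add_smul, hl] at this
    simpa using this.symm
  have h1 := le_sum_lw hf (z + c • x) x v (add_smul_not_mem_of_pair
    (not_mem_span_add hx0 hzx c) (fun h => hv (by
      obtain ⟨r, s, rfl⟩ := Submodule.mem_span_pair.mp h
      exact Submodule.mem_span_pair.mpr ⟨r * c + s, r, by module⟩)))
  rw [hlc] at h1
  have h2 := h1.trans (sum_lw_transversal_le hf x z v c)
  obtain ⟨b, hb⟩ : ∃ b : F, 2 < lw f z (v + b • x) := by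
    by_contra! h
    have := Finset.sum_le_sum fun b (_ : b ∈ Finset.univ) => h b
    rw [Finset.sum_const, Finset.card_univ, smul_eq_mul] at this
    omega
  have hb' := (hd z hz (v + b • x) (by
    have := add_add_ne_zero_of_pair hv b 0
    rw [zero_smul, add_zero] at this
    exact (not_mem_span_of_pair this).2)).resolve_left (by omega)
  -- few lines through `x` in this plane are long
  have h3 : (Finset.univ.filter fun a : F => 3 ≤ lw f x (v + a • z)).card ≤ 3 := by
    have h4 : (Finset.univ.filter fun a : F => 3 ≤ lw f x (v + a • z)).card *
        (Fintype.card F - 3) ≤ ∑ a : F, lw f x (v + a • z) := by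
      rw [← smul_eq_mul, ← Finset.sum_const]
      refine (Finset.sum_le_sum fun a ha => ?_).trans
        (Finset.sum_le_sum_of_subset (Finset.filter_subset _ _))
      have hvx : v + a • z ∉ Submodule.span F {x} := by
        have := add_add_ne_zero_of_pair hv 0 a
        rw [zero_smul, add_zero] at this
        exact (not_mem_span_of_pair this).1
      rcases hd x hx _ hvx with h | h
      · simp at ha; omega
      · omega
    by_contra! h
    have := Nat.mul_le_mul_right (Fintype.card F - 3) h
    omega
  have hvx : ∀ a : F, v + b • x + a • z ∉ Submodule.span F {x} := fun a =>
    (not_mem_span_of_pair (add_add_ne_zero_of_pair hv b a)).1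
  have h5 : (Finset.univ.filter fun a : F => f (v + b • x + a • z) ≠ 0).card ≤
      (Finset.univ.filter fun a : F => Γ (v + b • x + a • z) = 0).card +
      (Finset.univ.filter fun a : F => 3 ≤ lw f x (v + a • z)).card := by
    refine (Finset.card_le_card fun a ha => ?_).trans (Finset.card_union_le _ _)
    simp only [Finset.mem_union, Finset.mem_filter, Finset.mem_univ, true_and] at ha ⊢
    by_cases h : 3 ≤ lw f x (v + a • z)
    · exact Or.inr h
    · refine Or.inl (hΓf _ (hvx a) ?_ ha)
      rw [add_right_comm, lw_add_smul]
      omega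
  have h6 : ∀ a : F, Γ (v + b • x + a • z) = 0 := hΓ.line_eq_zero_of_card (by
    change lw f z (v + b • x) ≤ _ at h5
    omega)
  have h7 : ∀ t : F, Γ (z + t • (v + b • x)) = 0 := by
    intro t
    rcases eq_or_ne t 0 with rfl | ht
    · rwa [zero_smul, add_zero]
    · rw [show z + t • (v + b • x) = t • (v + b • x + t⁻¹ • z) by
        rw [smul_add t _ (t⁻¹ • z), smul_smul, mul_inv_cancel₀ ht, one_smul, add_comm], hΓ.1, h6,
        mul_zero]
  have h8 : L (v + b • x) = 0 := by
    obtain ⟨P, h1, h2, h3, h4⟩ := hL (v + b • x)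
    rw [← h4, eq_zero_of_eval_eq_zero h1 (by omega) fun t => ?_, Polynomial.coeff_zero]
    rw [h2, h7]
  rw [map_add, hLv, zero_add, map_smul, smul_eq_mul] at h8
  have h9 := (mul_eq_zero.mp h8).resolve_right hLx
  have := h6 0
  rwa [h9, zero_smul, zero_smul, add_zero, add_zero] at this

end ThreeSecant

section ThreeSecantStructure

variable {V : Type} [AddCommGroup V] [Module F V] [Fintype F] [Fintype V]

theorem sum_ker_sum_lw_le (f : V → F) {L : Module.Dual F V} {x z : V} (hx : L x ≠ 0)
    (hz : L z = 0) :
    ∑ v ∈ Finset.univ.filter (fun v => L v = 0), ∑ a : F, lw f x (v + a • z) ≤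
      Fintype.card F * nzc f := by
  rw [Finset.sum_comm, ← Finset.card_univ, ← smul_eq_mul, ← Finset.sum_const]
  refine Finset.sum_le_sum fun a _ => le_trans (le_of_eq ?_) (sum_ker_lw_le f hx)
  refine Finset.sum_bij (fun v _ => v + a • z) ?_ ?_ ?_ ?_
  · intro v hv
    simpa [hz] using hv
  · intro v _ w _ h
    exact add_right_cancel h
  · intro v hv
    exact ⟨v - a • z, by simpa [hz] using hv, by simp⟩
  · intro v _
    rfl

theorem exists_dual_card_zero_le {f : V → F} (hf : f ∈ hypCode F V) (hq : 29 ≤ Fintype.card F)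
    {I : ℕ} (hI : 0 < I)
    (hV : Fintype.card V = Fintype.card F * (Fintype.card F * (Fintype.card F * I)))
    (hN : nzc f + 36 * Fintype.card F * I ≤ (4 * Fintype.card F ^ 2 + 32) * I)
    (hd : ∀ a, f a ≠ 0 → ∀ b, b ∉ Submodule.span F {a} →
      lw f a b < 3 ∨ Fintype.card F ≤ lw f a b + 3)
    {x z : V} (hx : f x ≠ 0) (hz : f z ≠ 0) (hzx : z ∉ Submodule.span F {x})
    (hl : lw f x z = 2) :
    ∃ L : Module.Dual F V, L z = 0 ∧ L x ≠ 0 ∧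
      (Finset.univ.filter fun v => L v = 0 ∧ f v = 0).card ≤ 6 * (Fintype.card F * I) := by
  obtain ⟨L, Γ, D, hLz, hLx, hΓ, hD, hDz, hΓz, h1, h2⟩ :=
    exists_tangent_dual hf hq hd hx hz hzx hl
  have hT := card_ker hLx
  rw [hV] at hT
  set q := Fintype.card F with hqd
  have hT := Nat.eq_of_mul_eq_mul_left (by omega) hT
  have hker : (Finset.univ.filter fun v => v ∈ LinearMap.ker L).card = q * (q * I) := by
    rw [← hT]; rfl
  have hΓ0 : ∀ v, L v = 0 → Γ v = 0 := by
    by_contra! h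
    obtain ⟨u, hu, hΓu⟩ := h
    have h3 := form_zero_count hΓ (LinearMap.ker L) (LinearMap.mem_ker.mpr hu) hΓu
    rw [hker, ← hqd, mul_left_comm] at h3
    have h3 := Nat.le_of_mul_le_mul_left h3 (by omega)
    have h4 := Finset.card_filter_add_card_filter_not
      (s := Finset.univ.filter fun v => L v = 0) (fun v => Γ v = 0)
    rw [hT, Finset.filter_filter, Finset.filter_filter] at h4
    simp only [LinearMap.mem_ker] at h3
    have h5 : (Finset.univ.filter fun v => L v = 0 ∧ ¬ Γ v = 0).card * (4 * q - 15) ≤ q * nzc f := by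
      rw [← smul_eq_mul, ← Finset.sum_const]
      refine le_trans (le_trans (Finset.sum_le_sum fun v hv => ?_)
        (Finset.sum_le_sum_of_subset (s := Finset.univ.filter fun v => L v = 0 ∧ ¬ Γ v = 0)
          (t := Finset.univ.filter fun v => L v = 0)
          fun v hv => ?_)) (sum_ker_sum_lw_le f hLx hLz)
      · simp only [Finset.mem_filter, Finset.mem_univ, true_and] at hv
        by_contra h6
        exact hv.2 (h1 v hv.1 (by omega))
      · simp only [Finset.mem_filter, Finset.mem_univ, true_and] at hv ⊢
        exact hv.1
    set A := (Finset.univ.filter fun v => L v = 0 ∧ Γ v = 0).card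
    set B := (Finset.univ.filter fun v => L v = 0 ∧ ¬ Γ v = 0).card
    obtain ⟨r, hr⟩ : ∃ r, q = r + 15 := ⟨q - 15, by omega⟩
    have e : 4 * q - 15 = 4 * r + 45 := by omega
    rw [e] at h5
    have h6 : (r + 11) * (q * I) ≤ B := by
      have : (r + 15) * (q * I) = A + B := by rw [← hr]; exact h4.symm
      nlinarith
    have h7 : q * ((r + 11) * I * (4 * r + 45)) ≤ q * nzc f := by
      refine le_trans ?_ h5
      refine le_trans (le_of_eq ?_) (Nat.mul_le_mul_right _ h6)
      ring
    have h8 := Nat.le_of_mul_le_mul_left h7 (by omega)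
    rw [hr] at hN
    nlinarith [Nat.mul_le_mul_right I (show 1 ≤ r by omega)]
  refine ⟨L, hLz, hLx, ?_⟩
  have hDc := form_zero_count hD (LinearMap.ker L) (LinearMap.mem_ker.mpr hLz) hDz
  rw [hker, ← hqd, mul_left_comm] at hDc
  have hDc := Nat.le_of_mul_le_mul_left hDc (by omega)
  simp only [LinearMap.mem_ker] at hDc
  have hlong : (Finset.univ.filter fun v => L v = 0 ∧ q ≤ lw f x v + 3).card ≤ 4 * (q * I) := by
    have h3 : (Finset.univ.filter fun v => L v = 0 ∧ q ≤ lw f x v + 3).card * (q - 3) ≤ nzc f := by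
      rw [← smul_eq_mul, ← Finset.sum_const]
      refine le_trans (le_trans (Finset.sum_le_sum fun v hv => ?_)
        (Finset.sum_le_sum_of_subset
          (s := Finset.univ.filter fun v => L v = 0 ∧ q ≤ lw f x v + 3)
          (t := Finset.univ.filter fun v => L v = 0)
          fun v hv => ?_)) (sum_ker_lw_le f hLx)
      · simp only [Finset.mem_filter, Finset.mem_univ, true_and] at hv
        omega
      · simp only [Finset.mem_filter, Finset.mem_univ, true_and] at hv ⊢
        exact hv.1
    by_contra! h4
    have h5 := Nat.mul_le_mul_right (q - 3) h4.le
    obtain ⟨r, hr⟩ : ∃ r, q = r + 3 := ⟨q - 3, by omega⟩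
    rw [show q - 3 = r by omega] at h5 h3
    have h6 := h5.trans h3
    rw [hr] at h6 hN
    nlinarith [Nat.mul_le_mul_right I (show 26 ≤ r by omega)]
  refine le_trans (Finset.card_le_card (t := (Finset.univ.filter fun v => L v = 0 ∧ D v = 0) ∪
    (Finset.univ.filter fun v => L v = 0 ∧ q ≤ lw f x v + 3)) fun v hv => ?_)
    ((Finset.card_union_le _ _).trans (by omega))
  simp only [Finset.mem_union, Finset.mem_filter, Finset.mem_univ, true_and] at hv ⊢
  obtain ⟨hLv, hfv⟩ := hv
  by_cases h0 : v = 0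
  · subst h0
    refine Or.inl ⟨hLv, ?_⟩
    have := hD.1 0 0
    simpa using this
  have hvx := not_mem_span_of_dual hLx hLv h0
  rcases hd x hx v hvx with h | h
  · exact Or.inl ⟨hLv, h2 v hvx (by omega) (hΓ0 v hLv) hfv⟩
  · exact Or.inr ⟨hLv, h⟩

end ThreeSecantStructure

section ThreeSecantCone

variable {V : Type} [AddCommGroup V] [Module F V] [Fintype F] [Fintype V]

omit [Fintype F] in
theorem card_shear_le (f : V → F) {L M : Module.Dual F V} {x : V} (hL : L x ≠ 0) (hM : M x = 1) :
    (Finset.univ.filter fun z => L z = 0 ∧ f (z + -M z • x) = 0).card ≤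
      (Finset.univ.filter fun v => M v = 0 ∧ f v = 0).card := by
  refine Finset.card_le_card_of_injOn (fun z => z + -M z • x) ?_ ?_
  · intro z hz
    simp only [Finset.coe_filter, Finset.mem_univ, true_and, Set.mem_ofPred_eq] at hz ⊢
    exact ⟨by simp [hM], hz.2⟩
  · intro z hz z' hz' h
    simp only [Finset.coe_filter, Finset.mem_univ, true_and, Set.mem_ofPred_eq] at hz hz' h
    have h1 := congrArg L h
    simp only [map_add, map_smul, hz.1, hz'.1, zero_add, smul_eq_mul] at h1
    rw [mul_right_cancel₀ hL h1] at h
    exact add_right_cancel h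

theorem three_le_nnz {h : F → F} {a b c : F} (hab : a ≠ b) (hac : a ≠ c) (hbc : b ≠ c)
    (ha : h a ≠ 0) (hb : h b ≠ 0) (hc : h c ≠ 0) : 3 ≤ nnz h := by
  rw [← Finset.card_eq_three.mpr ⟨a, b, c, hab, hac, hbc, rfl⟩]
  refine Finset.card_le_card fun x hx => ?_
  simp at hx ⊢
  rcases hx with rfl | rfl | rfl <;> assumption

theorem quadratic_lt_cubic {r : ℕ} (h : 8 ≤ r) :
    4 * (r + 21) ^ 2 + 32 < r * (r + 21) * (r + 18) + 36 * (r + 21) := by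
  obtain ⟨k, rfl⟩ := Nat.exists_eq_add_of_le h
  have h2 := Nat.zero_le (k ^ 2)
  have h3 := Nat.zero_le (k ^ 3)
  ring_nf
  omega

/-- If three hyperplanes contain few points outside the support and the support is small,
then the hyperplanes cover the support. -/
theorem eq_zero_of_three_dual {f : V → F} (hq : 29 ≤ Fintype.card F)
    {I : ℕ} (hI : 0 < I)
    (hV : Fintype.card V = Fintype.card F * (Fintype.card F * (Fintype.card F * I)))
    (hN : nzc f + 36 * Fintype.card F * I ≤ (4 * Fintype.card F ^ 2 + 32) * I)
    (hd : ∀ a, f a ≠ 0 → ∀ b, b ∉ Submodule.span F {a} →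
      lw f a b < 3 ∨ Fintype.card F ≤ lw f a b + 3)
    {L₁ L₂ L₃ : Module.Dual F V} {u₂ u₃ u : V}
    (hu₂ : L₁ u₂ = 0) (hu₂' : L₂ u₂ ≠ 0) (hu₃ : L₁ u₃ = 0) (hu₃' : L₃ u₃ ≠ 0)
    (hu : L₂ u = 0) (hu' : L₃ u ≠ 0)
    (h1 : (Finset.univ.filter fun v => L₁ v = 0 ∧ f v = 0).card ≤ 6 * (Fintype.card F * I))
    (h2 : (Finset.univ.filter fun v => L₂ v = 0 ∧ f v = 0).card ≤ 6 * (Fintype.card F * I))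
    (h3 : (Finset.univ.filter fun v => L₃ v = 0 ∧ f v = 0).card ≤ 6 * (Fintype.card F * I))
    {x : V} (hx₁ : L₁ x ≠ 0) (hx₂ : L₂ x ≠ 0) (hx₃ : L₃ x ≠ 0) : f x = 0 := by
  by_contra hx
  have hT := card_ker hx₁
  rw [hV] at hT
  set q := Fintype.card F with hqd
  have hT := Nat.eq_of_mul_eq_mul_left (by omega) hT
  have hker : (Finset.univ.filter fun v => v ∈ LinearMap.ker L₁).card = q * (q * I) := by
    rw [← hT]; rfl
  set M₂ : Module.Dual F V := (L₂ x)⁻¹ • L₂ with hM₂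
  set M₃ : Module.Dual F V := (L₃ x)⁻¹ • L₃ with hM₃
  have e₂ : M₂ x = 1 := by simp [hM₂, hx₂]
  have e₃ : M₃ x = 1 := by simp [hM₃, hx₃]
  have z₂ : ∀ v, M₂ v = 0 ↔ L₂ v = 0 := fun v => by simp [hM₂, hx₂]
  have z₃ : ∀ v, M₃ v = 0 ↔ L₃ v = 0 := fun v => by simp [hM₃, hx₃]
  have b2 := card_shear_le f hx₁ e₂
  have b3 := card_shear_le f hx₁ e₃
  simp only [z₂] at b2
  simp only [z₃] at b3
  have hcoin : ∀ (M : Module.Dual F V) (w : V), L₁ w = 0 → M w ≠ 0 →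
      (Finset.univ.filter fun v => L₁ v = 0 ∧ M v = 0).card ≤ q * I := by
    intro M w hw hMw
    have := form_zero_count (IsForm.dual M) (LinearMap.ker L₁) (LinearMap.mem_ker.mpr hw) hMw
    rw [hker, ← hqd, one_mul] at this
    simpa only [LinearMap.mem_ker] using Nat.le_of_mul_le_mul_left this (by omega)
  have c2 := hcoin M₂ u₂ hu₂ (by rwa [Ne, z₂])
  have c3 := hcoin M₃ u₃ hu₃ (by rwa [Ne, z₃])
  have c23 := hcoin (M₂ - M₃) (u - (L₁ u / L₁ x) • x)
    (by rw [map_sub, map_smul, smul_eq_mul, div_mul_cancel₀ _ hx₁, sub_self])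
    (by
      have hM : (M₂ - M₃) x = 0 := by simp [e₂, e₃]
      rw [map_sub, map_smul, hM, smul_zero, sub_zero, LinearMap.sub_apply, (z₂ u).mpr hu, zero_sub,
        neg_ne_zero, Ne, z₃]
      exact hu')
  set X := Finset.univ.filter fun z => L₁ z = 0 ∧ q ≤ lw f x z + 3 with hX
  have hcover : (Finset.univ.filter fun z => L₁ z = 0) ⊆ X ∪
      ((Finset.univ.filter fun v => L₁ v = 0 ∧ f v = 0) ∪
      ((Finset.univ.filter fun z => L₁ z = 0 ∧ f (z + -M₂ z • x) = 0) ∪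
      ((Finset.univ.filter fun z => L₁ z = 0 ∧ f (z + -M₃ z • x) = 0) ∪
      ((Finset.univ.filter fun v => L₁ v = 0 ∧ M₂ v = 0) ∪
      ((Finset.univ.filter fun v => L₁ v = 0 ∧ M₃ v = 0) ∪
      (Finset.univ.filter fun v => L₁ v = 0 ∧ (M₂ - M₃) v = 0)))))) := by
    intro z hz
    simp only [hX, Finset.mem_union, Finset.mem_filter, Finset.mem_univ, true_and] at hz ⊢
    simp only [hz, true_and]
    by_contra! h
    obtain ⟨g0, g1, g2, g3, g4, g5, g6⟩ := h
    by_cases hz0 : z = 0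
    · subst hz0; exact g4 (map_zero _)
    have hzx := not_mem_span_of_dual hx₁ hz hz0
    rcases hd x hx z hzx with h | h
    · have h6 : M₂ z ≠ M₃ z := fun h => g6 (by rw [LinearMap.sub_apply, h, sub_self])
      have := three_le_nnz (h := fun t => f (z + t • x)) (a := 0) (b := -M₂ z) (c := -M₃ z)
        (neg_ne_zero.mpr g4).symm (neg_ne_zero.mpr g5).symm (fun h => h6 (neg_injective h))
        (by simpa using g1) g2 g3
      change 3 ≤ lw f x z at this
      omega
    · omega
  have k1 := Finset.card_le_card hcover
  have k2 : X.card * (q - 3) ≤ nzc f := by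
    rw [← smul_eq_mul, ← Finset.sum_const]
    refine le_trans (le_trans (Finset.sum_le_sum fun v hv => ?_)
      (Finset.sum_le_sum_of_subset (s := X) (t := Finset.univ.filter fun v => L₁ v = 0)
        fun v hv => ?_)) (sum_ker_lw_le f hx₁)
    · simp only [hX, Finset.mem_filter, Finset.mem_univ, true_and] at hv
      omega
    · simp only [hX, Finset.mem_filter, Finset.mem_univ, true_and] at hv ⊢
      exact hv.1
  rw [hT] at k1
  have k3 : q * (q * I) ≤ X.card + 21 * (q * I) := by
    refine k1.trans ?_
    refine (Finset.card_union_le _ _).trans (Nat.add_le_add_left ?_ _)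
    refine (Finset.card_union_le _ _).trans ?_
    refine (Nat.add_le_add_left (Finset.card_union_le _ _) _).trans ?_
    refine (Nat.add_le_add_left (Nat.add_le_add_left (Finset.card_union_le _ _) _) _).trans ?_
    refine (Nat.add_le_add_left (Nat.add_le_add_left (Nat.add_le_add_left
      (Finset.card_union_le _ _) _) _) _).trans ?_
    refine (Nat.add_le_add_left (Nat.add_le_add_left (Nat.add_le_add_left
      (Nat.add_le_add_left (Finset.card_union_le _ _) _) _) _) _).trans ?_
    omega
  obtain ⟨r, hr⟩ : ∃ r, q = r + 21 := ⟨q - 21, by omega⟩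
  have k4 : r * (q * I) ≤ X.card := by
    have : q * (q * I) = r * (q * I) + 21 * (q * I) := by
      rw [← Nat.add_mul, ← hr]
    omega
  have k5 := (Nat.mul_le_mul_right (q - 3) k4).trans k2
  rw [show q - 3 = r + 18 by omega] at k5
  rw [hr] at k5 hN
  have k6 : r * ((r + 21)) * (r + 18) + 36 * (r + 21) ≤ 4 * (r + 21) ^ 2 + 32 := by
    refine Nat.le_of_mul_le_mul_right (c := I) ?_ hI
    refine le_trans ?_ hN
    refine le_trans (le_of_eq ?_) (Nat.add_le_add_right k5 _)
    ring
  have k7 : 8 ≤ r := by omega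
  exact absurd k6 (not_le.mpr (quadratic_lt_cubic k7))

theorem isConical_of_three_secant (hdim : 3 ≤ Module.finrank F V) {f : V → F} {s : F}
    (hf : f ∈ hypCode F V) (hs : HasLineSum f s)
    (hq : 29 ≤ Fintype.card F) {I : ℕ} (hI : 0 < I)
    (hV : Fintype.card V = Fintype.card F * (Fintype.card F * (Fintype.card F * I)))
    (hN : nzc f + 36 * Fintype.card F * I ≤ (4 * Fintype.card F ^ 2 + 32) * I)
    (hd : ∀ a, f a ≠ 0 → ∀ b, b ∉ Submodule.span F {a} →
      lw f a b < 3 ∨ Fintype.card F ≤ lw f a b + 3)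
    {a b : V} (ha : f a ≠ 0) (hb : b ∉ Submodule.span F {a}) (hl : lw f a b = 2) :
    IsConical f := by
  have ha0 : a ≠ 0 := by rintro rfl; exact ha (apply_zero_of_mem hf)
  obtain ⟨t, ht⟩ : ∃ t : F, f (b + t • a) ≠ 0 := exists_of_lw_pos (by omega)
  have hQ : b + t • a ∉ Submodule.span F {a} := add_smul_not_mem hb t
  have hlQ : lw f a (b + t • a) = 2 := by rw [lw_add_smul, hl]
  generalize b + t • a = Q at ht hQ hlQ
  obtain ⟨y, a₁, a₂, hy, -, ha₂, hh⟩ := two_point_of_eq_two hlQ (by simpa using ht)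
  have hfy : f (Q + y • a) ≠ 0 := by rw [hh, if_neg hy, if_pos rfl, zero_add]; exact ha₂
  have hl' : lw f Q a = 2 := by
    have := lw_symm hf a Q
    rw [if_pos ha, if_pos ht, hlQ] at this
    omega
  obtain ⟨L₁, h11, h12, c1⟩ := exists_dual_card_zero_le hf hq hI hV hN hd ha ht hQ hlQ
  obtain ⟨L₂, h21, h22, c2⟩ := exists_dual_card_zero_le hf hq hI hV hN hd ht ha
    (not_mem_span_symm ha0 hQ) hl'
  obtain ⟨L₃, h31, h32, c3⟩ := exists_dual_card_zero_le hf hq hI hV hN hd ha hfy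
    (add_smul_not_mem hQ y) (by rw [lw_add_smul, hlQ])
  have h33 : L₃ Q ≠ 0 := by
    intro h
    rw [map_add, h, zero_add, map_smul, smul_eq_mul] at h31
    exact (mul_ne_zero hy h32) h31
  exact isConical_of_three hdim (by omega) hf hs
    (fun v e1 e2 e3 => eq_zero_of_three_dual hq hI hV hN hd h11 h22 h11 h33 h21 h32 c1 c2 c3 e1 e2 e3)
    h12 h11 h21 h22 hy h32 h31

end ThreeSecantCone

section WeightRanges

theorem mul_sub_le_mul_sub {m q w : ℕ} (h1 : m + 1 ≤ w) (h2 : w + m + 1 ≤ q) :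
    (m + 1) * (q - (m + 1)) ≤ w * (q - w) := by
  obtain ⟨i, rfl⟩ := Nat.exists_eq_add_of_le h1
  obtain ⟨j, rfl⟩ := Nat.exists_eq_add_of_le h2
  rw [show m + 1 + i + m + 1 + j - (m + 1) = m + 1 + i + j by omega,
    show m + 1 + i + m + 1 + j - (m + 1 + i) = m + 1 + j by omega]
  nlinarith [Nat.zero_le (i * j)]

theorem sq_sub_one_mul_le {q I C : ℕ} (hI : q ≤ I) (hC : C = q * (q * (q * I))) :
    (q - 1) * (q + 1) * (q * I) ≤ C - q ^ 2 := by
  subst hC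
  have h1 : q ^ 2 ≤ q * I := by rw [sq]; exact Nat.mul_le_mul_left q hI
  have h2 : (q - 1) * (q + 1) * (q * I) + q * I ≤ q * (q * (q * I)) := by
    rcases Nat.eq_zero_or_pos q with rfl | h
    · simp
    · obtain ⟨r, rfl⟩ := Nat.exists_eq_add_of_le' h
      rw [Nat.add_sub_cancel]
      exact le_of_eq (by ring)
  omega

theorem lt_of_secant_bound {m q w I C N : ℕ} (hq : 2 ≤ q) (hI : q ≤ I)
    (hC : C = q * (q * (q * I))) (hN : N < (m + 1) * (q - (m + 1)) * ((q + 1) * I))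
    (h1 : m + 1 ≤ w) (h2 : w + m + 1 ≤ q) :
    (q - 1) * q * N < (C - q ^ 2) * (w * (q - w)) := by
  refine lt_of_lt_of_le ?_ (Nat.mul_le_mul (sq_sub_one_mul_le hI hC) (mul_sub_le_mul_sub h1 h2))
  refine lt_of_lt_of_le (Nat.mul_lt_mul_of_pos_left hN (Nat.mul_pos (by omega) (by omega)))
    (le_of_eq ?_)
  ring

variable {V : Type} [AddCommGroup V] [Module F V]

theorem exists_not_mem_span_singleton (hdim : 2 ≤ Module.finrank F V) (P : V) :
    ∃ b, b ∉ Submodule.span F {P} := by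
  by_contra! h
  have := finrank_le_one P fun w => Submodule.mem_span_singleton.mp (h w)
  omega

variable [Fintype F] [Fintype V]

theorem isConical_of_le_two (hdim : 3 ≤ Module.finrank F V) (hq : 3 ≤ Fintype.card F)
    {f : V → F} (hf : f ∈ hypCode F V) {J : ℕ} (hJ : 0 < J)
    (hV : Fintype.card V = Fintype.card F * (Fintype.card F * J))
    (hN : nzc f ≤ (Fintype.card F - 1) * (2 * J)) : IsConical f := by
  obtain ⟨s, hs⟩ := exists_line_sum hf
  refine isConical_of_hasApexes hf hs hq hdim (hasApexes_of_nzc_le hf hs hq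
    (exists_not_mem_span_singleton (by omega)) ?_) hJ hV ?_
  · rw [hV]
    refine (Nat.mul_le_mul_left _ hN).trans (le_of_eq ?_)
    ring
  · refine (Nat.mul_le_mul_left 2 hN).trans ?_
    generalize Fintype.card F = q at hq
    rw [← mul_assoc, mul_left_comm, ← mul_assoc, ← mul_assoc]
    refine Nat.mul_le_mul_right J ?_
    obtain ⟨r, rfl⟩ := Nat.exists_eq_add_of_le hq
    rw [show 3 + r - 1 = r + 2 by omega,
      show (3 + r) ^ 2 - (3 + r) = (3 + r) * (r + 2) by
        rw [sq, ← Nat.mul_sub_one]; congr 1; omega]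
    nlinarith

theorem isConical_of_lt_three (hdim : 3 ≤ Module.finrank F V) (hq : 7 ≤ Fintype.card F)
    {f : V → F} (hf : f ∈ hypCode F V) {I : ℕ} (hI : Fintype.card F ≤ I)
    (hV : Fintype.card V = Fintype.card F * (Fintype.card F * (Fintype.card F * I)))
    (hN : nzc f < 3 * (Fintype.card F - 3) * ((Fintype.card F + 1) * I)) : IsConical f := by
  obtain ⟨s, hs⟩ := exists_line_sum hf
  have hd : ∀ a, f a ≠ 0 → ∀ b ∉ Submodule.span F {a},
      lw f a b ≤ 1 ∨ Fintype.card F ≤ lw f a b + 2 := fun a ha b hb => by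
    have := lw_dichotomy hf (m := 2) (by omega)
      (fun w h1 h2 => lt_of_secant_bound (by omega) hI hV hN h1 h2) ha hb
    omega
  refine isConical_of_hasApexes hf hs (by omega) hdim (hasApexes_of_dichotomy hf hs (by omega)
    (exists_not_mem_span_singleton (by omega)) hd ?_)
    (Nat.mul_pos (by omega) (by omega) : 0 < Fintype.card F * I) hV ?_
  · refine lt_of_lt_of_le ?_ (Nat.mul_le_mul_right _ (sq_sub_one_mul_le hI hV))
    refine lt_of_lt_of_le (Nat.mul_lt_mul_of_pos_left hN (by positivity)) ?_
    generalize Fintype.card F = q at hq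
    obtain ⟨r, rfl⟩ := Nat.exists_eq_add_of_le hq
    rw [show 7 + r - 3 = r + 4 by omega, show 7 + r - 1 = r + 6 by omega,
      show 7 + r - 2 * 2 = r + 3 by omega, show 7 + r - 2 = r + 5 by omega]
    have : (7 + r) * (3 * (r + 4)) ≤ (r + 6) * ((r + 3) * (r + 5)) := by
      nlinarith [Nat.zero_le (r ^ 3), Nat.zero_le (r ^ 2)]
    calc _ = (7 + r) * (3 * (r + 4)) * ((7 + r) * (7 + r + 1) * I) := by ring
      _ ≤ (r + 6) * ((r + 3) * (r + 5)) * ((7 + r) * (7 + r + 1) * I) :=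
        Nat.mul_le_mul_right _ this
      _ = _ := by ring
  · refine (Nat.mul_le_mul_left 2 hN.le).trans ?_
    generalize Fintype.card F = q at hq
    obtain ⟨r, rfl⟩ := Nat.exists_eq_add_of_le hq
    rw [show 7 + r - 3 = r + 4 by omega,
      show (7 + r) ^ 2 - (7 + r) = (7 + r) * (r + 6) by
        rw [sq, ← Nat.mul_sub_one]; congr 1; omega]
    have : 2 * (3 * (r + 4) * (7 + r + 1)) ≤ ((7 + r) * (r + 6) + 2) * (7 + r) := by
      nlinarith [Nat.zero_le (r ^ 3), Nat.zero_le (r ^ 2)]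
    calc _ = 2 * (3 * (r + 4) * (7 + r + 1)) * I := by ring
      _ ≤ ((7 + r) * (r + 6) + 2) * (7 + r) * I := Nat.mul_le_mul_right _ this
      _ = _ := by ring

theorem isConical_of_lt_four (hdim : 3 ≤ Module.finrank F V) (hq : 29 ≤ Fintype.card F)
    {f : V → F} (hf : f ∈ hypCode F V) {I : ℕ} (hI : Fintype.card F ≤ I)
    (hV : Fintype.card V = Fintype.card F * (Fintype.card F * (Fintype.card F * I)))
    (hN : nzc f + 36 * Fintype.card F * I ≤ (4 * Fintype.card F ^ 2 + 32) * I) :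
    IsConical f := by
  obtain ⟨s, hs⟩ := exists_line_sum hf
  have hIpos : 0 < I := by omega
  have hN' : nzc f < 4 * (Fintype.card F - 4) * ((Fintype.card F + 1) * I) := by
    generalize Fintype.card F = q at *
    obtain ⟨r, rfl⟩ := Nat.exists_eq_add_of_le hq
    rw [show 29 + r - 4 = r + 25 by omega]
    nlinarith
  have hd : ∀ a, f a ≠ 0 → ∀ b ∉ Submodule.span F {a},
      lw f a b < 3 ∨ Fintype.card F ≤ lw f a b + 3 := fun a ha b hb =>
    lw_dichotomy hf (m := 3) (by omega)
      (fun w h1 h2 => lt_of_secant_bound (by omega) hI hV hN' h1 h2) ha hb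
  by_cases h3 : ∃ a b, f a ≠ 0 ∧ b ∉ Submodule.span F {a} ∧ lw f a b = 2
  · obtain ⟨a, b, ha, hb, hl⟩ := h3
    exact isConical_of_three_secant hdim hf hs hq hIpos hV hN hd ha hb hl
  have hd' : ∀ a, f a ≠ 0 → ∀ b ∉ Submodule.span F {a},
      lw f a b ≤ 1 ∨ Fintype.card F ≤ lw f a b + 3 := fun a ha b hb => by
    have h4 : lw f a b ≠ 2 := fun h => h3 ⟨a, b, ha, hb, h⟩
    have := hd a ha b hb
    omega
  refine isConical_of_hasApexes hf hs (by omega) hdim (hasApexes_of_dichotomy hf hs (by omega)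
    (exists_not_mem_span_singleton (by omega)) hd' ?_)
    (Nat.mul_pos (by omega) (by omega) : 0 < Fintype.card F * I) hV ?_
  · refine lt_of_lt_of_le ?_ (Nat.mul_le_mul_right _ (sq_sub_one_mul_le hI hV))
    refine lt_of_lt_of_le (Nat.mul_lt_mul_of_pos_left hN' (by positivity)) ?_
    generalize Fintype.card F = q at hq
    obtain ⟨r, rfl⟩ := Nat.exists_eq_add_of_le hq
    rw [show 29 + r - 3 = r + 26 by omega, show 29 + r - 1 = r + 28 by omega,
      show 29 + r - 2 * 3 = r + 23 by omega, show 29 + r - 4 = r + 25 by omega]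
    have : (29 + r) * (4 * (r + 25)) ≤ (r + 28) * ((r + 23) * (r + 26)) := by
      nlinarith [Nat.zero_le (r ^ 3), Nat.zero_le (r ^ 2)]
    calc _ = (29 + r) * (4 * (r + 25)) * ((29 + r) * (29 + r + 1) * I) := by ring
      _ ≤ (r + 28) * ((r + 23) * (r + 26)) * ((29 + r) * (29 + r + 1) * I) :=
        Nat.mul_le_mul_right _ this
      _ = _ := by ring
  · refine (Nat.mul_le_mul_left 2 hN'.le).trans ?_
    generalize Fintype.card F = q at hq
    obtain ⟨r, rfl⟩ := Nat.exists_eq_add_of_le hq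
    rw [show 29 + r - 4 = r + 25 by omega,
      show (29 + r) ^ 2 - (29 + r) = (29 + r) * (r + 28) by
        rw [sq, ← Nat.mul_sub_one]; congr 1; omega]
    have : 2 * (4 * (r + 25) * (29 + r + 1)) ≤ ((29 + r) * (r + 28) + 2) * (29 + r) := by
      nlinarith [Nat.zero_le (r ^ 3), Nat.zero_le (r ^ 2)]
    calc _ = 2 * (4 * (r + 25) * (29 + r + 1)) * I := by ring
      _ ≤ ((29 + r) * (r + 28) + 2) * (29 + r) * I := Nat.mul_le_mul_right _ this
      _ = _ := by ring

end WeightRanges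

section Bound

theorem eq_of_prime_of_dvd_pow {p h r s : ℕ} (hp : p.Prime) (hr : r.Prime) (hs : s.Prime)
    (h1 : r ∣ p ^ h) (h2 : s ∣ p ^ h) : r = s :=
  ((Nat.prime_dvd_prime_iff_eq hr hp).mp (hr.dvd_of_dvd_pow h1)).trans
    ((Nat.prime_dvd_prime_iff_eq hs hp).mp (hs.dvd_of_dvd_pow h2)).symm

theorem weight_ranges {p h q n W : ℕ} (hp : p.Prime) (hq : q = p ^ h)
    (hW : (W : ℝ) ≤ B n q) :
    W ≤ 2 * q ^ (n - 1) ∨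
    (7 ≤ q ∧ (q - 1) * W < 3 * (q - 3) * ((q + 1) * q ^ (n - 2))) ∨
    (29 ≤ q ∧ W + 32 * q ^ (n - 2) ≤ 4 * q * q ^ (n - 2)) := by
  have hpp : ∀ r s : ℕ, r.Prime → s.Prime → r ∣ q → s ∣ q → r = s := fun r s hr hs h1 h2 =>
    eq_of_prime_of_dvd_pow hp hr hs (hq ▸ h1) (hq ▸ h2)
  have hIpos : 0 < q ^ (n - 2) := by rw [hq]; exact pow_pos (pow_pos hp.pos _) _
  have hcast : ((q ^ (n - 2) : ℕ) : ℝ) = (q : ℝ) ^ (n - 2) := Nat.cast_pow q (n - 2)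
  have mid : ∀ β : ℕ, (W : ℝ) ≤ (β / 2 : ℝ) * (q : ℝ) ^ (n - 2) → 7 ≤ q →
      (q - 1) * β < 2 * (3 * (q - 3) * (q + 1)) →
      7 ≤ q ∧ (q - 1) * W < 3 * (q - 3) * ((q + 1) * q ^ (n - 2)) := by
    intro β h1 h2 h3
    refine ⟨h2, ?_⟩
    have h4 : 2 * W ≤ β * q ^ (n - 2) := by
      rw [← hcast] at h1
      have : (2 : ℝ) * W ≤ β * ((q ^ (n - 2) : ℕ) : ℝ) := by linarith
      exact_mod_cast this
    have h5 := Nat.mul_le_mul_left (q - 1) h4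
    have h6 := Nat.mul_lt_mul_of_pos_right h3 hIpos
    nlinarith
  have large : (W : ℝ) ≤ (4 * q - 32) * (q : ℝ) ^ (n - 2) → 29 ≤ q →
      29 ≤ q ∧ W + 32 * q ^ (n - 2) ≤ 4 * q * q ^ (n - 2) := by
    intro h1 h2
    refine ⟨h2, ?_⟩
    rw [← hcast] at h1
    have : (W : ℝ) + 32 * ((q ^ (n - 2) : ℕ) : ℝ) ≤ 4 * q * ((q ^ (n - 2) : ℕ) : ℝ) := by linarith
    exact_mod_cast this
  have hI0 : (0 : ℝ) ≤ (q : ℝ) ^ (n - 2) := by positivity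
  have bound : ∀ {x y : ℝ}, (W : ℝ) ≤ x * (q : ℝ) ^ (n - 2) → x ≤ y →
      (W : ℝ) ≤ y * (q : ℝ) ^ (n - 2) := fun h1 h2 =>
    h1.trans (mul_le_mul_of_nonneg_right h2 hI0)
  have root : ∀ a b : ℕ, a * a ≤ b → (a : ℝ) ≤ Real.sqrt b := by
    intro a b hab
    refine Real.le_sqrt_of_sq_le ?_
    rw [sq]
    exact_mod_cast hab
  unfold B at hW
  split_ifs at hW with c1 c2 c3 c4
  · left
    exact_mod_cast hW
  · right; left
    rcases c2 with rfl | rfl | rfl | rfl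
    · have := root 6 (6 * 7) (by norm_num)
      refine mid 29 (bound hW ?_) (by norm_num) (by norm_num)
      push_cast at this ⊢
      linarith
    · have := root 8 (6 * 11) (by norm_num)
      refine mid 49 (bound hW ?_) (by norm_num) (by norm_num)
      push_cast at this ⊢
      linarith
    · have := root 8 (6 * 13) (by norm_num)
      refine mid 61 (bound hW ?_) (by norm_num) (by norm_num)
      push_cast at this ⊢
      linarith
    · have := root 10 (6 * 17) (by norm_num)
      refine mid 81 (bound hW ?_) (by norm_num) (by norm_num)
      push_cast at this ⊢
      linarith
  · right
    rcases c3 with rfl | rfl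
    · left
      have := root 10 (6 * 19) (by norm_num)
      refine mid 103 (bound hW ?_) (by norm_num) (by norm_num)
      push_cast at this ⊢
      linarith
    · right
      have := root 0 (6 * 121) (by norm_num)
      refine large (bound hW ?_) (by norm_num)
      push_cast at this ⊢
      linarith
  · right; right
    have := root 5 q (by omega)
    refine large (bound hW ?_) (by omega)
    push_cast at this
    linarith
  · right
    by_cases h23 : q = 23
    · left
      subst h23
      have := root 13 (8 * 23) (by norm_num)
      refine mid 125 (bound hW ?_) (by norm_num) (by norm_num)
      push_cast at this ⊢
      linarith
    · right
      have hnd : ∀ r s : ℕ, r.Prime → s.Prime → r ≠ s → ¬ r * s ∣ q := fun r s hr hs hrs hd =>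
        hrs (hpp r s hr hs (dvd_of_mul_right_dvd hd) (dvd_of_mul_left_dvd hd))
      have h6 := hnd 2 3 (by norm_num) (by norm_num) (by norm_num)
      have h10 := hnd 2 5 (by norm_num) (by norm_num) (by norm_num)
      have h14 := hnd 2 7 (by norm_num) (by norm_num) (by norm_num)
      have h22 := hnd 2 11 (by norm_num) (by norm_num) (by norm_num)
      have h26 := hnd 2 13 (by norm_num) (by norm_num) (by norm_num)
      have h15 := hnd 3 5 (by norm_num) (by norm_num) (by norm_num)
      have h21 := hnd 3 7 (by norm_num) (by norm_num) (by norm_num)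
      have h33 : 33 ≤ q := by
        clear hnd hpp mid large bound root hW hq hI0 hcast hIpos
        by_contra h
        have h7 : 7 ≤ q := by omega
        interval_cases q <;> omega
      have := root 16 (8 * q) (by omega)
      refine large (bound hW ?_) (by omega)
      push_cast at this
      linarith

end Bound

/-- Theorem 8 of the paper: a code word of `C_{n-1}(n,q)` of weight at most
`B_{n,q}` is a linear combination of incidence vectors of hyperplanes through a fixed
`(n-3)`-space (linear dimension `n-2`). -/
theorem statement0 [Fintype F] {p h q n : ℕ} [Fact p.Prime] (hh : 1 ≤ h) (hq : q = p ^ h)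
    (hF : Fintype.card F = q) (hn : 3 ≤ n)
    (c : Pt F n → ZMod p) (hc : c ∈ code F p n) (hwt : (wt c : ℝ) ≤ B n q) :
    ∃ κ : Submodule F (Fin (n + 1) → F), Module.finrank F κ = n - 2 ∧
      ∃ (s : Finset (Submodule F (Fin (n + 1) → F)))
        (a : Submodule F (Fin (n + 1) → F) → ZMod p),
        (∀ H ∈ s, Module.finrank F H = n ∧ κ ≤ H) ∧
        c = ∑ H ∈ s, a H • incVec p H := by
  have hp : p.Prime := Fact.out
  have hchar : CharP F p := by
    obtain ⟨r, hr⟩ := CharP.exists F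
    obtain ⟨m, hr', hm⟩ := FiniteField.card F r
    rw [hF, hq] at hm
    have := (Nat.prime_dvd_prime_iff_eq hp hr').mp
      (hp.dvd_of_dvd_pow (hm ▸ dvd_pow_self p (by omega)))
    rwa [this]
  let _ : Algebra (ZMod p) F := ZMod.algebra F p
  refine statement_of_isConical ?_
  have hf := toVec_mem hc
  have hN := nzc_toVec c
  have hdim : 3 ≤ Module.finrank F (Fin (n + 1) → F) := by
    rw [Module.finrank_fin_fun]; omega
  have hq2 : 2 ≤ q := hF ▸ Fintype.one_lt_card
  by_cases h2 : q = 2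
  · exact isConical_of_card_two hdim (hF.trans h2) hf
  have hV : Fintype.card (Fin (n + 1) → F) = q ^ (n + 1) := by simp [hF]
  obtain ⟨k, rfl⟩ := Nat.exists_eq_add_of_le hn
  have hI : q ≤ q ^ (3 + k - 2) := Nat.le_self_pow (by omega) q
  have hVI : Fintype.card (Fin (3 + k + 1) → F) = q * (q * (q * q ^ (3 + k - 2))) := by
    rw [hV, show 3 + k + 1 = (3 + k - 2) + 1 + 1 + 1 by omega]
    ring
  rcases weight_ranges hp hq hwt with hw | ⟨h7, hw⟩ | ⟨h29, hw⟩
  · refine isConical_of_le_two hdim (by omega) hf (J := q ^ (3 + k - 1)) (by positivity) ?_ ?_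
    · rw [hF, hV, show 3 + k + 1 = (3 + k - 1) + 1 + 1 by omega]
      ring
    · rw [hN, hF]
      exact Nat.mul_le_mul_left _ hw
  · refine isConical_of_lt_three hdim (by omega) hf (I := q ^ (3 + k - 2)) (by rwa [hF])
      (by rw [hF, hVI]) ?_
    rw [hN, hF]
    exact hw
  · refine isConical_of_lt_four hdim (by omega) hf (I := q ^ (3 + k - 2)) (by rwa [hF])
      (by rw [hF, hVI]) ?_
    rw [hN, hF]
    obtain ⟨r, hr⟩ := Nat.exists_eq_add_of_le' hq2
    generalize q ^ (3 + k - 2) = I at hw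
    have h3 := Nat.mul_le_mul_left (q - 1) hw
    rw [hr, show r + 2 - 1 = r + 1 by omega] at h3 ⊢
    nlinarith

end PGCode
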